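/- Let Φ={φ_i}_{i∈Λ} be an analytic IFS on I=[0,1] with 0<|φ_i'(x)|<1 for all i∈Λ and x∈I, whose maps have no common fixed point, let p be a positive probability vector and μ the associated self-conformal measure, and suppose μ is exact dimensional with dim μ < 1. Then for each integer k≥1 and each 0<ε<1 there exists ρ=ρ(k,ε)>0 and N=N(k,ε)≥1 such that for all n≥N the following holds: if ν is a compactly supported Borel probability measure on P_k such that ‖q‖_2 ≤ ε^{-1} and |q'(x)| ≥ ε for all q∈supp(ν) and x∈I, and (1/n)H(ν,D_n) ≥ ε, and ψ:I→I is a C¹ map with ε ≤ |ψ'(x)| ≤ ε^{-1} for all x∈I, then (1/n)H(ν.(ψμ), D_n) ≥ dim μ + ρ. -/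

import Mathlib

open MeasureTheory Filter Set Metric Topology

noncomputable section

/-- The unit interval `I = [0,1]`. -/
def unitI : Set ℝ := Set.Icc 0 1

/-- For a word `u = i₁…iₙ`, `compWord φ u = φ_{i₁} ∘ … ∘ φ_{iₙ}`. -/
def compWord {Λ : Type*} (φ : Λ → ℝ → ℝ) : List Λ → ℝ → ℝ
  | [] => id
  | i :: u => φ i ∘ compWord φ u

/-- `μ` is exact dimensional with dimension `d`. -/
def ExactDimWith (μ : Measure ℝ) (d : ℝ) : Prop :=
  ∀ᵐ x ∂μ, Tendsto (fun δ : ℝ =>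
      Real.log (μ (Metric.closedBall x δ)).toReal / Real.log δ)
    (nhdsWithin 0 (Set.Ioi 0)) (nhds d)

/-- The space `P_k` of polynomials of degree at most `k`, identified with `ℝ^{k+1}`
via coefficients; `polyEval k a` is the corresponding polynomial function. -/
def polyEval (k : ℕ) (a : EuclideanSpace ℝ (Fin (k + 1))) (x : ℝ) : ℝ :=
  ∑ j : Fin (k + 1), a j * x ^ (j : ℕ)

/-- The level-`n` dyadic interval `[m/2^n, (m+1)/2^n)`. -/
def dyadIco (n : ℕ) (m : ℤ) : Set ℝ :=
  Set.Ico ((m : ℝ) / 2 ^ n) (((m : ℝ) + 1) / 2 ^ n)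

/-- Entropy of a measure on `ℝ` with respect to the level-`n` dyadic partition
(logarithms in base 2). -/
def ent1 (n : ℕ) (θ : Measure ℝ) : ℝ :=
  -∑' m : ℤ, (θ (dyadIco n m)).toReal * Real.logb 2 (θ (dyadIco n m)).toReal

/-- The level-`n` dyadic cell of `ℝ^d` indexed by `m : Fin d → ℤ`. -/
def vcell (d n : ℕ) (m : Fin d → ℤ) : Set (EuclideanSpace ℝ (Fin d)) :=
  {x | ∀ j, x j ∈ Set.Ico ((m j : ℝ) / 2 ^ n) (((m j : ℝ) + 1) / 2 ^ n)}

/-- Entropy of a measure on `ℝ^d ≃ P_{d-1}` with respect to the level-`n` dyadic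
partition (logarithms in base 2). -/
def entV (d n : ℕ) (θ : Measure (EuclideanSpace ℝ (Fin d))) : ℝ :=
  -∑' m : Fin d → ℤ,
    (θ (vcell d n m)).toReal * Real.logb 2 (θ (vcell d n m)).toReal

/-- The topological support of a measure. -/
def msupp {X : Type*} [TopologicalSpace X] [MeasurableSpace X] (θ : Measure X) : Set X :=
  {x | ∀ U : Set X, IsOpen U → x ∈ U → θ U ≠ 0}

/-- The convolution `ν.θ`: the pushforward of `ν × θ` under `(q, x) ↦ q(x)`. -/
def pact (k : ℕ) (ν : Measure (EuclideanSpace ℝ (Fin (k + 1)))) (θ : Measure ℝ) :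
    Measure ℝ :=
  (ν.prod θ).map fun q => polyEval k q.1 q.2

/-- Finitely supported (signed) measures on `A`; the ring structure is convolution. -/
abbrev FinMeas (A : Type*) := AddMonoidAlgebra ℝ A

namespace FinMeas

variable {A B C : Type*}

/-- Pushforward of finitely supported measures. -/
def push (f : A → B) : FinMeas A →ₗ[ℝ] FinMeas B where
  toFun := AddMonoidAlgebra.mapDomain f
  map_add' := AddMonoidAlgebra.mapDomain_add f
  map_smul' c x := by
    ext
    simp [AddMonoidAlgebra.mapDomain, Finsupp.mapDomain_smul]

/-- The Dirac mass at `a`. -/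
def dirac (a : A) : FinMeas A := AddMonoidAlgebra.single a 1

/-- Nonnegativity of all weights. -/
def Nonneg (ζ : FinMeas A) : Prop := ∀ x, 0 ≤ ζ.coeff x

/-- Total mass. -/
def mass (ζ : FinMeas A) : ℝ := (push (fun _ => ()) ζ).coeff ()

/-- Finitely supported probability measures. -/
def IsProb (ζ : FinMeas A) : Prop := Nonneg ζ ∧ mass ζ = 1

/-- Shannon entropy (natural logarithm). -/
def ent (ζ : FinMeas A) : ℝ := ζ.coeff.sum fun _ p => Real.negMulLog p

/-- Conditional entropy of the identity given `f`. -/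
def condEnt (f : A → B) (ζ : FinMeas A) : ℝ := ent ζ - ent (push f ζ)

lemma push_push (f : A → B) (g : B → C) (ζ : FinMeas A) :
    push g (push f ζ) = push (g ∘ f) ζ := by
  ext
  simp [push, AddMonoidAlgebra.mapDomain, Finsupp.mapDomain_comp]

lemma push_id (ζ : FinMeas A) : push id ζ = ζ := by
  ext
  simp [push, AddMonoidAlgebra.mapDomain, Finsupp.mapDomain_id]

@[simp] lemma push_dirac (f : A → B) (a : A) : push f (dirac a) = dirac (f a) := by
  simp [push, dirac]

lemma push_congr {f g : A → B} {ζ : FinMeas A} (h : ∀ x ∈ ζ.coeff.support, f x = g x) :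
    push f ζ = push g ζ := by
  ext1
  exact Finsupp.mapDomain_congr h

lemma coeff_push [DecidableEq B] (f : A → B) (ζ : FinMeas A) {s : Finset A}
    (hs : ζ.coeff.support ⊆ s) (b : B) :
    (push f ζ).coeff b = ∑ x ∈ s with f x = b, ζ.coeff x := by
  classical
  have : (push f ζ).coeff b = ∑ x ∈ ζ.coeff.support, if f x = b then ζ.coeff x else 0 := by
    simp only [push, LinearMap.coe_mk, AddHom.coe_mk, AddMonoidAlgebra.mapDomain,
      Finsupp.mapDomain, Finsupp.sum, Finsupp.coe_finsetSum, Finset.sum_apply,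
      Finsupp.single_apply]
  rw [this, Finset.sum_filter]
  refine Finset.sum_subset hs fun x _ hx => ?_
  simp only [Finsupp.mem_support_iff, not_not] at hx
  simp [hx]

lemma mass_eq_sum (ζ : FinMeas A) {s : Finset A} (hs : ζ.coeff.support ⊆ s) :
    mass ζ = ∑ x ∈ s, ζ.coeff x := by
  classical
  rw [mass, coeff_push _ _ hs]
  simp

lemma mass_push (f : A → B) (ζ : FinMeas A) : mass (push f ζ) = mass ζ := by
  rw [mass, push_push]; rfl

lemma mass_smul (c : ℝ) (ζ : FinMeas A) : mass (c • ζ) = c * mass ζ := by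
  simp [mass]

lemma mass_sum {ι : Type*} (s : Finset ι) (ζ : ι → FinMeas A) :
    mass (∑ i ∈ s, ζ i) = ∑ i ∈ s, mass (ζ i) := by
  simp [mass]

@[simp] lemma mass_dirac (a : A) : mass (dirac a) = 1 := by
  rw [mass, push_dirac]; simp [dirac]

lemma Nonneg.push {ζ : FinMeas A} (h : Nonneg ζ) (f : A → B) : Nonneg (push f ζ) := by
  classical
  intro b
  rw [coeff_push f ζ subset_rfl]
  exact Finset.sum_nonneg fun x _ => h x

lemma Nonneg.add {ζ ξ : FinMeas A} (h : Nonneg ζ) (h' : Nonneg ξ) : Nonneg (ζ + ξ) :=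
  fun x => by simpa using add_nonneg (h x) (h' x)

lemma Nonneg.smul {ζ : FinMeas A} (h : Nonneg ζ) {c : ℝ} (hc : 0 ≤ c) : Nonneg (c • ζ) :=
  fun x => by simpa using mul_nonneg hc (h x)

lemma Nonneg.sum {ι : Type*} {s : Finset ι} {ζ : ι → FinMeas A} (h : ∀ i ∈ s, Nonneg (ζ i)) :
    Nonneg (∑ i ∈ s, ζ i) := fun x => by
  simpa using Finset.sum_nonneg fun i hi => h i hi x

lemma nonneg_dirac (a : A) : Nonneg (dirac a) := fun x => by
  classical
  simp only [dirac, AddMonoidAlgebra.coeff_single, Finsupp.single_apply]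
  split_ifs <;> norm_num

lemma isProb_dirac (a : A) : IsProb (dirac a) := ⟨nonneg_dirac a, mass_dirac a⟩

lemma IsProb.push {ζ : FinMeas A} (h : IsProb ζ) (f : A → B) : IsProb (push f ζ) :=
  ⟨h.1.push f, by rw [mass_push, h.2]⟩

lemma IsProb.mix {ι : Type*} {s : Finset ι} {c : ι → ℝ} {ζ : ι → FinMeas A}
    (hc : ∀ i ∈ s, 0 ≤ c i) (hc1 : ∑ i ∈ s, c i = 1) (h : ∀ i ∈ s, IsProb (ζ i)) :
    IsProb (∑ i ∈ s, c i • ζ i) := by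
  refine ⟨Nonneg.sum fun i hi => (h i hi).1.smul (hc i hi), ?_⟩
  rw [mass_sum, ← hc1]
  exact Finset.sum_congr rfl fun i hi => by rw [mass_smul, (h i hi).2, mul_one]

lemma eq_sum_dirac (ζ : FinMeas A) {s : Finset A} (hs : ζ.coeff.support ⊆ s) :
    ζ = ∑ x ∈ s, ζ.coeff x • dirac x := by
  conv_lhs => rw [← AddMonoidAlgebra.sum_coeff_single ζ]
  rw [Finsupp.sum_of_support_subset _ hs _ (by simp)]
  exact Finset.sum_congr rfl fun x _ => by simp [dirac]

lemma ent_eq_sum (ζ : FinMeas A) {s : Finset A} (hs : ζ.coeff.support ⊆ s) :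
    ent ζ = ∑ x ∈ s, Real.negMulLog (ζ.coeff x) :=
  Finsupp.sum_of_support_subset _ hs _ (by simp)

lemma ent_push_eq (f : A → B) (ζ : FinMeas A) {s : Finset A} (hs : ζ.coeff.support ⊆ s) :
    ent (push f ζ) = ∑ x ∈ s, -(ζ.coeff x * Real.log ((push f ζ).coeff (f x))) := by
  classical
  have h1 : (push f ζ).coeff.support ⊆ s.image f := by
    intro b hb
    rw [Finsupp.mem_support_iff, coeff_push f ζ hs] at hb
    obtain ⟨x, hx, -⟩ := Finset.exists_ne_zero_of_sum_ne_zero hb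
    rw [Finset.mem_filter] at hx
    exact Finset.mem_image.2 ⟨x, hx.1, hx.2⟩
  rw [ent_eq_sum _ h1, ← Finset.sum_fiberwise_of_maps_to (g := f) (t := s.image f)
    fun x hx => Finset.mem_image_of_mem f hx]
  refine Finset.sum_congr rfl fun b _ => ?_
  have : ∀ x ∈ s.filter (fun x => f x = b),
      -(ζ.coeff x * Real.log ((push f ζ).coeff (f x)))
        = ζ.coeff x * -Real.log ((push f ζ).coeff b) := by
    intro x hx
    rw [(Finset.mem_filter.1 hx).2]; ring
  rw [Finset.sum_congr rfl this, ← Finset.sum_mul, ← coeff_push f ζ hs, Real.negMulLog]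
  ring

lemma condEnt_eq (f : A → B) (ζ : FinMeas A) {s : Finset A} (hs : ζ.coeff.support ⊆ s) :
    condEnt f ζ = ∑ x ∈ s,
      ζ.coeff x * (Real.log ((push f ζ).coeff (f x)) - Real.log (ζ.coeff x)) := by
  rw [condEnt, ent_eq_sum ζ hs, ent_push_eq f ζ hs, ← Finset.sum_sub_distrib]
  refine Finset.sum_congr rfl fun x _ => ?_
  rw [Real.negMulLog]; ring

lemma Nonneg.coeff_le_push {ζ : FinMeas A} (h : Nonneg ζ) (f : A → B) (x : A) :
    ζ.coeff x ≤ (FinMeas.push f ζ).coeff (f x) := by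
  classical
  rw [coeff_push f ζ (s := insert x ζ.coeff.support) (Finset.subset_insert _ _)]
  exact Finset.single_le_sum (f := fun x => ζ.coeff x) (fun y _ => h y) (by simp)

lemma mul_log_superadd {a b y z : ℝ} (ha : 0 ≤ a) (hb : 0 ≤ b) (hy : a ≤ y) (hz : b ≤ z) :
    a * (Real.log y - Real.log a) + b * (Real.log z - Real.log b)
      ≤ (a + b) * (Real.log (y + z) - Real.log (a + b)) := by
  rcases ha.eq_or_lt with rfl | ha
  · rcases hb.eq_or_lt with rfl | hb
    · simp
    · have := Real.log_le_log (hb.trans_le hz) (by linarith : z ≤ y + z)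
      simp only [zero_mul, zero_add]
      gcongr
  rcases hb.eq_or_lt with rfl | hb
  · have := Real.log_le_log (ha.trans_le hy) (by linarith : y ≤ y + z)
    simp only [zero_mul, add_zero]
    gcongr
  have hy0 := ha.trans_le hy
  have hz0 := hb.trans_le hz
  have key : ∀ c w : ℝ, 0 < c → 0 < w →
      c * (Real.log w - Real.log c - Real.log (y + z) + Real.log (a + b))
        ≤ w * (a + b) / (y + z) - c := by
    intro c w hc hw
    have h := Real.log_le_sub_one_of_pos (x := w * (a + b) / (c * (y + z))) (by positivity)
    rw [Real.log_div (by positivity) (by positivity), Real.log_mul hw.ne' (by positivity),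
      Real.log_mul hc.ne' (by positivity)] at h
    calc _ = c * (Real.log w + Real.log (a + b) - (Real.log c + Real.log (y + z))) := by ring
      _ ≤ c * (w * (a + b) / (c * (y + z)) - 1) := by gcongr
      _ = _ := by field_simp
  have h1 := key a y ha hy0
  have h2 := key b z hb hz0
  have h3 : y * (a + b) / (y + z) + z * (a + b) / (y + z) = a + b := by field_simp
  linarith

lemma condEnt_add_le {f : A → B} {ζ ξ : FinMeas A} (h : Nonneg ζ) (h' : Nonneg ξ) :
    condEnt f ζ + condEnt f ξ ≤ condEnt f (ζ + ξ) := by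
  classical
  have hs : (ζ + ξ).coeff.support ⊆ ζ.coeff.support ∪ ξ.coeff.support := Finsupp.support_add
  rw [condEnt_eq f ζ Finset.subset_union_left, condEnt_eq f ξ Finset.subset_union_right,
    condEnt_eq f _ hs, ← Finset.sum_add_distrib]
  refine Finset.sum_le_sum fun x _ => ?_
  simpa using mul_log_superadd (h x) (h' x) (h.coeff_le_push f x) (h'.coeff_le_push f x)

lemma condEnt_smul {f : A → B} {ζ : FinMeas A} (h : Nonneg ζ) {c : ℝ} (hc : 0 ≤ c) :
    condEnt f (c • ζ) = c * condEnt f ζ := by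
  rcases hc.eq_or_lt with rfl | hc
  · simp [condEnt, ent]
  rw [condEnt_eq f (c • ζ) (s := ζ.coeff.support) (Finsupp.support_smul),
    condEnt_eq f ζ subset_rfl, Finset.mul_sum]
  refine Finset.sum_congr rfl fun x hx => ?_
  have hx : 0 < ζ.coeff x := lt_of_le_of_ne (h x) (Finsupp.mem_support_iff.1 hx).symm
  have := hx.trans_le (h.coeff_le_push f x)
  simp only [map_smul, AddMonoidAlgebra.coeff_smul, Finsupp.coe_smul, Pi.smul_apply, smul_eq_mul]
  rw [Real.log_mul hc.ne' this.ne', Real.log_mul hc.ne' hx.ne']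
  ring

/-- Conditional entropy is concave. -/
lemma sum_condEnt_le {ι : Type*} (f : A → B) (s : Finset ι) {c : ι → ℝ} {ζ : ι → FinMeas A}
    (hc : ∀ i ∈ s, 0 ≤ c i) (h : ∀ i ∈ s, Nonneg (ζ i)) :
    ∑ i ∈ s, c i * condEnt f (ζ i) ≤ condEnt f (∑ i ∈ s, c i • ζ i) := by
  classical
  induction s using Finset.induction_on with
  | empty => simp [condEnt, ent]
  | insert i s hi ih =>
    rw [Finset.sum_insert hi, Finset.sum_insert hi]
    simp only [Finset.mem_insert, forall_eq_or_imp] at hc h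
    have h1 := ih hc.2 h.2
    have h2 := condEnt_add_le (f := f) (h.1.smul hc.1)
      (Nonneg.sum fun i hi => (h.2 i hi).smul (hc.2 i hi))
    rw [condEnt_smul h.1 hc.1] at h2
    linarith

lemma condEnt_nonneg {f : A → B} {ζ : FinMeas A} (h : Nonneg ζ) : 0 ≤ condEnt f ζ := by
  rw [condEnt_eq f ζ subset_rfl]
  refine Finset.sum_nonneg fun x hx => mul_nonneg (h x) (sub_nonneg.2 ?_)
  have hx : 0 < ζ.coeff x := lt_of_le_of_ne (h x) (Finsupp.mem_support_iff.1 hx).symm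
  exact Real.log_le_log hx (h.coeff_le_push f x)

lemma ent_push_le {ζ : FinMeas A} (h : Nonneg ζ) (f : A → B) : ent (push f ζ) ≤ ent ζ :=
  sub_nonneg.1 (condEnt_nonneg h)

/-- Gibbs' inequality, conditional form. -/
lemma condEnt_le_of_ref {f : A → B} {ζ : FinMeas A} (h : Nonneg ζ) {q : A → ℝ}
    (hq : ∀ x ∈ ζ.coeff.support, 0 < q x)
    (hq1 : ∀ (b : B) (s : Finset A), s ⊆ ζ.coeff.support → (∀ x ∈ s, f x = b) →
      ∑ x ∈ s, q x ≤ 1) :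
    condEnt f ζ ≤ ∑ x ∈ ζ.coeff.support, ζ.coeff x * -Real.log (q x) := by
  classical
  rw [condEnt_eq f ζ subset_rfl]
  have h1 : ∀ x ∈ ζ.coeff.support,
      ζ.coeff x * (Real.log ((push f ζ).coeff (f x)) - Real.log (ζ.coeff x))
        ≤ ζ.coeff x * -Real.log (q x) + ((push f ζ).coeff (f x) * q x - ζ.coeff x) := by
    intro x hx
    have hq := hq x hx
    have hx : 0 < ζ.coeff x := lt_of_le_of_ne (h x) (Finsupp.mem_support_iff.1 hx).symm
    have hz := hx.trans_le (h.coeff_le_push f x)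
    have h2 := Real.log_le_sub_one_of_pos
      (x := (push f ζ).coeff (f x) * q x / ζ.coeff x) (by positivity)
    rw [Real.log_div (by positivity) hx.ne', Real.log_mul hz.ne' hq.ne'] at h2
    have h3 := mul_le_mul_of_nonneg_left h2 hx.le
    have h4 : ζ.coeff x * ((push f ζ).coeff (f x) * q x / ζ.coeff x - 1)
      = (push f ζ).coeff (f x) * q x - ζ.coeff x := by field_simp
    linarith
  refine (Finset.sum_le_sum h1).trans ?_
  rw [Finset.sum_add_distrib, Finset.sum_sub_distrib, ← mass_eq_sum ζ subset_rfl]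
  suffices ∑ x ∈ ζ.coeff.support, (push f ζ).coeff (f x) * q x ≤ mass ζ by linarith
  rw [← Finset.sum_fiberwise_of_maps_to (g := f) (t := ζ.coeff.support.image f)
    fun x hx => Finset.mem_image_of_mem f hx, mass_eq_sum ζ subset_rfl,
    ← Finset.sum_fiberwise_of_maps_to (g := f) (t := ζ.coeff.support.image f)
    fun x hx => Finset.mem_image_of_mem f hx]
  refine Finset.sum_le_sum fun b _ => ?_
  rw [← coeff_push f ζ subset_rfl]
  calc _ = ∑ x ∈ ζ.coeff.support with f x = b, (push f ζ).coeff b * q x :=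
        Finset.sum_congr rfl fun x hx => by rw [(Finset.mem_filter.1 hx).2]
    _ = (push f ζ).coeff b * ∑ x ∈ ζ.coeff.support with f x = b, q x := by
        rw [Finset.mul_sum]
    _ ≤ (push f ζ).coeff b * 1 := by
        gcongr
        · exact h.push f b
        · exact hq1 b _ (Finset.filter_subset _ _) fun x hx => (Finset.mem_filter.1 hx).2
    _ = _ := mul_one _

lemma condEnt_le_log_card {f : A → B} {ζ : FinMeas A} (h : Nonneg ζ) {N : ℝ} (hN : 0 < N)
    (hcard : ∀ (b : B) (s : Finset A), s ⊆ ζ.coeff.support → (∀ x ∈ s, f x = b) →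
      (s.card : ℝ) ≤ N) :
    condEnt f ζ ≤ mass ζ * Real.log N := by
  refine (condEnt_le_of_ref h (q := fun _ => N⁻¹) (fun _ _ => by positivity) ?_).trans ?_
  · intro b s hs hb
    rw [Finset.sum_const, nsmul_eq_mul]
    have := hcard b s hs hb
    rw [← div_eq_mul_inv, div_le_one hN]
    exact this
  · rw [mass_eq_sum ζ subset_rfl, Finset.sum_mul]
    simp

lemma ent_dirac (a : A) : ent (dirac a) = 0 := by
  classical
  simp [ent, dirac]

lemma IsProb.push_unit {ζ : FinMeas A} (h : IsProb ζ) :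
    FinMeas.push (fun _ => ()) ζ = dirac () := by
  ext
  have := h.2
  rw [mass] at this
  simp [this, dirac]

lemma IsProb.ent_eq_condEnt {ζ : FinMeas A} (h : IsProb ζ) :
    ent ζ = condEnt (fun _ => ()) ζ := by
  rw [condEnt, h.push_unit, ent_dirac, sub_zero]

lemma IsProb.ent_nonneg {ζ : FinMeas A} (h : IsProb ζ) : 0 ≤ ent ζ :=
  h.ent_eq_condEnt ▸ condEnt_nonneg h.1

lemma IsProb.ent_le_log_card {ζ : FinMeas A} (h : IsProb ζ) {N : ℝ} (hN : 0 < N)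
    (hcard : (ζ.coeff.support.card : ℝ) ≤ N) : ent ζ ≤ Real.log N := by
  have := condEnt_le_log_card (f := fun _ => ()) h.1 hN fun _ s hs _ =>
    (Nat.cast_le.2 (Finset.card_le_card hs)).trans hcard
  rwa [h.2, one_mul, ← h.ent_eq_condEnt] at this

lemma IsProb.ent_le_of_ref {ζ : FinMeas A} (h : IsProb ζ) {q : A → ℝ}
    (hq : ∀ x ∈ ζ.coeff.support, 0 < q x) (hq1 : ∑ x ∈ ζ.coeff.support, q x ≤ 1) :
    ent ζ ≤ ∑ x ∈ ζ.coeff.support, ζ.coeff x * -Real.log (q x) := by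
  rw [h.ent_eq_condEnt]
  refine condEnt_le_of_ref h.1 hq fun _ s hs _ => le_trans ?_ hq1
  exact Finset.sum_le_sum_of_subset_of_nonneg hs fun x hx _ => (hq x hx).le

lemma sum_ent_le {ι : Type*} (s : Finset ι) {c : ι → ℝ} {ζ : ι → FinMeas A}
    (hc : ∀ i ∈ s, 0 ≤ c i) (hc1 : ∑ i ∈ s, c i = 1) (h : ∀ i ∈ s, IsProb (ζ i)) :
    ∑ i ∈ s, c i * ent (ζ i) ≤ ent (∑ i ∈ s, c i • ζ i) := by
  rw [(IsProb.mix hc hc1 h).ent_eq_condEnt]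
  refine le_trans (le_of_eq ?_) (sum_condEnt_le _ s hc fun i hi => (h i hi).1)
  exact Finset.sum_congr rfl fun i hi => by rw [(h i hi).ent_eq_condEnt]

/-- If `f` determines `g` up to `N` values, the entropy of `g` exceeds that of `f` by at most
`log N`. -/
lemma IsProb.ent_push_le_add_log {ζ : FinMeas A} (h : IsProb ζ) (f : A → B) (g : A → C) {N : ℝ}
    (hN : 0 < N)
    (hcard : ∀ b : B, ∀ s : Finset C, (∀ c ∈ s, ∃ x ∈ ζ.coeff.support, f x = b ∧ g x = c) →
      (s.card : ℝ) ≤ N) :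
    ent (FinMeas.push g ζ) ≤ ent (FinMeas.push f ζ) + Real.log N := by
  classical
  have hJ := h.push fun x => (f x, g x)
  have h1 := condEnt_le_log_card (f := Prod.fst) hJ.1 hN (by
    intro b s hs hb
    have : (s.image Prod.snd).card = s.card := by
      refine Finset.card_image_of_injOn fun x hx y hy hxy => Prod.ext ?_ hxy
      rw [hb x hx, hb y hy]
    rw [← this]
    refine hcard b _ fun c hc => ?_
    obtain ⟨⟨b', c'⟩, hx, rfl⟩ := Finset.mem_image.1 hc
    have h2 := Finsupp.mem_support_iff.1 (hs hx)
    rw [coeff_push _ ζ subset_rfl] at h2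
    obtain ⟨x, hx', -⟩ := Finset.exists_ne_zero_of_sum_ne_zero h2
    rw [Finset.mem_filter] at hx'
    have h3 := hb _ hx
    simp only [Prod.mk.injEq] at hx' h3
    exact ⟨x, hx'.1, hx'.2.1.trans h3, hx'.2.2⟩)
  rw [hJ.2, one_mul, condEnt, push_push] at h1
  have h2 := ent_push_le hJ.1 Prod.snd
  rw [push_push] at h2
  have e1 : (Prod.fst ∘ fun x => (f x, g x)) = f := rfl
  have e2 : (Prod.snd ∘ fun x => (f x, g x)) = g := rfl
  rw [e1] at h1
  rw [e2] at h2
  linarith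

end FinMeas

namespace FinMeas

variable {A B C : Type*}

/-- Product measure. -/
def prod (γ : FinMeas A) (α : FinMeas B) : FinMeas (A × B) :=
  ∑ z ∈ γ.coeff.support, ∑ x ∈ α.coeff.support, (γ.coeff z * α.coeff x) • dirac (z, x)

lemma coeff_prod (γ : FinMeas A) (α : FinMeas B) (z : A) (x : B) :
    (prod γ α).coeff (z, x) = γ.coeff z * α.coeff x := by
  classical
  simp only [prod, dirac, AddMonoidAlgebra.coeff_sum, AddMonoidAlgebra.coeff_smul,
    Finsupp.coe_finsetSum, Finset.sum_apply, Finsupp.coe_smul, Pi.smul_apply,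
    AddMonoidAlgebra.coeff_single, Finsupp.single_apply, Prod.mk.injEq, smul_eq_mul, mul_ite,
    mul_one, mul_zero]
  rw [Finset.sum_eq_single z, Finset.sum_eq_single x]
  · simp
  · intro b _ hb; simp [hb]
  · intro h; simp only [Finsupp.mem_support_iff, not_not] at h; simp [h]
  · intro b _ hb; simp [hb]
  · intro h; simp only [Finsupp.mem_support_iff, not_not] at h; simp [h]

lemma support_prod_subset (γ : FinMeas A) (α : FinMeas B) :
    (prod γ α).coeff.support ⊆ γ.coeff.support ×ˢ α.coeff.support := by
  rintro ⟨z, x⟩ h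
  rw [Finsupp.mem_support_iff, coeff_prod] at h
  rw [Finset.mem_product, Finsupp.mem_support_iff, Finsupp.mem_support_iff]
  exact mul_ne_zero_iff.1 h

lemma mass_prod (γ : FinMeas A) (α : FinMeas B) : mass (prod γ α) = mass γ * mass α := by
  rw [mass_eq_sum _ (support_prod_subset γ α), Finset.sum_product, mass_eq_sum γ subset_rfl,
    mass_eq_sum α subset_rfl, Finset.sum_mul_sum]
  simp only [coeff_prod]

lemma IsProb.prod {γ : FinMeas A} {α : FinMeas B} (h : IsProb γ) (h' : IsProb α) :
    IsProb (prod γ α) :=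
  ⟨fun ⟨z, x⟩ => by rw [coeff_prod]; exact mul_nonneg (h.1 z) (h'.1 x),
    by rw [mass_prod, h.2, h'.2, one_mul]⟩

lemma IsProb.sum_coeff {ζ : FinMeas A} (h : IsProb ζ) : ∑ x ∈ ζ.coeff.support, ζ.coeff x = 1 := by
  rw [← mass_eq_sum ζ subset_rfl, h.2]

lemma IsProb.ent_prod {γ : FinMeas A} {α : FinMeas B} (h : IsProb γ) (h' : IsProb α) :
    ent (FinMeas.prod γ α) = ent γ + ent α := by
  rw [ent_eq_sum _ (support_prod_subset γ α), Finset.sum_product]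
  simp only [coeff_prod, Real.negMulLog_mul, Finset.sum_add_distrib]
  simp only [← Finset.sum_mul, ← Finset.mul_sum, h.sum_coeff, h'.sum_coeff, one_mul]
  rw [ent_eq_sum γ subset_rfl, ent_eq_sum α subset_rfl]

lemma ent_push_of_injective {ζ : FinMeas A} (h : Nonneg ζ) {f : A → B}
    (hf : Function.Injective f) : ent (push f ζ) = ent ζ := by
  refine le_antisymm (ent_push_le h f) ?_
  cases isEmpty_or_nonempty A
  · have : ζ = 0 := by ext x; exact isEmptyElim x
    simp [this, ent]
  have := ent_push_le (h.push f) (Function.invFun f)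
  rwa [push_push, Function.invFun_comp hf, push_id] at this

section Conv

variable [AddCommMonoid A] [AddCommMonoid B]

lemma dirac_mul_dirac (a b : A) : dirac a * dirac b = dirac (a + b) := by
  simp [dirac, AddMonoidAlgebra.single_mul_single]

lemma mul_eq_push_prod (γ α : FinMeas A) :
    γ * α = push (fun p : A × A => p.1 + p.2) (prod γ α) := by
  conv_lhs => rw [eq_sum_dirac γ subset_rfl, eq_sum_dirac α subset_rfl]
  simp only [prod, map_sum, map_smul, push_dirac, Finset.sum_mul_sum, smul_mul_smul_comm,
    dirac_mul_dirac]

lemma IsProb.mul {γ α : FinMeas A} (h : IsProb γ) (h' : IsProb α) : IsProb (γ * α) := by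
  rw [mul_eq_push_prod]
  exact (h.prod h').push _

lemma dirac_zero : (dirac 0 : FinMeas A) = 1 := rfl

lemma isProb_one : IsProb (1 : FinMeas A) := dirac_zero (A := A) ▸ isProb_dirac 0

lemma IsProb.pow {γ : FinMeas A} (h : IsProb γ) (n : ℕ) : IsProb (γ ^ n) := by
  induction n with
  | zero => simpa using isProb_one
  | succ n ih => rw [pow_succ]; exact ih.mul h

lemma IsProb.finset_prod {ι : Type*} {s : Finset ι} {γ : ι → FinMeas A}
    (h : ∀ i ∈ s, IsProb (γ i)) : IsProb (∏ i ∈ s, γ i) := by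
  classical
  induction s using Finset.induction_on with
  | empty => simpa using isProb_one
  | insert i s hi ih =>
    rw [Finset.prod_insert hi]
    exact (h i (by simp)).mul (ih fun j hj => h j (by simp [hj]))

lemma push_mul (f : A →+ B) (γ α : FinMeas A) : push f (γ * α) = push f γ * push f α :=
  AddMonoidAlgebra.mapDomain_mul f γ α

lemma mul_dirac (γ : FinMeas A) (a : A) : γ * dirac a = push (· + a) γ := by
  conv_lhs => rw [eq_sum_dirac γ subset_rfl]
  conv_rhs => rw [eq_sum_dirac γ subset_rfl]
  simp only [map_sum, map_smul, push_dirac, Finset.sum_mul, smul_mul_assoc, dirac_mul_dirac]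

end Conv

section KV

variable [AddCommGroup A]

/-- The law of `(Z, Z + X)` for independent `Z`, `X`. -/
private def graphLaw (γ α : FinMeas A) : FinMeas (A × A) :=
  push (fun z => (z, z)) γ * push (fun x => ((0 : A), x)) α

private lemma graphLaw_eq (γ α : FinMeas A) :
    graphLaw γ α = push (fun p : A × A => (p.1, p.1 + p.2)) (prod γ α) := by
  rw [graphLaw]
  conv_lhs => rw [eq_sum_dirac γ subset_rfl, eq_sum_dirac α subset_rfl]
  simp only [prod, map_sum, map_smul, push_dirac, Finset.sum_mul_sum, smul_mul_smul_comm,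
    dirac_mul_dirac, Prod.mk_add_mk, add_zero]

private lemma isProb_graphLaw {γ α : FinMeas A} (h : IsProb γ) (h' : IsProb α) :
    IsProb (graphLaw γ α) := graphLaw_eq γ α ▸ (h.prod h').push _

private lemma condEnt_graphLaw {γ α : FinMeas A} (h : IsProb γ) (h' : IsProb α) :
    condEnt Prod.snd (graphLaw γ α) = ent γ + ent α - ent (γ * α) := by
  rw [condEnt, graphLaw_eq, push_push, mul_eq_push_prod, ent_push_of_injective (h.prod h').1,
    h.ent_prod h']
  · rfl
  · rintro ⟨a, b⟩ ⟨c, d⟩ h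
    simp only [Prod.mk.injEq] at h ⊢
    obtain ⟨rfl, h⟩ := h
    exact ⟨rfl, add_left_cancel h⟩

private lemma graphLaw_mul (γ α β : FinMeas A) :
    graphLaw γ (α * β) = graphLaw γ α * push (fun x => ((0 : A), x)) β := by
  have : push (fun x => ((0 : A), x)) (α * β)
      = push (fun x => ((0 : A), x)) α * push (fun x => ((0 : A), x)) β :=
    push_mul (AddMonoidHom.inr A A) α β
  rw [graphLaw, graphLaw, this, mul_assoc]

/-- Submodularity of entropy under convolution (Kaimanovich–Vershik, Madiman). -/
theorem ent_submodular {α β γ : FinMeas A} (ha : IsProb α) (hb : IsProb β) (hc : IsProb γ) :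
    ent (γ * (α * β)) + ent α ≤ ent (γ * α) + ent (α * β) := by
  have h1 := condEnt_graphLaw hc ha
  have h2 := condEnt_graphLaw hc (ha.mul hb)
  suffices condEnt Prod.snd (graphLaw γ α) ≤ condEnt Prod.snd (graphLaw γ (α * β)) by linarith
  rw [graphLaw_mul]
  conv_rhs => rw [eq_sum_dirac β subset_rfl]
  simp only [map_sum, map_smul, push_dirac, Finset.mul_sum, mul_smul_comm, mul_dirac]
  refine le_trans (le_of_eq ?_) (sum_condEnt_le _ _ (fun i _ => hb.1 i)
    fun i _ => (isProb_graphLaw hc ha).1.push _)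
  have : ∀ i ∈ β.coeff.support, β.coeff i * condEnt Prod.snd
      (push (fun x => x + ((0 : A), i)) (graphLaw γ α))
        = β.coeff i * condEnt Prod.snd (graphLaw γ α) := by
    intro i _
    congr 1
    have hp := isProb_graphLaw hc ha
    have e : Prod.snd ∘ (fun x => x + ((0 : A), i)) = (· + i) ∘ Prod.snd := rfl
    rw [condEnt, condEnt, push_push, e, ← push_push,
      ent_push_of_injective hp.1 (add_left_injective _),
      ent_push_of_injective (hp.push _).1 (add_left_injective _)]
  rw [Finset.sum_congr rfl this, ← Finset.sum_mul, hb.sum_coeff, one_mul]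

lemma ent_mul_pow_le {α β : FinMeas A} (ha : IsProb α) (hb : IsProb β) (k : ℕ) :
    ent (α * β ^ k) - ent α ≤ k * (ent (α * β) - ent α) := by
  induction k with
  | zero => simp
  | succ k ih =>
    have := ent_submodular ha hb (hb.pow k)
    have e1 : β ^ k * (α * β) = α * β ^ (k + 1) := by ring
    have e2 : β ^ k * α = α * β ^ k := by ring
    rw [e1, e2] at this
    push_cast
    linarith

lemma ent_mul_dirac {α : FinMeas A} (ha : Nonneg α) (a : A) : ent (α * dirac a) = ent α := by
  rw [mul_dirac, ent_push_of_injective ha (add_left_injective a)]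

lemma mul_eq_sum_dirac (α β : FinMeas A) :
    α * β = ∑ y ∈ β.coeff.support, β.coeff y • (α * dirac y) := by
  conv_lhs => rw [eq_sum_dirac β subset_rfl]
  simp only [Finset.mul_sum, mul_smul_comm]

lemma ent_le_ent_mul {α β : FinMeas A} (ha : IsProb α) (hb : IsProb β) :
    ent α ≤ ent (α * β) := by
  rw [mul_eq_sum_dirac]
  refine le_trans (le_of_eq ?_) (sum_ent_le _ (fun y _ => hb.1 y) hb.sum_coeff
    fun y _ => ha.mul (isProb_dirac y))
  simp only [ent_mul_dirac ha.1, ← Finset.sum_mul, hb.sum_coeff, one_mul]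

end KV

lemma IsProb.neg_log_le_ent {ζ : FinMeas A} (h : IsProb ζ) {P : ℝ}
    (hζ : ∀ x, ζ.coeff x ≤ P) : -Real.log P ≤ ent ζ := by
  rw [ent_eq_sum ζ subset_rfl]
  calc -Real.log P = ∑ x ∈ ζ.coeff.support, ζ.coeff x * -Real.log P := by
        rw [← Finset.sum_mul, h.sum_coeff, one_mul]
    _ ≤ _ := by
        refine Finset.sum_le_sum fun x hx => ?_
        have hx : 0 < ζ.coeff x := lt_of_le_of_ne (h.1 x) (Finsupp.mem_support_iff.1 hx).symm
        rw [Real.negMulLog, neg_mul, mul_neg]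
        have := Real.log_le_log hx (hζ x)
        have := mul_le_mul_of_nonneg_left this hx.le
        linarith

/-- Subadditivity of entropy for tuples. -/
lemma IsProb.ent_le_sum_push {ι : Type*} [Fintype ι] {ζ : FinMeas (ι → A)} (h : IsProb ζ) :
    ent ζ ≤ ∑ i, ent (FinMeas.push (fun x => x i) ζ) := by
  classical
  have hpos : ∀ x ∈ ζ.coeff.support, ∀ i, 0 < (FinMeas.push (fun x => x i) ζ).coeff (x i) := by
    intro x hx i
    have hx : 0 < ζ.coeff x := lt_of_le_of_ne (h.1 x) (Finsupp.mem_support_iff.1 hx).symm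
    exact hx.trans_le (h.1.coeff_le_push (fun x => x i) x)
  refine (h.ent_le_of_ref (q := fun x => ∏ i, (FinMeas.push (fun x => x i) ζ).coeff (x i))
    (fun x hx => Finset.prod_pos fun i _ => hpos x hx i) ?_).trans (le_of_eq ?_)
  · calc _ ≤ ∑ x ∈ Fintype.piFinset fun i => (FinMeas.push (fun x => x i) ζ).coeff.support,
          ∏ i, (FinMeas.push (fun x => x i) ζ).coeff (x i) := by
          refine Finset.sum_le_sum_of_subset_of_nonneg (fun x hx => ?_)
            fun x _ _ => Finset.prod_nonneg fun i _ => (h.1.push _) _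
          rw [Fintype.mem_piFinset]
          exact fun i => Finsupp.mem_support_iff.2 (hpos x hx i).ne'
      _ = 1 := by
          rw [← Finset.prod_univ_sum]
          exact Finset.prod_eq_one fun i _ => (h.push _).sum_coeff
  · have : ∀ i, ent (FinMeas.push (fun x => x i) ζ) = ∑ x ∈ ζ.coeff.support,
        ζ.coeff x * -Real.log ((FinMeas.push (fun x => x i) ζ).coeff (x i)) := by
      intro i
      rw [ent_push_eq _ ζ subset_rfl]
      simp
    simp only [this]
    rw [Finset.sum_comm]
    refine Finset.sum_congr rfl fun x hx => ?_
    rw [Real.log_prod fun i _ => (hpos x hx i).ne', ← Finset.mul_sum, Finset.sum_neg_distrib]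

section Int

lemma IsProb.ent_push_le_of_close {ζ : FinMeas A} (h : IsProb ζ) {f g : A → ℤ} {N : ℕ}
    (hN : ∀ x ∈ ζ.coeff.support, |f x - g x| ≤ N) :
    ent (FinMeas.push g ζ) ≤ ent (FinMeas.push f ζ) + Real.log (2 * N + 1) := by
  refine h.ent_push_le_add_log f g (by positivity) fun b s hs => ?_
  have : s ⊆ Finset.Icc (b - N) (b + N) := by
    intro c hc
    obtain ⟨x, hx, rfl, rfl⟩ := hs c hc
    have := abs_le.1 (hN x hx)
    rw [Finset.mem_Icc]
    constructor <;> linarith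
  have := Finset.card_le_card this
  rw [Int.card_Icc] at this
  have h2 : s.card ≤ 2 * N + 1 := by omega
  exact_mod_cast h2

lemma abs_add_ediv_sub_le (x s n : ℤ) (hn : 0 < n) :
    |(x + s) / n - (x / n + s / n)| ≤ 1 := by
  have h1 := Int.emod_add_mul_ediv x n
  have h2 := Int.emod_add_mul_ediv s n
  have a1 := Int.emod_nonneg x hn.ne'
  have a2 := Int.emod_nonneg s hn.ne'
  have b1 := Int.emod_lt_of_pos x hn
  have b2 := Int.emod_lt_of_pos s hn
  have : (x + s) / n = (x % n + s % n) / n + (x / n + s / n) := by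
    rw [← Int.add_mul_ediv_left _ _ hn.ne']
    congr 1
    linarith
  rw [this, add_sub_cancel_right, abs_le]
  constructor
  · have := Int.ediv_nonneg (add_nonneg a1 a2) hn.le
    linarith
  · have : (x % n + s % n) / n < 2 := Int.ediv_lt_of_lt_mul hn (by linarith)
    linarith

lemma ent_push_div_mul_dirac {α : FinMeas ℤ} (ha : IsProb α) {n : ℤ} (hn : 0 < n) (s : ℤ) :
    ent (push (· / n) α) ≤ ent (push (· / n) (α * dirac s)) + Real.log 3 := by
  rw [mul_dirac, push_push]
  have h1 := ha.ent_push_le_of_close (f := (· / n) ∘ (· + s)) (g := fun x => x / n + s / n) (N := 1)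
    fun x _ => by simpa using abs_add_ediv_sub_le x s n hn
  have h2 : push (fun x => x / n + s / n) α = push (· + s / n) (push (· / n) α) := by
    rw [push_push]; rfl
  rw [h2, ent_push_of_injective (ha.push _).1 (add_left_injective _)] at h1
  norm_num at h1
  exact h1

lemma sum_two_pow_neg_abs_le (s : Finset ℤ) : ∑ x ∈ s, ((1 / 2 : ℝ)) ^ x.natAbs ≤ 3 := by
  have h0 : ∀ n : ℕ, ∑ x ∈ Finset.range n, ((1 / 2 : ℝ)) ^ x ≤ 2 := by
    intro n
    rw [geom_sum_eq (by norm_num)]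
    have : (0 : ℝ) ≤ (1 / 2) ^ n := by positivity
    have e : (((1 / 2 : ℝ)) ^ n - 1) / (1 / 2 - 1) = 2 - 2 * (1 / 2) ^ n := by ring
    rw [e]
    linarith
  have hinj : ∀ n : ℕ, ((Finset.range n).image fun k : ℕ => (k : ℤ)).sum
      (fun x => ((1 / 2 : ℝ)) ^ x.natAbs) ≤ 2 := by
    intro n
    rw [Finset.sum_image (by intro a _ b _ h; simpa using h)]
    simpa using h0 n
  have hinj' : ∀ n : ℕ, ((Finset.range n).image fun k : ℕ => -((k : ℤ) + 1)).sum
      (fun x => ((1 / 2 : ℝ)) ^ x.natAbs) ≤ 1 := by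
    intro n
    rw [Finset.sum_image (by intro a _ b _ h; simpa using h)]
    have : ∀ k : ℕ, (-((k : ℤ) + 1)).natAbs = k + 1 := by intro k; omega
    simp only [this, pow_succ, ← Finset.sum_mul]
    linarith [h0 n]
  obtain ⟨n, hn⟩ : ∃ n : ℕ, ∀ x ∈ s, x.natAbs < n := by
    refine ⟨s.sup Int.natAbs + 1, fun x hx => ?_⟩
    exact Nat.lt_succ_of_le (Finset.le_sup (f := Int.natAbs) hx)
  have hsub : s ⊆ ((Finset.range n).image fun k : ℕ => (k : ℤ)) ∪
      ((Finset.range n).image fun k : ℕ => -((k : ℤ) + 1)) := by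
    intro x hx
    have := hn x hx
    simp only [Finset.mem_union, Finset.mem_image, Finset.mem_range]
    rcases le_or_gt 0 x with h | h
    · exact Or.inl ⟨x.natAbs, this, by omega⟩
    · exact Or.inr ⟨x.natAbs - 1, by omega, by omega⟩
  refine (Finset.sum_le_sum_of_subset_of_nonneg hsub fun _ _ _ => by positivity).trans ?_
  rw [Finset.sum_union]
  · linarith [hinj n, hinj' n]
  · rw [Finset.disjoint_left]
    simp only [Finset.mem_image, Finset.mem_range, not_exists, not_and]
    rintro _ ⟨a, _, rfl⟩ b _ h
    omega

lemma IsProb.ent_le_moment {ζ : FinMeas ℤ} (h : IsProb ζ) (c : ℤ) :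
    ent ζ ≤ Real.log 3 +
      Real.log 2 * ∑ x ∈ ζ.coeff.support, ζ.coeff x * |(x : ℝ) - c| := by
  refine (h.ent_le_of_ref (q := fun x => (1 / 3) * (1 / 2) ^ (x - c).natAbs)
    (fun x _ => by positivity) ?_).trans (le_of_eq ?_)
  · rw [← Finset.mul_sum]
    have := sum_two_pow_neg_abs_le (ζ.coeff.support.image (· - c))
    rw [Finset.sum_image (by intro a _ b _ h; simpa using h)] at this
    linarith
  · have : ∀ x ∈ ζ.coeff.support,
        ζ.coeff x * -Real.log ((1 / 3) * (1 / 2) ^ (x - c).natAbs)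
        = ζ.coeff x * Real.log 3 + Real.log 2 * (ζ.coeff x * |(x : ℝ) - c|) := by
      intro x _
      rw [Real.log_mul (by norm_num) (by positivity), Real.log_pow, one_div, one_div,
        Real.log_inv, Real.log_inv, Nat.cast_natAbs]
      push_cast
      ring
    rw [Finset.sum_congr rfl this, Finset.sum_add_distrib, ← Finset.sum_mul, ← Finset.mul_sum,
      h.sum_coeff, one_mul]

lemma IsProb.ent_push_div_le_of_window {ζ : FinMeas ℤ} (h : IsProb ζ) {n u : ℤ} (hn : 0 < n)
    {N : ℕ} (hs : ∀ x ∈ ζ.coeff.support, u ≤ x ∧ x ≤ u + N * n) :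
    ent (FinMeas.push (· / n) ζ) ≤ Real.log (N + 1 + 1) := by
  classical
  refine (h.push _).ent_le_log_card (by positivity) ?_
  have : (FinMeas.push (· / n) ζ).coeff.support ⊆ Finset.Icc (u / n) (u / n + N + 1) := by
    intro y hy
    have h2 := Finsupp.mem_support_iff.1 hy
    rw [coeff_push _ ζ subset_rfl] at h2
    obtain ⟨x, hx', -⟩ := Finset.exists_ne_zero_of_sum_ne_zero h2
    rw [Finset.mem_filter] at hx'
    obtain ⟨hx, rfl⟩ := hx'
    have := hs x hx
    rw [Finset.mem_Icc]
    refine ⟨Int.ediv_le_ediv hn this.1, ?_⟩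
    have h3 := Int.ediv_le_ediv hn this.2
    rw [Int.add_mul_ediv_right _ _ hn.ne'] at h3
    linarith
  have := Finset.card_le_card this
  rw [Int.card_Icc] at this
  have h2 : (FinMeas.push (· / n) ζ).coeff.support.card ≤ N + 1 + 1 := by omega
  exact_mod_cast h2

end Int

end FinMeas

namespace FinMeas

/-- The uniform measure on the pair `{x, y}`. -/
def two (x y : ℤ) : FinMeas ℤ := (1 / 2 : ℝ) • (dirac x + dirac y)

lemma isProb_two (x y : ℤ) : IsProb (two x y) := by
  refine ⟨((nonneg_dirac x).add (nonneg_dirac y)).smul (by norm_num), ?_⟩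
  have hx := mass_dirac x
  have hy := mass_dirac y
  rw [two, mass_smul]
  simp only [mass, map_add, AddMonoidAlgebra.coeff_add, Finsupp.add_apply] at hx hy ⊢
  rw [hx, hy]
  norm_num

lemma two_comm (x y : ℤ) : two x y = two y x := by rw [two, two, add_comm]

lemma prod_dirac {ι : Type*} (s : Finset ι) (x : ι → ℤ) :
    ∏ i ∈ s, dirac (x i) = dirac (∑ i ∈ s, x i) := by
  classical
  induction s using Finset.induction_on with
  | empty => simp [dirac_zero]
  | insert a s ha ih => rw [Finset.prod_insert ha, Finset.sum_insert ha, ih, dirac_mul_dirac]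

lemma prod_two {ι : Type*} [DecidableEq ι] (s : Finset ι) (x y : ι → ℤ) :
    ∏ i ∈ s, two (x i) (y i) = ∑ t ∈ s.powerset,
      ((1 / 2 : ℝ) ^ s.card) • dirac (∑ i ∈ s, if i ∈ t then x i else y i) := by
  simp only [two]
  rw [← Finset.smul_sum]
  have h : ∀ s : Finset ι, ∏ i ∈ s, (1 / 2 : ℝ) • (dirac (x i) + dirac (y i)) =
      ((1 / 2 : ℝ) ^ s.card) • ∏ i ∈ s, (dirac (x i) + dirac (y i)) := by
    intro s
    rw [Finset.prod_smul, Finset.prod_const]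
  rw [h, Finset.prod_add]
  congr 1
  refine Finset.sum_congr rfl fun t ht => ?_
  rw [prod_dirac, prod_dirac, dirac_mul_dirac]
  congr 1
  rw [Finset.mem_powerset] at ht
  rw [Finset.sum_ite, ← Finset.sdiff_eq_filter, Finset.filter_mem_eq_inter,
    Finset.inter_eq_right.2 ht]

lemma centralBinom_sq_le (n : ℕ) : n.centralBinom ^ 2 * (2 * n + 1) ≤ 16 ^ n := by
  induction n with
  | zero => simp
  | succ n ih =>
    have h := Nat.succ_mul_centralBinom_succ n
    have h2 : (n + 1) ^ 2 * ((n + 1).centralBinom ^ 2 * (2 * (n + 1) + 1))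
        ≤ (n + 1) ^ 2 * 16 ^ (n + 1) := by
      calc (n + 1) ^ 2 * ((n + 1).centralBinom ^ 2 * (2 * (n + 1) + 1))
          = ((n + 1) * (n + 1).centralBinom) ^ 2 * (2 * n + 3) := by ring
        _ = 4 * (2 * n + 1) * (2 * n + 3) * (n.centralBinom ^ 2 * (2 * n + 1)) := by rw [h]; ring
        _ ≤ 4 * (2 * n + 1) * (2 * n + 3) * 16 ^ n := by gcongr
        _ ≤ (16 * (n + 1) ^ 2) * 16 ^ n := Nat.mul_le_mul_right _ (by nlinarith)
        _ = _ := by ring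
    exact Nat.le_of_mul_le_mul_left h2 (by positivity)

lemma choose_half_sq_le (n : ℕ) : (n.choose (n / 2)) ^ 2 * n ≤ 4 ^ n := by
  rcases Nat.even_or_odd' n with ⟨m, rfl | rfl⟩
  · have := centralBinom_sq_le m
    rw [Nat.mul_div_cancel_left _ two_pos, pow_mul]
    rw [Nat.centralBinom] at this
    norm_num
    nlinarith [sq_nonneg ((2 * m).choose m)]
  · have := centralBinom_sq_le (m + 1)
    have h2 : (2 * m + 1) / 2 = m := by omega
    have h3 : (m + 1).centralBinom = 2 * (2 * m + 1).choose m := by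
      rw [Nat.centralBinom, Nat.mul_add, Nat.mul_one, Nat.choose_succ_succ,
        ← Nat.choose_symm_half]
      ring
    rw [h2, pow_succ 4, pow_mul]
    rw [h3, pow_succ 16] at this
    norm_num at this ⊢
    nlinarith [sq_nonneg ((2 * m + 1).choose m)]

/-- The Erdős–Littlewood–Offord inequality. -/
lemma coeff_push_div_prod_two_le {ι : Type*} [Fintype ι] {x y : ι → ℤ} {D : ℤ} (hD : 0 < D)
    (h : ∀ i, D ≤ y i - x i) (z b : ℤ) :
    (push (· / D) (dirac z * ∏ i, two (x i) (y i))).coeff b ≤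
      (1 / 2) ^ Fintype.card ι * (Fintype.card ι).choose (Fintype.card ι / 2) := by
  classical
  rw [prod_two, Finset.mul_sum, map_sum, AddMonoidAlgebra.coeff_sum, Finsupp.finsetSum_apply]
  simp only [mul_smul_comm, dirac_mul_dirac, map_smul, push_dirac, AddMonoidAlgebra.coeff_smul,
    Finsupp.smul_apply, smul_eq_mul, ← Finset.mul_sum, Finset.card_univ]
  gcongr
  simp only [dirac, AddMonoidAlgebra.coeff_single, Finsupp.single_apply]
  rw [Finset.sum_boole]
  refine Nat.cast_le.2 (IsAntichain.sperner ?_)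
  intro t ht t' ht' hne hsub
  simp only [Finset.coe_filter, Set.mem_ofPred_eq] at ht ht'
  obtain ⟨a, ha', ha⟩ := Finset.exists_of_ssubset (lt_of_le_of_ne hsub hne)
  have key : (∑ i, if i ∈ t' then x i else y i) + D ≤ ∑ i, if i ∈ t then x i else y i := by
    rw [← Finset.add_sum_erase _ _ (Finset.mem_univ a),
      ← Finset.add_sum_erase _ _ (Finset.mem_univ a)]
    rw [if_pos ha', if_neg ha]
    have : ∑ i ∈ Finset.univ.erase a, (if i ∈ t' then x i else y i) ≤
        ∑ i ∈ Finset.univ.erase a, (if i ∈ t then x i else y i) := by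
      refine Finset.sum_le_sum fun i _ => ?_
      have := h i
      by_cases h1 : i ∈ t
      · rw [if_pos h1, if_pos (hsub h1)]
      · rw [if_neg h1]; split_ifs <;> omega
    have := h a
    omega
  have h1 := Int.ediv_mul_le (z + ∑ i, if i ∈ t' then x i else y i) hD.ne'
  have h2 := Int.lt_ediv_add_one_mul_self (z + ∑ i, if i ∈ t then x i else y i) hD
  rw [ht'.2] at h1
  rw [ht.2] at h2
  nlinarith

lemma IsProb.ent_mix_le {ι : Type*} {s : Finset ι} {c : ι → ℝ} {ζ : ι → FinMeas ℤ}
    (hc : ∀ i ∈ s, 0 ≤ c i) (hc1 : ∑ i ∈ s, c i = 1) (h : ∀ i ∈ s, IsProb (ζ i)) {e : ℝ}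
    (he : ∀ i ∈ s, e ≤ ent (ζ i)) : e ≤ ent (∑ i ∈ s, c i • ζ i) := by
  refine le_trans ?_ (sum_ent_le s hc hc1 h)
  calc e = ∑ i ∈ s, c i * e := by rw [← Finset.sum_mul, hc1, one_mul]
    _ ≤ _ := Finset.sum_le_sum fun i hi => mul_le_mul_of_nonneg_left (he i hi) (hc i hi)

lemma le_ent_push_div_mul_prod_two {ι : Type*} {s : Finset ι} {x y : ι → ℤ} {D : ℤ} (hD : 0 < D)
    (hs : s.Nonempty) (h : ∀ i ∈ s, D ≤ |y i - x i|) {γ : FinMeas ℤ} (hγ : IsProb γ) :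
    Real.log s.card / 2 ≤ ent (push (· / D) (γ * ∏ i ∈ s, two (x i) (y i))) := by
  classical
  have e1 : ∏ i ∈ s, two (x i) (y i) =
      ∏ i : s, two (min (x i) (y i)) (max (x i) (y i)) := by
    rw [← Finset.prod_coe_sort]
    refine Finset.prod_congr rfl fun i _ => ?_
    rcases le_total (x i) (y i) with h | h
    · rw [min_eq_left h, max_eq_right h]
    · rw [min_eq_right h, max_eq_left h, two_comm]
  have hprob : IsProb (∏ i ∈ s, two (x i) (y i)) := IsProb.finset_prod fun i _ => isProb_two _ _
  rw [mul_comm, mul_eq_sum_dirac, map_sum]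
  simp only [map_smul]
  refine IsProb.ent_mix_le (fun i _ => hγ.1 i) hγ.sum_coeff
    (fun i _ => (hprob.mul (isProb_dirac _)).push _) fun z _ => ?_
  have hpos : (0 : ℝ) < s.card := by exact_mod_cast hs.card_pos
  have hC : (0 : ℝ) < (s.card.choose (s.card / 2) : ℝ) := by
    exact_mod_cast Nat.choose_pos (Nat.div_le_self _ _)
  refine le_trans ?_ (((hprob.mul (isProb_dirac z)).push _).neg_log_le_ent
    (P := (1 / 2) ^ s.card * s.card.choose (s.card / 2)) ?_)
  · have h1 : ((s.card.choose (s.card / 2) : ℝ)) ^ 2 * s.card ≤ 4 ^ s.card := by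
      exact_mod_cast choose_half_sq_le s.card
    have h2 := Real.log_le_log (by positivity) h1
    rw [Real.log_mul (by positivity) hpos.ne', Real.log_pow, Real.log_pow] at h2
    rw [Real.log_mul (by positivity) hC.ne', Real.log_pow, one_div, Real.log_inv]
    have h3 : Real.log 4 = 2 * Real.log 2 := by
      rw [show (4 : ℝ) = 2 ^ 2 by norm_num, Real.log_pow]; norm_num
    rw [h3] at h2
    push_cast at h2
    linarith
  · intro b
    rw [mul_comm, e1]
    have := coeff_push_div_prod_two_le (x := fun i : s => min (x i) (y i))
      (y := fun i : s => max (x i) (y i)) hD (fun i => ?_) z b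
    · simpa using this
    · rw [max_sub_min_eq_abs]; exact h i i.2

lemma ent_mix_dirac_le_moment {ι : Type*} {s : Finset ι} {c : ι → ℝ} {f : ι → ℤ}
    (hc : ∀ i ∈ s, 0 ≤ c i) (hc1 : ∑ i ∈ s, c i = 1) (m : ℤ) :
    ent (∑ i ∈ s, c i • dirac (f i)) ≤
      Real.log 3 + Real.log 2 * ∑ i ∈ s, c i * |(f i : ℝ) - m| := by
  classical
  have hp := IsProb.mix hc hc1 fun i _ => isProb_dirac (f i)
  refine (hp.ent_le_moment m).trans (le_of_eq ?_)
  congr 2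
  set ζ := ∑ i ∈ s, c i • dirac (f i) with hζ
  have hco : ∀ x, ζ.coeff x = ∑ i ∈ s, if f i = x then c i else 0 := by
    intro x
    rw [hζ, AddMonoidAlgebra.coeff_sum, Finsupp.finsetSum_apply]
    refine Finset.sum_congr rfl fun i _ => ?_
    simp [dirac]
  have hsub : ζ.coeff.support ⊆ s.image f := by
    intro x hx
    rw [Finsupp.mem_support_iff, hco] at hx
    obtain ⟨i, hi, h⟩ := Finset.exists_ne_zero_of_sum_ne_zero hx
    exact Finset.mem_image.2 ⟨i, hi, by by_contra h'; exact h (if_neg h')⟩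
  rw [Finset.sum_subset hsub fun x _ hx => by rw [Finsupp.notMem_support_iff.1 hx, zero_mul]]
  simp only [hco, Finset.sum_mul]
  rw [Finset.sum_comm]
  refine Finset.sum_congr rfl fun i hi => ?_
  simp only [ite_mul, zero_mul]
  rw [Finset.sum_ite_eq, if_pos (Finset.mem_image_of_mem f hi)]

lemma sum_powerset_sq {ι : Type*} [DecidableEq ι] (s : Finset ι) (d : ι → ℝ) :
    ∑ t ∈ s.powerset, (∑ i ∈ s, if i ∈ t then d i else -d i) ^ 2 =
      2 ^ s.card * ∑ i ∈ s, d i ^ 2 := by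
  induction s using Finset.induction_on with
  | empty => simp
  | insert a s ha ih =>
    rw [Finset.sum_powerset_insert ha, Finset.sum_insert ha, Finset.card_insert_of_notMem ha,
      pow_succ, mul_assoc, mul_left_comm, mul_add, ← ih, ← Finset.sum_add_distrib]
    have h1 : ∀ t ∈ s.powerset, (∑ i ∈ insert a s, if i ∈ t then d i else -d i) ^ 2 +
        (∑ i ∈ insert a s, if i ∈ insert a t then d i else -d i) ^ 2 =
        2 * d a ^ 2 + 2 * (∑ i ∈ s, if i ∈ t then d i else -d i) ^ 2 := by
      intro t ht
      rw [Finset.mem_powerset] at ht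
      rw [Finset.sum_insert ha, Finset.sum_insert ha, if_neg fun h => ha (ht h),
        if_pos (Finset.mem_insert_self a t)]
      have : ∑ i ∈ s, (if i ∈ insert a t then d i else -d i) =
          ∑ i ∈ s, (if i ∈ t then d i else -d i) := by
        refine Finset.sum_congr rfl fun i hi => ?_
        have : i ≠ a := fun h => ha (h ▸ hi)
        simp [Finset.mem_insert, this]
      rw [this]; ring
    rw [Finset.sum_congr rfl h1, Finset.sum_add_distrib, Finset.sum_const, Finset.card_powerset,
      ← Finset.mul_sum, nsmul_eq_mul]
    push_cast
    ring

lemma ent_push_div_mul_prod_two_le {ι : Type*} {s : Finset ι} {x y : ι → ℤ} {D : ℤ} (hD : 0 < D)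
    {W : ℝ} (h : ∀ i ∈ s, |(x i : ℝ) - y i| ≤ W) (hW : s.card * W ^ 2 ≤ (D : ℝ) ^ 2) (z : ℤ) :
    ent (push (· / D) (dirac z * ∏ i ∈ s, two (x i) (y i))) ≤ Real.log 3 + Real.log 2 * 3 := by
  classical
  rw [prod_two, Finset.mul_sum, map_sum]
  simp only [mul_smul_comm, dirac_mul_dirac, map_smul, push_dirac]
  have hD' : (0 : ℝ) < D := by exact_mod_cast hD
  set μ : ℝ := z + (∑ i ∈ s, ((x i : ℝ) + y i)) / 2 with hμ
  have hc1 : ∑ t ∈ s.powerset, (1 / 2 : ℝ) ^ s.card = 1 := by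
    rw [Finset.sum_const, Finset.card_powerset, nsmul_eq_mul]
    push_cast
    rw [← mul_pow]; norm_num
  refine (ent_mix_dirac_le_moment (fun t _ => by positivity) hc1 ⌊μ / D⌋).trans ?_
  have hl2 : 0 < Real.log 2 := Real.log_pos (by norm_num)
  gcongr
  have hb : ∀ t ∈ s.powerset, (1 / 2 : ℝ) ^ s.card *
      |(((z + ∑ i ∈ s, if i ∈ t then x i else y i) / D : ℤ) : ℝ) - ⌊μ / D⌋| ≤
      (1 / 2 : ℝ) ^ s.card * (2 + ((∑ i ∈ s, if i ∈ t then ((x i : ℝ) - y i) else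
        -((x i : ℝ) - y i)) ^ 2 / D ^ 2)) := by
    intro t _
    gcongr
    set S : ℤ := z + ∑ i ∈ s, if i ∈ t then x i else y i with hS
    set R := ∑ i ∈ s, if i ∈ t then ((x i : ℝ) - y i) else -((x i : ℝ) - y i) with hR
    have hSR : (S : ℝ) - μ = R / 2 := by
      rw [hS, hμ, hR]
      push_cast
      rw [add_sub_add_left_eq_sub, Finset.sum_div, Finset.sum_div, ← Finset.sum_sub_distrib]
      refine Finset.sum_congr rfl fun i _ => ?_
      split_ifs <;> ring
    have e1 : ((S / D : ℤ) : ℝ) = (⌊(S : ℝ) / D⌋ : ℝ) := by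
      congr 1
      symm
      rw [Int.floor_eq_iff, le_div_iff₀ hD', div_lt_iff₀ hD']
      exact ⟨by exact_mod_cast Int.ediv_mul_le S hD.ne',
        by exact_mod_cast Int.lt_ediv_add_one_mul_self S hD⟩
    rw [e1]
    have a1 := Int.floor_le ((S : ℝ) / D)
    have a2 := Int.lt_floor_add_one ((S : ℝ) / D)
    have a3 := Int.floor_le (μ / D)
    have a4 := Int.lt_floor_add_one (μ / D)
    have e2 : (S : ℝ) / D - μ / D = R / D / 2 := by rw [← sub_div, hSR]; ring
    have e3 : R ^ 2 / D ^ 2 = (R / D) ^ 2 := by rw [div_pow]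
    rw [e3, abs_le]
    constructor <;> nlinarith [sq_nonneg (R / D - 1), sq_nonneg (R / D + 1)]
  refine (Finset.sum_le_sum hb).trans ?_
  rw [← Finset.mul_sum, Finset.sum_add_distrib, ← Finset.sum_div, sum_powerset_sq, Finset.sum_const,
    Finset.card_powerset, nsmul_eq_mul, mul_add]
  have h1 : ∑ i ∈ s, ((x i : ℝ) - y i) ^ 2 ≤ (D : ℝ) ^ 2 := by
    refine le_trans ?_ hW
    rw [← nsmul_eq_mul]
    refine Finset.sum_le_card_nsmul _ _ _ fun i hi => ?_
    rw [← sq_abs]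
    exact pow_le_pow_left₀ (abs_nonneg _) (h i hi) 2
  have h2 : (1 / 2 : ℝ) ^ s.card * 2 ^ s.card = 1 := by rw [← mul_pow]; norm_num
  push_cast
  have h3 : (∑ i ∈ s, ((x i : ℝ) - y i) ^ 2) / (D : ℝ) ^ 2 ≤ 1 := by
    rw [div_le_one (by positivity)]; exact h1
  calc _ = ((1 / 2 : ℝ) ^ s.card * 2 ^ s.card) *
        (2 + (∑ i ∈ s, ((x i : ℝ) - y i) ^ 2) / (D : ℝ) ^ 2) := by ring
    _ ≤ 3 := by rw [h2]; linarith

end FinMeas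

namespace FinMeas

section pairs

variable {A B C : Type*}

/-- The law of two conditionally independent samples of `ζ` given `f`. -/
def pairKer [DecidableEq B] (f : A → B) (ζ : FinMeas A) (x y : A) : ℝ :=
  if f x = f y then ζ.coeff x * ζ.coeff y / (push f ζ).coeff (f x) else 0

variable [DecidableEq B] {f : A → B} {ζ : FinMeas A}

lemma pairKer_nonneg (h : Nonneg ζ) (x y : A) : 0 ≤ pairKer f ζ x y := by
  rw [pairKer]
  split_ifs
  · exact div_nonneg (mul_nonneg (h x) (h y)) (h.push f _)
  · exact le_rfl

lemma pairKer_comm (x y : A) : pairKer f ζ x y = pairKer f ζ y x := by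
  rw [pairKer, pairKer]
  by_cases h : f x = f y
  · rw [if_pos h, if_pos h.symm, h, mul_comm]
  · rw [if_neg h, if_neg fun h' => h h'.symm]

lemma sum_pairKer (h : Nonneg ζ) (x : A) :
    ∑ y ∈ ζ.coeff.support, pairKer f ζ x y = ζ.coeff x := by
  have e : ∀ y ∈ ζ.coeff.support, pairKer f ζ x y =
      ζ.coeff x / (push f ζ).coeff (f x) * if f y = f x then ζ.coeff y else 0 := by
    intro y _
    rw [pairKer]
    by_cases h : f x = f y
    · rw [if_pos h, if_pos h.symm]; ring
    · rw [if_neg h, if_neg fun h' => h h'.symm, mul_zero]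
  rw [Finset.sum_congr rfl e, ← Finset.mul_sum, ← Finset.sum_filter, ← coeff_push f ζ subset_rfl]
  rcases (h.push f (f x)).eq_or_lt with h0 | h0
  · have := h.coeff_le_push f x
    rw [← h0] at this ⊢
    rw [mul_zero]
    exact le_antisymm (h x) this
  · rw [div_mul_cancel₀ _ h0.ne']

lemma sum_coeff_mul_push (g : A → C) (ζ : FinMeas A) (H : C → ℝ) :
    ∑ x ∈ ζ.coeff.support, ζ.coeff x * H (g x) =
      ∑ z ∈ (push g ζ).coeff.support, (push g ζ).coeff z * H z := by
  have := Finsupp.sum_mapDomain_index (f := g) (s := ζ.coeff) (h := fun z p => p * H z)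
    (fun _ => zero_mul _) (fun _ _ _ => add_mul _ _ _)
  exact this.symm

lemma sum_pairKer_push {f' : C → B} {g : A → C} (H : C → C → ℝ) :
    ∑ x ∈ ζ.coeff.support, ∑ y ∈ ζ.coeff.support,
      pairKer (fun x => f' (g x)) ζ x y * H (g x) (g y) =
    ∑ x ∈ (push g ζ).coeff.support, ∑ y ∈ (push g ζ).coeff.support,
      pairKer f' (push g ζ) x y * H x y := by
  have e : ∀ x y : A, pairKer (fun x => f' (g x)) ζ x y * H (g x) (g y) =
      ζ.coeff x * (ζ.coeff y * ((if f' (g x) = f' (g y) then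
        ((push f' (push g ζ)).coeff (f' (g x)))⁻¹ else 0) * H (g x) (g y))) := by
    intro x y
    rw [pairKer, push_push, Function.comp_def]
    split_ifs <;> ring
  simp only [e, ← Finset.mul_sum]
  have e2 : ∀ x : A, ∑ y ∈ ζ.coeff.support, ζ.coeff y * ((if f' (g x) = f' (g y) then
        ((push f' (push g ζ)).coeff (f' (g x)))⁻¹ else 0) * H (g x) (g y)) = _ := fun x =>
    sum_coeff_mul_push g ζ (fun z' => (if f' (g x) = f' z' then
        ((push f' (push g ζ)).coeff (f' (g x)))⁻¹ else 0) * H (g x) z')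
  simp only [e2]
  rw [sum_coeff_mul_push g ζ (fun z => ∑ z' ∈ (push g ζ).coeff.support, (push g ζ).coeff z' *
    ((if f' z = f' z' then ((push f' (push g ζ)).coeff (f' z))⁻¹ else 0) * H z z'))]
  refine Finset.sum_congr rfl fun x _ => ?_
  rw [Finset.mul_sum]
  refine Finset.sum_congr rfl fun y _ => ?_
  rw [pairKer]
  split_ifs <;> ring

/-- Conditional Gibbs inequality, the reference law depending on a conditionally independent
second sample. -/
lemma condEnt_le_sum_pairKer (h : Nonneg ζ) {ref : A → A → ℝ}
    (hpos : ∀ x y, 0 < ref x y)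
    (href : ∀ y ∈ ζ.coeff.support, ∑ x ∈ ζ.coeff.support with f x = f y, ref x y ≤ 1) :
    condEnt f ζ ≤ ∑ x ∈ ζ.coeff.support, ∑ y ∈ ζ.coeff.support,
      pairKer f ζ x y * -Real.log (ref x y) := by
  set s := ζ.coeff.support with hs
  have hcoeff : ∀ x ∈ s, 0 < ζ.coeff x := fun x hx =>
    lt_of_le_of_ne (h x) (Finsupp.mem_support_iff.1 hx).symm
  have hF : ∀ x ∈ s, 0 < (push f ζ).coeff (f x) := fun x hx =>
    (hcoeff x hx).trans_le (h.coeff_le_push f x)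
  have e1 : condEnt f ζ = ∑ x ∈ s, ∑ y ∈ s, pairKer f ζ x y *
      (Real.log ((push f ζ).coeff (f x)) - Real.log (ζ.coeff x)) := by
    rw [condEnt_eq f ζ subset_rfl]
    refine Finset.sum_congr rfl fun x _ => ?_
    rw [← Finset.sum_mul, sum_pairKer h]
  have e2 : ∀ x ∈ s, ∀ y ∈ s, pairKer f ζ x y *
      (Real.log ((push f ζ).coeff (f x)) - Real.log (ζ.coeff x)) ≤
      pairKer f ζ x y * -Real.log (ref x y) +
        ((if f x = f y then ζ.coeff y * ref x y else 0) - pairKer f ζ x y) := by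
    intro x hx y hy
    by_cases hxy : f x = f y
    · have h1 := hcoeff x hx
      have h2 := hF x hx
      have h3 := hpos x y
      have := Real.log_le_sub_one_of_pos (x := (push f ζ).coeff (f x) * ref x y / ζ.coeff x)
        (by positivity)
      rw [Real.log_div (by positivity) h1.ne', Real.log_mul h2.ne' h3.ne'] at this
      have h4 : pairKer f ζ x y * ((push f ζ).coeff (f x) * ref x y / ζ.coeff x) =
          ζ.coeff y * ref x y := by
        rw [pairKer, if_pos hxy]; field_simp
      have h5 := mul_le_mul_of_nonneg_left this (pairKer_nonneg (f := f) h x y)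
      rw [if_pos hxy]
      rw [mul_sub, mul_sub, h4] at h5
      linarith
    · rw [pairKer, if_neg hxy, if_neg hxy]; simp
  rw [e1]
  refine (Finset.sum_le_sum fun x hx => Finset.sum_le_sum fun y hy => e2 x hx y hy).trans ?_
  have e4 : ∑ x ∈ s, ∑ y ∈ s, pairKer f ζ x y = ∑ x ∈ s, ζ.coeff x :=
    Finset.sum_congr rfl fun x _ => sum_pairKer h x
  simp only [Finset.sum_add_distrib, Finset.sum_sub_distrib]
  have e3 : ∑ x ∈ s, ∑ y ∈ s, (if f x = f y then ζ.coeff y * ref x y else 0) ≤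
      ∑ y ∈ s, ζ.coeff y := by
    rw [Finset.sum_comm]
    refine Finset.sum_le_sum fun y hy => ?_
    rw [← Finset.sum_filter, ← Finset.mul_sum]
    exact mul_le_of_le_one_right (h y) (href y hy)
  linarith

end pairs

/-- Weight of the pairs at distance at least `D` inside cells of size `n`. -/
def farMass (D n : ℤ) (β : FinMeas ℤ) : ℝ :=
  ∑ x ∈ β.coeff.support, ∑ y ∈ β.coeff.support,
    pairKer (· / n) β x y * if D ≤ |x - y| then 1 else 0

lemma condEnt_div_le_farMass {β : FinMeas ℤ} (hβ : IsProb β) {D R : ℤ} (hD : 0 < D) (hR : 0 < R) :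
    ent (push (· / D) β) - ent (push (· / (D * R)) β) ≤
      Real.log 6 + farMass D (D * R) β * Real.log R := by
  have hR' : (1 : ℝ) ≤ R := by exact_mod_cast hR
  have hlogR : 0 ≤ Real.log R := Real.log_nonneg hR'
  have hpp : push (· / (D * R)) β = push (· / R) (push (· / D) β) := by
    rw [push_push]; congr 2; funext x; exact (Int.ediv_ediv_of_nonneg hD.le).symm
  rw [hpp]
  have hb := hβ.push (· / D)
  refine (condEnt_le_sum_pairKer (f := (· / R)) hb.1
    (ref := fun x y => (if |x - y| ≤ 1 then (1 / 6 : ℝ) else 0) + 1 / 2 / R)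
    (fun x y => add_pos_of_nonneg_of_pos (by split_ifs <;> norm_num) (by positivity)) ?_).trans ?_
  · intro y _
    rw [Finset.sum_add_distrib, Finset.sum_const, ← Finset.sum_filter, Finset.sum_const,
      nsmul_eq_mul, nsmul_eq_mul]
    set s := (push (· / D) β).coeff.support
    have h1 : (({x ∈ s | x / R = y / R}.filter fun x => |x - y| ≤ 1).card : ℝ) ≤ 3 := by
      have : ({x ∈ s | x / R = y / R}.filter fun x => |x - y| ≤ 1) ⊆
          Finset.Icc (y - 1) (y + 1) := by
        intro x hx
        rw [Finset.mem_filter, abs_le] at hx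
        rw [Finset.mem_Icc]
        omega
      have := Finset.card_le_card this
      rw [Int.card_Icc] at this
      exact_mod_cast this.trans (by omega)
    have h2 : (({x ∈ s | x / R = y / R}).card : ℝ) ≤ R := by
      have : ({x ∈ s | x / R = y / R}) ⊆ Finset.Ico (y / R * R) (y / R * R + R) := by
        intro x hx
        rw [Finset.mem_filter] at hx
        have h1 := Int.ediv_mul_le x hR.ne'
        have h2 := Int.lt_ediv_add_one_mul_self x hR
        rw [hx.2] at h1 h2
        rw [Finset.mem_Ico]
        constructor
        · exact h1
        · linarith
      have := Finset.card_le_card this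
      rw [Int.card_Ico] at this
      have h3 : (({x ∈ s | x / R = y / R}).card : ℤ) ≤ R := by omega
      exact_mod_cast h3
    have h3 : (({x ∈ s | x / R = y / R}).card : ℝ) * (1 / 2 / R) ≤ 1 / 2 := by
      calc _ ≤ (R : ℝ) * (1 / 2 / R) := by gcongr
        _ = 1 / 2 := by field_simp
    linarith
  · have key : ∀ x y : ℤ, -Real.log ((if |x - y| ≤ 1 then (1 / 6 : ℝ) else 0) + 1 / 2 / R) ≤
        Real.log 6 + (if 2 ≤ |x - y| then 1 else 0) * Real.log R := by
      intro x y
      by_cases h : |x - y| ≤ 1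
      · rw [if_pos h, if_neg (by omega), zero_mul, add_zero, ← Real.log_inv]
        refine Real.log_le_log (by positivity) ?_
        rw [inv_le_comm₀ (by positivity) (by norm_num)]
        have : (0 : ℝ) ≤ 1 / 2 / R := by positivity
        linarith
      · rw [if_neg h, if_pos (by omega), zero_add, one_mul, ← Real.log_inv,
          ← Real.log_mul (by norm_num) (by positivity)]
        refine Real.log_le_log (by positivity) ?_
        rw [inv_div, div_div_eq_mul_div, div_one]
        linarith
    set s := (push (· / D) β).coeff.support
    set q := pairKer (· / R) (push (· / D) β)
    calc _ ≤ ∑ x ∈ s, ∑ y ∈ s, q x y * (Real.log 6 + (if 2 ≤ |x - y| then 1 else 0) * Real.log R) :=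
          Finset.sum_le_sum fun x _ => Finset.sum_le_sum fun y _ =>
            mul_le_mul_of_nonneg_left (key x y) (pairKer_nonneg hb.1 x y)
      _ = Real.log 6 + (∑ x ∈ s, ∑ y ∈ s, q x y * (if 2 ≤ |x - y| then 1 else 0)) * Real.log R := by
          simp only [mul_add, Finset.sum_add_distrib, ← mul_assoc, ← Finset.sum_mul]
          have : ∑ x ∈ s, ∑ y ∈ s, q x y = 1 := by
            rw [← hb.sum_coeff]
            exact Finset.sum_congr rfl fun x _ => sum_pairKer hb.1 x
          rw [this, one_mul]
      _ ≤ _ := by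
          gcongr
          have := sum_pairKer_push (f' := (· / R)) (g := (· / D)) (ζ := β)
            (fun x y => if 2 ≤ |x - y| then (1 : ℝ) else 0)
          rw [← this, farMass]
          refine Finset.sum_le_sum fun x _ => Finset.sum_le_sum fun y _ => ?_
          have e : (fun x : ℤ => x / D / R) = fun x => x / (D * R) := by
            funext x; rw [Int.ediv_ediv_of_nonneg hD.le]
          rw [e]
          refine mul_le_mul_of_nonneg_left ?_ (pairKer_nonneg hβ.1 x y)
          by_cases h : 2 ≤ |x / D - y / D|
          · rw [if_pos h, if_pos]
            have a1 := Int.ediv_mul_le x hD.ne'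
            have a2 := Int.lt_ediv_add_one_mul_self x hD
            have a3 := Int.ediv_mul_le y hD.ne'
            have a4 := Int.lt_ediv_add_one_mul_self y hD
            rw [le_abs] at h ⊢
            rcases h with h | h
            · left; nlinarith
            · right; nlinarith
          · rw [if_neg h]; split_ifs <;> norm_num

end FinMeas

namespace FinMeas

lemma eq_sum_pairKer_two {β : FinMeas ℤ} (hβ : Nonneg β) (f : ℤ → ℤ) :
    β = ∑ z ∈ β.coeff.support ×ˢ β.coeff.support, pairKer f β z.1 z.2 • two z.1 z.2 := by
  have h1 : ∑ x ∈ β.coeff.support, ∑ y ∈ β.coeff.support, pairKer f β x y • dirac x = β := by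
    conv_rhs => rw [eq_sum_dirac β subset_rfl]
    exact Finset.sum_congr rfl fun x _ => by rw [← Finset.sum_smul, sum_pairKer hβ]
  have h2 : ∑ x ∈ β.coeff.support, ∑ y ∈ β.coeff.support, pairKer f β x y • dirac y = β := by
    rw [Finset.sum_comm]
    simp only [pairKer_comm (f := f) (ζ := β) _]
    conv_rhs => rw [← h1]
  rw [Finset.sum_product]
  simp only [two, smul_add, Finset.sum_add_distrib, smul_comm _ (1 / 2 : ℝ), ← Finset.smul_sum,
    h1, h2]
  rw [← add_smul]
  norm_num

lemma sum_prod_mul_sum {E : Type*} [DecidableEq E] (s : Finset E) (k : ℕ) {q : E → ℝ}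
    (hq : ∑ e ∈ s, q e = 1) (g : E → ℝ) :
    ∑ w ∈ Fintype.piFinset (fun _ : Fin k => s), (∏ l, q (w l)) * ∑ l, g (w l) =
      k * ∑ e ∈ s, q e * g e := by
  have h : ∀ l₀ : Fin k, ∑ w ∈ Fintype.piFinset (fun _ : Fin k => s), (∏ l, q (w l)) * g (w l₀) =
      ∑ e ∈ s, q e * g e := by
    intro l₀
    have h1 : ∀ w : Fin k → E, (∏ l, q (w l)) * g (w l₀) =
        ∏ l, (q (w l) * if l = l₀ then g (w l) else 1) := by
      intro w
      rw [Finset.prod_mul_distrib, Finset.prod_ite_eq' Finset.univ l₀ (fun l => g (w l)),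
        if_pos (Finset.mem_univ _)]
    simp only [h1]
    rw [← Finset.prod_univ_sum (fun _ => s) (fun l e => q e * if l = l₀ then g e else 1),
      ← Finset.mul_prod_erase _ _ (Finset.mem_univ l₀)]
    rw [Finset.prod_eq_one, mul_one]
    · simp
    · intro l hl
      simp [Finset.ne_of_mem_erase hl, hq]
  simp only [Finset.mul_sum]
  rw [Finset.sum_comm]
  simp only [h]
  simp [Finset.mul_sum]

lemma sum_prod_eq_one {E : Type*} [DecidableEq E] (s : Finset E) (k : ℕ) {q : E → ℝ}
    (hq : ∑ e ∈ s, q e = 1) :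
    ∑ w ∈ Fintype.piFinset (fun _ : Fin k => s), ∏ l, q (w l) = 1 := by
  rw [← Finset.prod_univ_sum (fun _ => s) (fun _ e => q e)]
  simp [hq]

lemma sum_smul_pow {E : Type*} [DecidableEq E] (s : Finset E) (k : ℕ) (q : E → ℝ)
    (τ : E → FinMeas ℤ) :
    (∑ e ∈ s, q e • τ e) ^ k =
      ∑ w ∈ Fintype.piFinset (fun _ : Fin k => s), (∏ l, q (w l)) • ∏ l, τ (w l) := by
  rw [← Fin.prod_const, Finset.prod_univ_sum (fun _ => s) (fun _ e => q e • τ e)]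
  exact Finset.sum_congr rfl fun w _ => by rw [Finset.prod_smul]

lemma push_div_div {D T : ℤ} (hD : 0 < D) (ζ : FinMeas ℤ) :
    push (· / T) (push (· / D) ζ) = push (· / (D * T)) ζ := by
  rw [push_push]
  congr 2
  funext x
  exact Int.ediv_ediv_of_nonneg hD.le

lemma condEnt_div_eq {D T : ℤ} (hD : 0 < D) (ζ : FinMeas ℤ) :
    condEnt (· / T) (push (· / D) ζ) = ent (push (· / D) ζ) - ent (push (· / (D * T)) ζ) := by
  rw [condEnt, push_div_div hD]

lemma support_mul_dirac {α : FinMeas ℤ} {z x : ℤ} (hx : x ∈ (α * dirac z).coeff.support) :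
    x - z ∈ α.coeff.support := by
  rw [mul_dirac, Finsupp.mem_support_iff, coeff_push _ _ subset_rfl] at hx
  obtain ⟨y, hy, -⟩ := Finset.exists_ne_zero_of_sum_ne_zero hx
  rw [Finset.mem_filter] at hy
  have : x - z = y := by have := hy.2; omega
  rw [this]; exact hy.1

lemma le_condEnt_mul_of_window {α τ : FinMeas ℤ} (hα : IsProb α) (hτ : IsProb τ) {D T b : ℤ}
    (hD : 0 < D) (hT : 0 < T) {N : ℕ}
    (hs : ∀ x ∈ α.coeff.support, b ≤ x ∧ x ≤ b + N * (D * T)) :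
    ent (push (· / D) α) - Real.log 3 - Real.log (N + 1 + 1) ≤
      condEnt (· / T) (push (· / D) (α * τ)) := by
  rw [mul_eq_sum_dirac, map_sum]
  simp only [map_smul]
  refine le_trans ?_ (sum_condEnt_le _ _ (fun i _ => hτ.1 i)
    fun z _ => ((hα.mul (isProb_dirac z)).push (· / D)).1)
  calc ent (push (· / D) α) - Real.log 3 - Real.log (N + 1 + 1)
      = ∑ z ∈ τ.coeff.support, τ.coeff z *
          (ent (push (· / D) α) - Real.log 3 - Real.log (N + 1 + 1)) := by
        rw [← Finset.sum_mul, hτ.sum_coeff, one_mul]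
    _ ≤ _ := by
        refine Finset.sum_le_sum fun z _ => mul_le_mul_of_nonneg_left ?_ (hτ.1 z)
        rw [condEnt_div_eq hD]
        have h1 := ent_push_div_mul_dirac hα hD z
        have h2 := (hα.mul (isProb_dirac z)).ent_push_div_le_of_window (mul_pos hD hT)
          (u := b + z) (N := N) (fun x hx => by
            have := hs _ (support_mul_dirac hx)
            constructor <;> linarith)
        linarith

lemma le_condEnt_mul_prod_two {α : FinMeas ℤ} (hα : IsProb α) {D R T : ℤ}
    (hD : 0 < D) {k : ℕ} {x y : Fin k → ℤ}
    (hk : (k : ℝ) * (R : ℝ) ^ 2 ≤ (T : ℝ) ^ 2) (hT : 0 < T)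
    (hxy : ∀ l, |(x l : ℝ) - y l| ≤ D * R) {c : ℝ} (hc : 0 < c * k)
    (hG : c * k ≤ ∑ l, if D ≤ |x l - y l| then (1 : ℝ) else 0) :
    Real.log (c * k) / 2 - (Real.log 3 + Real.log 2 * 3) ≤
      condEnt (· / T) (push (· / D) (α * ∏ l, two (x l) (y l))) := by
  have hpr : IsProb (∏ l, two (x l) (y l)) := IsProb.finset_prod fun l _ => isProb_two _ _
  rw [mul_comm α, mul_eq_sum_dirac, map_sum]
  simp only [map_smul]
  refine le_trans ?_ (sum_condEnt_le _ _ (fun i _ => hα.1 i)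
    fun z _ => ((hpr.mul (isProb_dirac z)).push (· / D)).1)
  calc Real.log (c * k) / 2 - (Real.log 3 + Real.log 2 * 3)
      = ∑ z ∈ α.coeff.support, α.coeff z *
          (Real.log (c * k) / 2 - (Real.log 3 + Real.log 2 * 3)) := by
        rw [← Finset.sum_mul, hα.sum_coeff, one_mul]
    _ ≤ _ := by
        refine Finset.sum_le_sum fun z _ => mul_le_mul_of_nonneg_left ?_ (hα.1 z)
        rw [condEnt_div_eq hD, mul_comm _ (dirac z)]
        have h2 := ent_push_div_mul_prod_two_le (s := Finset.univ) (x := x) (y := y)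
          (mul_pos hD hT) (W := D * R) (fun l _ => hxy l) (by
            rw [Finset.card_univ, Fintype.card_fin]
            push_cast
            have : (0 : ℝ) ≤ (D : ℝ) ^ 2 := by positivity
            nlinarith) z
        rw [Finset.sum_boole] at hG
        set G := Finset.univ.filter fun l => D ≤ |x l - y l| with hGdef
        have hGpos : G.Nonempty := by
          rw [← Finset.card_pos]
          exact_mod_cast hc.trans_le hG
        have h1 := le_ent_push_div_mul_prod_two (s := G) (x := x) (y := y) hD hGpos
          (fun l hl => by rw [abs_sub_comm]; exact (Finset.mem_filter.1 hl).2)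
          (γ := dirac z * ∏ l with ¬ D ≤ |x l - y l|, two (x l) (y l))
          ((isProb_dirac z).mul (IsProb.finset_prod fun l _ => isProb_two _ _))
        rw [mul_assoc, mul_comm (∏ l with ¬ D ≤ |x l - y l|, two (x l) (y l)), hGdef,
          Finset.prod_filter_mul_prod_filter_not] at h1
        have h3 := Real.log_le_log hc hG
        linarith

/-- Entropy growth of `α * β ^ k` across one block of scales. -/
lemma le_condEnt_mul_pow {α β : FinMeas ℤ} (hβ : IsProb β) {D R T : ℤ} (hD : 0 < D) (hR : 0 < R)
    (hT : 0 < T) {k N : ℕ} (hk : (k : ℝ) * (R : ℝ) ^ 2 ≤ (T : ℝ) ^ 2)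
    {ι : Type*} {s : Finset ι} {p : ι → ℝ} {a : ι → FinMeas ℤ} {b : ι → ℤ}
    (hp : ∀ u ∈ s, 0 ≤ p u) (hp1 : ∑ u ∈ s, p u = 1) (ha : ∀ u ∈ s, IsProb (a u))
    (hα : α = ∑ u ∈ s, p u • a u)
    (hwin : ∀ u ∈ s, ∀ x ∈ (a u).coeff.support, b u ≤ x ∧ x ≤ b u + N * (D * T))
    {e c B : ℝ} (hB : 0 ≤ B) (hc : 0 < c * k)
    (he : ∀ u ∈ s, e + Real.log 3 + Real.log (N + 1 + 1) ≤ ent (push (· / D) (a u)))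
    (heB : e + B ≤ Real.log (c * k) / 2 - (Real.log 3 + Real.log 2 * 3)) :
    e + (farMass D (D * R) β - c) * B ≤
      ent (push (· / D) (α * β ^ k)) - ent (push (· / (D * T)) (α * β ^ k)) := by
  classical
  rw [← condEnt_div_eq hD]
  set E := β.coeff.support ×ˢ β.coeff.support with hE
  set q : ℤ × ℤ → ℝ := fun z => pairKer (· / (D * R)) β z.1 z.2 with hqdef
  have hq0 : ∀ z, 0 ≤ q z := fun z => pairKer_nonneg hβ.1 _ _
  have hq1 : ∑ z ∈ E, q z = 1 := by
    rw [hE, Finset.sum_product, ← hβ.sum_coeff]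
    exact Finset.sum_congr rfl fun x _ => sum_pairKer hβ.1 x
  have hexp : push (· / D) (α * β ^ k) = ∑ w ∈ Fintype.piFinset (fun _ : Fin k => E), ∑ u ∈ s,
      ((∏ l, q (w l)) * p u) • push (· / D) (a u * ∏ l, two (w l).1 (w l).2) := by
    conv_lhs => rw [eq_sum_pairKer_two hβ.1 (· / (D * R)), sum_smul_pow, hα]
    rw [Finset.mul_sum, map_sum]
    refine Finset.sum_congr rfl fun w _ => ?_
    rw [Finset.sum_mul, map_sum]
    refine Finset.sum_congr rfl fun u _ => ?_
    rw [smul_mul_smul_comm, map_smul, mul_comm (p u)]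
  have hprod0 : ∀ w : Fin k → ℤ × ℤ, 0 ≤ ∏ l, q (w l) := fun w =>
    Finset.prod_nonneg fun l _ => hq0 _
  have hpr : ∀ w : Fin k → ℤ × ℤ, IsProb (∏ l, two (w l).1 (w l).2) := fun w =>
    IsProb.finset_prod fun l _ => isProb_two _ _
  set g : ℤ × ℤ → ℝ := fun z => if D ≤ |z.1 - z.2| then 1 else 0 with hg
  have hkpos : (0 : ℝ) < k := by
    rcases Nat.eq_zero_or_pos k with rfl | h
    · simp at hc
    · exact_mod_cast h
  have key : ∀ w ∈ Fintype.piFinset (fun _ : Fin k => E), ∀ u ∈ s,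
      (∏ l, q (w l)) * (e + ((∑ l, g (w l)) / k - c) * B) ≤ (∏ l, q (w l)) *
        condEnt (· / T) (push (· / D) (a u * ∏ l, two (w l).1 (w l).2)) := by
    intro w hw u hu
    by_cases h0 : ∏ l, q (w l) = 0
    · rw [h0, zero_mul, zero_mul]
    refine mul_le_mul_of_nonneg_left ?_ (hprod0 w)
    by_cases hG : c * k ≤ ∑ l, g (w l)
    · refine le_trans ?_ (le_condEnt_mul_prod_two (ha u hu) hD hk hT (fun l => ?_) hc hG)
      · refine le_trans ?_ heB
        have h1 : (∑ l, g (w l)) / k ≤ 1 := by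
          rw [div_le_one hkpos]
          calc ∑ l, g (w l) ≤ ∑ l : Fin k, (1 : ℝ) := Finset.sum_le_sum fun l _ => by
                rw [hg]; dsimp only; split_ifs <;> norm_num
            _ = k := by simp
        have hc' : 0 < c := pos_of_mul_pos_left hc hkpos.le
        nlinarith
      · have h1 : q (w l) ≠ 0 := fun h => h0 (Finset.prod_eq_zero (Finset.mem_univ l) h)
        rw [hqdef] at h1
        dsimp only at h1
        rw [pairKer] at h1
        have h2 : (w l).1 / (D * R) = (w l).2 / (D * R) := by
          by_contra h; exact h1 (if_neg h)
        have hDR := mul_pos hD hR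
        have a1 := Int.ediv_mul_le (w l).1 hDR.ne'
        have a2 := Int.lt_ediv_add_one_mul_self (w l).1 hDR
        have a3 := Int.ediv_mul_le (w l).2 hDR.ne'
        have a4 := Int.lt_ediv_add_one_mul_self (w l).2 hDR
        rw [h2] at a1 a2
        have : |(w l).1 - (w l).2| ≤ D * R := by
          rw [abs_le]; constructor <;> linarith
        exact_mod_cast this
    · push Not at hG
      have h1 := le_condEnt_mul_of_window (ha u hu) (hpr w) hD hT (hwin u hu)
      have h2 := he u hu
      have h3 : (∑ l, g (w l)) / k - c ≤ 0 := by
        rw [sub_nonpos, div_le_iff₀ hkpos]; exact hG.le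
      have := mul_nonpos_of_nonpos_of_nonneg h3 hB
      linarith
  rw [hexp, ← Finset.sum_product']
  refine le_trans ?_ (sum_condEnt_le _ _
    (fun z hz => mul_nonneg (hprod0 z.1) (hp _ (Finset.mem_product.1 hz).2))
    fun z hz => (((ha _ (Finset.mem_product.1 hz).2).mul (hpr z.1)).push (· / D)).1)
  rw [Finset.sum_product]
  have hfar : farMass D (D * R) β = ∑ z ∈ E, q z * g z := by
    rw [farMass, hE, Finset.sum_product]
  have hmean := sum_prod_mul_sum E k hq1 g
  calc e + (farMass D (D * R) β - c) * B
      = ∑ w ∈ Fintype.piFinset (fun _ : Fin k => E), (∏ l, q (w l)) *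
          (e + ((∑ l, g (w l)) / k - c) * B) := by
        have : ∀ w : Fin k → ℤ × ℤ, (∏ l, q (w l)) * (e + ((∑ l, g (w l)) / k - c) * B) =
            (∏ l, q (w l)) * (e - c * B) + ((∏ l, q (w l)) * ∑ l, g (w l)) * (B / k) := by
          intro w; ring
        simp only [this]
        rw [Finset.sum_add_distrib, ← Finset.sum_mul, ← Finset.sum_mul, hmean,
          sum_prod_eq_one E k hq1, hfar]
        field_simp
        ring
    _ = ∑ w ∈ Fintype.piFinset (fun _ : Fin k => E), ∑ u ∈ s, p u * ((∏ l, q (w l)) *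
          (e + ((∑ l, g (w l)) / k - c) * B)) := by
        refine Finset.sum_congr rfl fun w _ => ?_
        rw [← Finset.sum_mul, hp1, one_mul]
    _ ≤ _ := by
        refine Finset.sum_le_sum fun w hw => Finset.sum_le_sum fun u hu => ?_
        rw [mul_comm (∏ l, q (w l)) (p u), mul_assoc]
        exact mul_le_mul_of_nonneg_left (key w hw u hu) (hp u hu)

end FinMeas

namespace FinMeas

lemma sum_range_sub_shift_le {E : ℕ → ℝ} (h0 : ∀ j, 0 ≤ E j) (h1 : ∀ j, E j ≤ E 0) (J t : ℕ) :
    ∑ j ∈ Finset.range J, (E j - E (j + t)) ≤ t * E 0 := by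
  have e1 := Finset.sum_range_add (fun j => E j) J t
  have e2 := Finset.sum_range_add (fun j => E j) t J
  rw [add_comm t J] at e2
  rw [Finset.sum_sub_distrib]
  have e3 : ∑ j ∈ Finset.range J, E (j + t) = ∑ j ∈ Finset.range J, E (t + j) :=
    Finset.sum_congr rfl fun j _ => by rw [add_comm]
  have e4 : 0 ≤ ∑ j ∈ Finset.range t, E (J + j) := Finset.sum_nonneg fun j _ => h0 _
  have e5 : ∑ j ∈ Finset.range t, E j ≤ t * E 0 := by
    calc _ ≤ ∑ j ∈ Finset.range t, E 0 := Finset.sum_le_sum fun j _ => h1 j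
      _ = _ := by simp
  linarith

/-- A measure is a mixture of pieces of diameter about `2 ^ b` whose entropy at scale `2 ^ a`
is at least `e`. -/
def HasPieces (α : FinMeas ℤ) (N a b : ℕ) (e : ℝ) : Prop :=
  ∃ (n : ℕ) (p : Fin n → ℝ) (ζ : Fin n → FinMeas ℤ) (c : Fin n → ℤ),
    (∀ u, 0 ≤ p u) ∧ ∑ u, p u = 1 ∧ (∀ u, IsProb (ζ u)) ∧ α = ∑ u, p u • ζ u ∧
    (∀ u, ∀ x ∈ (ζ u).coeff.support, c u ≤ x ∧ x ≤ c u + N * 2 ^ b) ∧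
    ∀ u, e ≤ ent (push (· / 2 ^ a) (ζ u))

set_option maxHeartbeats 1000000 in
theorem ent_mul_pow_growth {d ε : ℝ} (hd : d < 1) (hε : 0 < ε) :
    ∃ τ > 0, ∃ δ > 0, ∃ r : ℕ, 1 ≤ r ∧ ∀ N : ℕ, ∃ t₀ : ℕ, ∀ t, t₀ ≤ t → ∃ M₀ : ℕ, ∀ M, M₀ ≤ M →
      ∀ α β : FinMeas ℤ, IsProb α → IsProb β →
      (∃ b : ℤ, ∀ x ∈ β.coeff.support, b ≤ x ∧ x ≤ b + N * 2 ^ M) →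
      ε * M * Real.log 2 ≤ ent β →
      (∀ a, a + t * r ≤ M → HasPieces α N a (a + t * r) ((d * Real.log 2 - τ) * (t * r : ℕ))) →
      (d * Real.log 2 + δ) * M ≤ ent (α * β ^ 4 ^ ((t - 1) * r)) := by
  have hl2 : 0 < Real.log 2 := Real.log_pos (by norm_num)
  set l := Real.log 2 with hl
  set κ := (1 - d) * l / 2 with hκdef
  have hκ : 0 < κ := by have := sub_pos.2 hd; positivity
  obtain ⟨r, hr⟩ := exists_nat_gt (Real.log 6 / (ε / 4 * l))
  have hrpos : 0 < r := by
    have : (0 : ℝ) < r :=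
      lt_of_le_of_lt (div_nonneg (Real.log_nonneg (by norm_num)) (by positivity)) hr
    exact_mod_cast this
  have hr0 : (0 : ℝ) < r := by exact_mod_cast hrpos
  rw [div_lt_iff₀ (by positivity)] at hr
  refine ⟨κ * ε / 8, by positivity, κ * ε / 8, by positivity, r, hrpos, fun N => ?_⟩
  set C1 := Real.log 3 + Real.log (N + 1 + 1) with hC1
  have hC1pos : 0 ≤ C1 := add_nonneg (Real.log_nonneg (by norm_num))
    (Real.log_nonneg (by have : (0 : ℝ) ≤ N := N.cast_nonneg; linarith))
  set c := ε / 4 with hc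
  have hcpos : 0 < c := by positivity
  obtain ⟨t₁, ht₁⟩ := exists_nat_gt
    ((r * l + Real.log 3 + l * 3 - Real.log c / 2) / (κ * r))
  obtain ⟨t₂, ht₂⟩ := exists_nat_gt (C1 / (r * κ * ε / 8))
  refine ⟨max (max t₁ t₂) 1, fun t ht => ?_⟩
  have ht1 : 1 ≤ t := (le_max_right _ _).trans ht
  have htpos : (0 : ℝ) < t := by exact_mod_cast ht1
  have hA : r * l + Real.log 3 + l * 3 - Real.log c / 2 ≤ κ * (t * r) := by
    have : (t₁ : ℝ) ≤ t := by exact_mod_cast (le_max_left _ _).trans ((le_max_left _ _).trans ht)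
    have := ht₁.trans_le this
    rw [div_lt_iff₀ (by positivity)] at this
    linarith
  have hB : C1 ≤ t * (r * κ * ε / 8) := by
    have : (t₂ : ℝ) ≤ t := by exact_mod_cast (le_max_right _ _).trans ((le_max_left _ _).trans ht)
    have := ht₂.trans_le this
    rw [div_lt_iff₀ (by positivity)] at this
    linarith
  set C2 := Real.log (N + 1 + 1) + (t + 1) * r * l with hC2
  set C3 := C2 / (r * l) with hC3
  have hC2pos : 0 ≤ C2 := add_nonneg
    (Real.log_nonneg (by have : (0 : ℝ) ≤ N := N.cast_nonneg; linarith)) (by positivity)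
  obtain ⟨M₁, hM₁⟩ := exists_nat_gt
    (((t + 1) * r * |d * l + κ * ε / 4| + κ * r * C3) / (κ * ε / 8))
  refine ⟨max M₁ ((t + 1) * r), fun M hM α β hα hβ hwin hent hpieces => ?_⟩
  have hM1 : (t + 1) * r * |d * l + κ * ε / 4| + κ * r * C3 ≤ M * (κ * ε / 8) := by
    have : (M₁ : ℝ) ≤ M := by exact_mod_cast (le_max_left _ _).trans hM
    have := hM₁.trans_le this
    rw [div_lt_iff₀ (by positivity)] at this
    linarith
  have hM2 : (t + 1) * r ≤ M := (le_max_right _ _).trans hM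
  set k := 4 ^ ((t - 1) * r) with hk
  set ζ := α * β ^ k with hζ
  have hζp : IsProb ζ := hα.mul (hβ.pow k)
  have htM : t + 1 ≤ M / r := (Nat.le_div_iff_mul_le hrpos).2 hM2
  obtain ⟨J, hJ⟩ : ∃ J, M / r = J + t := ⟨M / r - t, by omega⟩
  have hJ1 : (J + t) * r ≤ M := by rw [← hJ]; exact Nat.div_mul_le_self M r
  have hJ2 : M < (J + t + 1) * r := by
    rw [← hJ, mul_comm]; exact Nat.lt_mul_div_succ M hrpos
  have hJr : J * r ≤ M := (Nat.mul_le_mul_right r (Nat.le_add_right J t)).trans hJ1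
  have hJr' : (J : ℝ) * r ≤ M := by exact_mod_cast hJr
  have hJ1' : ((J : ℝ) + t) * r ≤ M := by exact_mod_cast hJ1
  have hJ2' : (M : ℝ) ≤ (J + t + 1) * r := by exact_mod_cast hJ2.le
  set E : ℕ → ℝ := fun j => ent (push (· / (2 : ℤ) ^ (j * r)) ζ) with hE
  set F : ℕ → ℝ := fun j => ent (push (· / (2 : ℤ) ^ (j * r)) β) with hF
  set P : ℕ → ℝ := fun j => farMass (2 ^ (j * r)) (2 ^ (j * r) * 2 ^ r) β with hP
  have hpush0 : ∀ ξ : FinMeas ℤ, push (· / (2 : ℤ) ^ (0 * r)) ξ = ξ := by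
    intro ξ
    conv_rhs => rw [← push_id ξ]
    congr 2
    funext x; simp
  have hE0 : E 0 = ent ζ := by rw [hE]; dsimp only; rw [hpush0]
  have hF0 : F 0 = ent β := by rw [hF]; dsimp only; rw [hpush0]
  -- entropy of `β` at the scales
  have hFstep : ∀ j, F j - F (j + 1) ≤ Real.log 6 + P j * (r * l) := by
    intro j
    have := condEnt_div_le_farMass hβ (D := 2 ^ (j * r)) (R := 2 ^ r) (by positivity)
      (by positivity)
    have e1 : (2 : ℤ) ^ ((j + 1) * r) = 2 ^ (j * r) * 2 ^ r := by rw [← pow_add]; congr 1; ring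
    have e2 : Real.log (((2 : ℤ) ^ r : ℤ) : ℝ) = r * l := by
      push_cast; rw [Real.log_pow]
    rw [e2] at this
    rw [hF]; dsimp only; rw [e1]; exact this
  have hFJ : F J ≤ C2 := by
    obtain ⟨b, hb⟩ := hwin
    have h1 := hβ.ent_push_div_le_of_window (n := 2 ^ (J * r)) (u := b) (by positivity)
      (N := N * 2 ^ (M - J * r)) (fun x hx => by
        have := hb x hx
        have e : (((N * 2 ^ (M - J * r) : ℕ)) : ℤ) * 2 ^ (J * r) = N * 2 ^ M := by
          push_cast
          rw [mul_assoc, ← pow_add, Nat.sub_add_cancel hJr]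
        rw [e]; exact this)
    refine h1.trans ?_
    have h2 : ((N * 2 ^ (M - J * r) : ℕ) : ℝ) + 1 + 1 ≤ (N + 1 + 1) * 2 ^ (M - J * r) := by
      push_cast
      have : (1 : ℝ) ≤ 2 ^ (M - J * r) := one_le_pow₀ (by norm_num)
      nlinarith
    refine (Real.log_le_log (by positivity) h2).trans ?_
    rw [Real.log_mul (by positivity) (by positivity), Real.log_pow, hC2]
    have h3 : ((M - J * r : ℕ) : ℝ) ≤ (t + 1) * r := by
      have : M - J * r ≤ (t + 1) * r := by
        rw [Nat.sub_le_iff_le_add]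
        exact hJ2.le.trans (le_of_eq (by ring))
      exact_mod_cast this
    gcongr
  have hPsum : 3 / 4 * ε * J - C3 ≤ ∑ j ∈ Finset.range J, P j := by
    have h1 : F 0 - F J ≤ ∑ j ∈ Finset.range J, (Real.log 6 + P j * (r * l)) := by
      rw [← Finset.sum_range_sub']
      exact Finset.sum_le_sum fun j _ => hFstep j
    rw [Finset.sum_add_distrib, ← Finset.sum_mul, Finset.sum_const, Finset.card_range,
      nsmul_eq_mul, hF0] at h1
    have h2 : (J : ℝ) * Real.log 6 ≤ J * (r * (ε / 4 * l)) := by gcongr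
    have h3 : ε * (J * r) * l ≤ ε * M * l := by
      gcongr
    have h4 : C2 = C3 * (r * l) := by rw [hC3]; field_simp
    have h5 : (3 / 4 * ε * J - C3) * (r * l) ≤ (∑ j ∈ Finset.range J, P j) * (r * l) := by
      linarith
    exact le_of_mul_le_mul_right h5 (by positivity)
  -- blocks
  have hblock : ∀ j ∈ Finset.range J, ((d * l - κ * ε / 8) * (t * r) - C1) +
      (P j - c) * (κ * (t * r)) ≤ E j - E (j + t) := by
    intro j hj
    rw [Finset.mem_range] at hj
    obtain ⟨n, p, ξ, b, hp, hp1, hξ, hαeq, hw, he⟩ := hpieces (j * r) (by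
      calc j * r + t * r = (j + t) * r := by ring
        _ ≤ (J + t) * r := by gcongr
        _ ≤ M := hJ1)
    have hkk : (0 : ℝ) < (k : ℕ) := by rw [hk]; positivity
    have := le_condEnt_mul_pow (α := α) hβ (D := 2 ^ (j * r)) (R := 2 ^ r) (T := 2 ^ (t * r))
      (k := k) (N := N)
      (by positivity) (by positivity) (by positivity) (by
        rw [hk]; push_cast
        rw [show (4 : ℝ) = 2 ^ 2 by norm_num, ← pow_mul, ← pow_mul, ← pow_mul, ← pow_add]
        refine le_of_eq ?_
        congr 1
        obtain ⟨t', rfl⟩ : ∃ t', t = t' + 1 := ⟨t - 1, by omega⟩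
        simp; ring)
      (s := Finset.univ) (p := p) (a := ξ) (b := b) (fun u _ => hp u) hp1 (fun u _ => hξ u) hαeq
      (fun u _ x hx => by rw [← pow_add]; exact hw u x hx)
      (e := (d * l - κ * ε / 8) * (t * r) - C1) (c := c) (B := κ * (t * r))
      (by positivity) (by positivity) (fun u _ => by
        have := he u
        push_cast at this
        linarith) (by
        rw [Real.log_mul hcpos.ne' hkk.ne', hk]
        push_cast
        rw [Real.log_pow, show (4 : ℝ) = 2 ^ 2 by norm_num, Real.log_pow]
        have e : (((t - 1) * r : ℕ) : ℝ) = (t - 1) * r := by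
          rw [Nat.cast_mul, Nat.cast_sub ht1, Nat.cast_one]
        rw [e]
        have h1 : (1 - d) * l = 2 * κ := by rw [hκdef]; ring
        have h2 : ((1 - d) * l) * (t * r) = 2 * κ * (t * r) := by rw [h1]
        have h3 : 0 ≤ κ * ε / 8 * (t * r) := by positivity
        push_cast
        linarith)
    have e1 : (2 : ℤ) ^ ((j + t) * r) = 2 ^ (j * r) * 2 ^ (t * r) := by
      rw [← pow_add]; congr 1; ring
    rw [hE]; dsimp only; rw [e1]; exact this
  have hsum := (Finset.sum_le_sum hblock).trans
    (sum_range_sub_shift_le (E := E) (fun j => (hζp.push _).ent_nonneg)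
      (fun j => (ent_push_le hζp.1 _).trans_eq hE0.symm) J t)
  rw [hE0, Finset.sum_add_distrib, ← Finset.sum_mul, Finset.sum_sub_distrib (f := P)] at hsum
  simp only [Finset.sum_const, Finset.card_range, nsmul_eq_mul] at hsum
  have hmul := mul_le_mul_of_nonneg_right hPsum (show 0 ≤ κ * (t * r) by positivity)
  have hCJ := mul_le_mul_of_nonneg_left hB (show (0 : ℝ) ≤ J by positivity)
  have h6 : t * (J * r * (d * l + κ * ε / 4) - κ * r * C3) ≤ t * ent ζ := by
    rw [hc] at hsum
    linarith
  have h7 := le_of_mul_le_mul_left h6 htpos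
  have h8 : M * (d * l + κ * ε / 4) - (t + 1) * r * |d * l + κ * ε / 4| ≤
      J * r * (d * l + κ * ε / 4) := by
    have h9 : 0 ≤ (M : ℝ) - J * r := sub_nonneg.2 hJr'
    have h10 : (M : ℝ) - J * r ≤ (t + 1) * r := by linarith
    have h11 : (M - J * r) * (d * l + κ * ε / 4) ≤ (t + 1) * r * |d * l + κ * ε / 4| :=
      (mul_le_mul_of_nonneg_left (le_abs_self _) h9).trans
        (mul_le_mul_of_nonneg_right h10 (abs_nonneg _))
    linarith
  linarith

end FinMeas

namespace FinMeas

section law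

variable {Ω A B : Type*} [MeasurableSpace Ω] {P : Measure Ω}

/-- `F` is a null-measurable map taking finitely many values almost surely. -/
def Disc (P : Measure Ω) (F : Ω → A) : Prop :=
  (∀ b, NullMeasurableSet (F ⁻¹' {b}) P) ∧ ∃ s : Finset A, ∀ᵐ ω ∂P, F ω ∈ s

open Classical in
/-- The law of `F` under `P`. -/
def law (P : Measure Ω) (F : Ω → A) : FinMeas A :=
  if h : (Function.support fun b => P.real (F ⁻¹' {b})).Finite then
    AddMonoidAlgebra.ofCoeff (Finsupp.ofSupportFinite _ h) else 0

lemma Disc.null_of_notMem {F : Ω → A} {s : Finset A} (hs : ∀ᵐ ω ∂P, F ω ∈ s) {b : A} (hb : b ∉ s) :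
    P (F ⁻¹' {b}) = 0 :=
  measure_mono_null (fun ω (hω : F ω = b) => by
    simp only [mem_compl_iff]; exact fun h => hb (hω ▸ h)) (mem_ae_iff.1 hs)

lemma coeff_law {F : Ω → A} (h : Disc P F) (b : A) :
    (law P F).coeff b = P.real (F ⁻¹' {b}) := by
  classical
  obtain ⟨s, hs⟩ := h.2
  have hf : (Function.support fun b => P.real (F ⁻¹' {b})).Finite := by
    refine s.finite_toSet.subset fun b hb => ?_
    by_contra hb'
    refine hb ?_
    change P.real (F ⁻¹' {b}) = 0
    rw [measureReal_def, Disc.null_of_notMem hs hb', ENNReal.toReal_zero]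
  rw [law, dif_pos hf]
  rfl

lemma Disc.support_subset {F : Ω → A} (h : Disc P F) {s : Finset A} (hs : ∀ᵐ ω ∂P, F ω ∈ s) :
    (law P F).coeff.support ⊆ s := by
  intro b hb
  by_contra hb'
  rw [Finsupp.mem_support_iff, coeff_law h, measureReal_def, Disc.null_of_notMem hs hb'] at hb
  exact hb rfl

lemma Disc.exists_of_mem_support {F : Ω → A} (h : Disc P F) {S : Set Ω} (hS : ∀ᵐ ω ∂P, ω ∈ S)
    {b : A} (hb : b ∈ (law P F).coeff.support) : ∃ ω ∈ S, F ω = b := by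
  by_contra! hne
  rw [Finsupp.mem_support_iff, coeff_law h, measureReal_def] at hb
  refine hb ?_
  have : P (F ⁻¹' {b}) = 0 :=
    measure_mono_null (t := Sᶜ) (fun ω hω hωS => hne ω hωS hω) (mem_ae_iff.1 hS)
  rw [this]
  rfl

lemma Disc.comp {F : Ω → A} (h : Disc P F) (g : A → B) : Disc P (g ∘ F) := by
  classical
  obtain ⟨s, hs⟩ := h.2
  refine ⟨fun c => ?_, s.image g, hs.mono fun ω hω => Finset.mem_image_of_mem g hω⟩
  have hu : NullMeasurableSet (⋃ b ∈ s.filter (g · = c), F ⁻¹' {b}) P :=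
    NullMeasurableSet.biUnion (Finset.countable_toSet _) fun b _ => h.1 b
  refine hu.congr ?_
  filter_upwards [hs] with ω hω
  refine propext ?_
  change ω ∈ (⋃ b ∈ s.filter (g · = c), F ⁻¹' {b}) ↔ ω ∈ (g ∘ F) ⁻¹' {c}
  simp [hω]

lemma measureReal_comp {F : Ω → A} [IsFiniteMeasure P] (h : Disc P F) {s : Finset A}
    (hs : ∀ᵐ ω ∂P, F ω ∈ s) (p : A → Prop) [DecidablePred p] :
    P.real {ω | p (F ω)} = ∑ b ∈ s with p b, P.real (F ⁻¹' {b}) := by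
  have h1 : P {ω | p (F ω)} = P (⋃ b ∈ s.filter p, F ⁻¹' {b}) := by
    refine measure_congr ?_
    filter_upwards [hs] with ω hω
    refine propext ?_
    change ω ∈ {ω | p (F ω)} ↔ ω ∈ (⋃ b ∈ s.filter p, F ⁻¹' {b})
    simp [hω]
  rw [measureReal_def, h1, measure_biUnion_finset₀ _ fun b _ => h.1 b, ENNReal.toReal_sum]
  · rfl
  · exact fun b _ => measure_ne_top _ _
  · intro b _ c _ hbc
    refine Disjoint.aedisjoint (Set.disjoint_left.2 fun ω h1 h2 => hbc ?_)
    exact h1.symm.trans h2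

lemma push_law [IsFiniteMeasure P] {F : Ω → A} (h : Disc P F) (g : A → B) :
    push g (law P F) = law P (g ∘ F) := by
  classical
  obtain ⟨s, hs⟩ := h.2
  ext c
  rw [coeff_push _ _ (h.support_subset hs), coeff_law (h.comp g)]
  simp only [coeff_law h]
  exact (measureReal_comp h hs (g · = c)).symm

lemma isProb_law [IsProbabilityMeasure P] {F : Ω → A} (h : Disc P F) : IsProb (law P F) := by
  refine ⟨fun b => by rw [coeff_law h]; exact measureReal_nonneg, ?_⟩
  rw [mass, push_law h, coeff_law (h.comp _)]
  have : ((fun _ : A => ()) ∘ F) ⁻¹' {()} = univ := by ext; simp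
  rw [this]
  simp

lemma law_map {Ω' : Type*} [MeasurableSpace Ω'] {f : Ω → Ω'} (hf : AEMeasurable f P) {F : Ω' → A}
    (hF : Disc (P.map f) F) (hF' : Disc P (F ∘ f)) : law (P.map f) F = law P (F ∘ f) := by
  ext b
  rw [coeff_law hF, coeff_law hF', measureReal_def, Measure.map_apply₀ hf (hF.1 b)]
  rfl

lemma law_mix {ι : Type*} {s : Finset ι} {p : ι → ℝ} (hp : ∀ i ∈ s, 0 ≤ p i)
    {Q : ι → Measure Ω} [∀ i, IsFiniteMeasure (Q i)]
    (hP : P = ∑ i ∈ s, ENNReal.ofReal (p i) • Q i) {F : Ω → A} (hF : Disc P F)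
    (hFi : ∀ i ∈ s, Disc (Q i) F) : law P F = ∑ i ∈ s, p i • law (Q i) F := by
  ext b
  rw [coeff_law hF, measureReal_def, hP, AddMonoidAlgebra.coeff_sum, Finsupp.finsetSum_apply]
  rw [Measure.finsetSum_apply, ENNReal.toReal_sum]
  · refine Finset.sum_congr rfl fun i hi => ?_
    rw [AddMonoidAlgebra.coeff_smul, Finsupp.smul_apply, coeff_law (hFi i hi), Measure.smul_apply,
      smul_eq_mul, ENNReal.toReal_mul, ENNReal.toReal_ofReal (hp i hi)]
    rfl
  · intro i _
    rw [Measure.smul_apply, smul_eq_mul]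
    exact ENNReal.mul_ne_top ENNReal.ofReal_ne_top (measure_ne_top _ _)

lemma Disc.prodMk {F : Ω → A} {G : Ω → B} (hF : Disc P F) (hG : Disc P G) :
    Disc P fun ω => (F ω, G ω) := by
  obtain ⟨s, hs⟩ := hF.2
  obtain ⟨t, ht⟩ := hG.2
  refine ⟨fun b => ?_, s ×ˢ t, ?_⟩
  · have : (fun ω => (F ω, G ω)) ⁻¹' {b} = F ⁻¹' {b.1} ∩ G ⁻¹' {b.2} := by
      ext ω; simp [Prod.ext_iff]
    rw [this]
    exact (hF.1 _).inter (hG.1 _)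
  · filter_upwards [hs, ht] with ω h1 h2
    exact Finset.mem_product.2 ⟨h1, h2⟩

end law

lemma card_le_of_abs_sub_le {s : Finset ℤ} {N : ℕ} (h : ∀ x ∈ s, ∀ y ∈ s, |x - y| ≤ N) :
    s.card ≤ N + 1 := by
  rcases s.eq_empty_or_nonempty with rfl | hs
  · simp
  have : s ⊆ Finset.Icc (s.min' hs) (s.min' hs + N) := by
    intro x hx
    have h1 := h x hx _ (s.min'_mem hs)
    rw [abs_le] at h1
    rw [Finset.mem_Icc]
    exact ⟨s.min'_le x hx, by linarith⟩
  have := Finset.card_le_card this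
  rw [Int.card_Icc] at this
  omega

variable {Ω : Type*} [MeasurableSpace Ω] {P : Measure Ω} [IsProbabilityMeasure P]

lemma ent_law_le_of_determines {F G : Ω → ℤ} (hF : Disc P F) (hG : Disc P G) {S : Set Ω}
    (hS : ∀ᵐ ω ∂P, ω ∈ S) {N : ℕ}
    (h : ∀ ω ∈ S, ∀ ω' ∈ S, F ω = F ω' → |G ω - G ω'| ≤ N) :
    ent (law P G) ≤ ent (law P F) + Real.log (N + 1) := by
  have hJ := hF.prodMk hG
  have e1 : law P F = push Prod.fst (law P fun ω => (F ω, G ω)) := (push_law hJ Prod.fst).symm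
  have e2 : law P G = push Prod.snd (law P fun ω => (F ω, G ω)) := (push_law hJ Prod.snd).symm
  rw [e1, e2]
  refine (isProb_law hJ).ent_push_le_add_log _ _ (by positivity) fun b s hs => ?_
  have : s.card ≤ N + 1 := by
    refine card_le_of_abs_sub_le fun x hx y hy => ?_
    obtain ⟨z, hz, hz1, rfl⟩ := hs x hx
    obtain ⟨z', hz', hz1', rfl⟩ := hs y hy
    obtain ⟨ω, hω, rfl⟩ := hJ.exists_of_mem_support hS hz
    obtain ⟨ω', hω', rfl⟩ := hJ.exists_of_mem_support hS hz'
    exact h ω hω ω' hω' (hz1.trans hz1'.symm)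
  exact_mod_cast this

lemma ent_mix_law_le_of_close {ι : Type*} {s : Finset ι} {c : ι → ℝ} (hc : ∀ i ∈ s, 0 ≤ c i)
    (hc1 : ∑ i ∈ s, c i = 1) {F G : ι → Ω → ℤ} (hF : ∀ i ∈ s, Disc P (F i))
    (hG : ∀ i ∈ s, Disc P (G i)) {S : Set Ω} (hS : ∀ᵐ ω ∂P, ω ∈ S) {N : ℕ}
    (h : ∀ i ∈ s, ∀ ω ∈ S, |F i ω - G i ω| ≤ N) :
    ent (∑ i ∈ s, c i • law P (G i)) ≤
      ent (∑ i ∈ s, c i • law P (F i)) + Real.log (2 * N + 1) := by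
  classical
  have hJ : ∀ i ∈ s, Disc P fun ω => (F i ω, G i ω) := fun i hi => (hF i hi).prodMk (hG i hi)
  set ζ := ∑ i ∈ s, c i • law P fun ω => (F i ω, G i ω) with hζ
  have e1 : ∑ i ∈ s, c i • law P (F i) = push Prod.fst ζ := by
    rw [hζ, map_sum]
    exact Finset.sum_congr rfl fun i hi => by rw [map_smul, push_law (hJ i hi)]; rfl
  have e2 : ∑ i ∈ s, c i • law P (G i) = push Prod.snd ζ := by
    rw [hζ, map_sum]
    exact Finset.sum_congr rfl fun i hi => by rw [map_smul, push_law (hJ i hi)]; rfl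
  rw [e1, e2]
  refine (IsProb.mix hc hc1 fun i hi => isProb_law (hJ i hi)).ent_push_le_of_close fun z hz => ?_
  rw [Finsupp.mem_support_iff, AddMonoidAlgebra.coeff_sum, Finsupp.finsetSum_apply] at hz
  obtain ⟨i, hi, h0⟩ := Finset.exists_ne_zero_of_sum_ne_zero hz
  have : z ∈ (law P fun ω => (F i ω, G i ω)).coeff.support := by
    rw [Finsupp.mem_support_iff]
    intro h1
    rw [AddMonoidAlgebra.coeff_smul, Finsupp.smul_apply, h1, smul_zero] at h0
    exact h0 rfl
  obtain ⟨ω, hω, rfl⟩ := (hJ i hi).exists_of_mem_support hS this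
  exact h i hi ω hω

end FinMeas

/-- `g` is bi-Lipschitz on the unit interval with constant `L`. -/
def BiLip (L : ℝ) (g : ℝ → ℝ) : Prop :=
  ∀ x ∈ unitI, ∀ y ∈ unitI, |x - y| ≤ L * |g x - g y| ∧ |g x - g y| ≤ L * |x - y|

/-- At every dyadic scale, `μ` is a mixture of images of itself under maps which contract by that
scale, up to the factor `C`. -/
def MultiScale (μ : Measure ℝ) (C : ℝ) : Prop :=
  ∀ i : ℕ, ∃ (n : ℕ) (p : Fin n → ℝ) (h : Fin n → ℝ → ℝ),
    (∀ u, 0 ≤ p u) ∧ ∑ u, p u = 1 ∧ (∀ u, MapsTo (h u) unitI unitI) ∧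
    (∀ u, BiLip C fun x => 2 ^ i * h u x) ∧ μ = ∑ u, ENNReal.ofReal (p u) • μ.map (h u)

lemma zero_mem_unitI : (0 : ℝ) ∈ unitI := ⟨le_rfl, zero_le_one⟩

lemma one_mem_unitI : (1 : ℝ) ∈ unitI := ⟨zero_le_one, le_rfl⟩

lemma abs_sub_le_one_of_mem_unitI {x y : ℝ} (hx : x ∈ unitI) (hy : y ∈ unitI) : |x - y| ≤ 1 := by
  rw [abs_le]
  constructor <;> linarith [hx.1, hx.2, hy.1, hy.2]

lemma isCompact_unitI : IsCompact unitI := isCompact_Icc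

lemma measurableSet_unitI : MeasurableSet unitI := measurableSet_Icc

lemma BiLip.pos {L : ℝ} {g : ℝ → ℝ} (h : BiLip L g) : 0 < L := by
  have := (h 0 zero_mem_unitI 1 one_mem_unitI).1
  by_contra! hL
  norm_num at this
  nlinarith [abs_nonneg (g 0 - g 1)]

lemma BiLip.mono {L L' : ℝ} {g : ℝ → ℝ} (h : BiLip L g) (hL : L ≤ L') : BiLip L' g :=
  fun x hx y hy => ⟨(h x hx y hy).1.trans (by gcongr), (h x hx y hy).2.trans (by gcongr)⟩

lemma BiLip.comp {L C a b : ℝ} {g h : ℝ → ℝ} (hg : BiLip L fun x => b * g x)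
    (hh : BiLip C fun x => a * h x)
    (hm : MapsTo h unitI unitI) : BiLip (L * C) fun x => a * b * g (h x) := by
  intro x hx y hy
  have h1 := hg _ (hm hx) _ (hm hy)
  have h2 := hh x hx y hy
  have hL := hg.pos
  have hC := hh.pos
  simp only [← mul_sub, abs_mul] at h1 h2 ⊢
  constructor
  · calc |x - y| ≤ C * (|a| * |h x - h y|) := h2.1
      _ ≤ C * (|a| * (L * (|b| * |g (h x) - g (h y)|))) := by gcongr; exact h1.1
      _ = _ := by ring
  · calc |a| * |b| * |g (h x) - g (h y)| = |a| * (|b| * |g (h x) - g (h y)|) := by ring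
      _ ≤ |a| * (L * |h x - h y|) := mul_le_mul_of_nonneg_left h1.2 (abs_nonneg a)
      _ = L * (|a| * |h x - h y|) := by ring
      _ ≤ L * (C * |x - y|) := mul_le_mul_of_nonneg_left h2.2 hL.le
      _ = _ := by ring

lemma BiLip.continuousOn {L : ℝ} {g : ℝ → ℝ} (h : BiLip L g) : ContinuousOn g unitI := by
  have : LipschitzOnWith L.toNNReal g unitI := by
    refine LipschitzOnWith.of_dist_le_mul fun x hx y hy => ?_
    rw [Real.dist_eq, Real.dist_eq, Real.coe_toNNReal _ h.pos.le]
    exact (h x hx y hy).2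
  exact this.continuousOn

lemma aemeasurable_of_continuousOn {μ : Measure ℝ} (hμ : μ unitIᶜ = 0) {g : ℝ → ℝ}
    (hg : ContinuousOn g unitI) : AEMeasurable g μ := by
  have := hg.aemeasurable measurableSet_unitI (μ := μ)
  rwa [Measure.restrict_eq_self_of_ae_mem (s := unitI) (mem_ae_iff.2 hμ)] at this

lemma map_compl_eq_zero {μ : Measure ℝ} (hμ : μ unitIᶜ = 0) {g : ℝ → ℝ}
    (hg : ContinuousOn g unitI) (hm : MapsTo g unitI unitI) : μ.map g unitIᶜ = 0 := by
  rw [Measure.map_apply_of_aemeasurable (aemeasurable_of_continuousOn hμ hg)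
    measurableSet_unitI.compl]
  exact measure_mono_null (fun x hx h => hx (hm h)) hμ

lemma ContinuousOn.const_mul_unitI {g : ℝ → ℝ} (h : ContinuousOn g unitI) (a : ℝ) :
    ContinuousOn (fun x => a * g x) unitI :=
  continuousOn_const.mul h

lemma continuousOn_const_mul_iff {a : ℝ} (ha : a ≠ 0) {g : ℝ → ℝ} :
    ContinuousOn (fun x => a * g x) unitI ↔ ContinuousOn g unitI :=
  ⟨fun h => by simpa [ha] using h.const_mul_unitI a⁻¹, fun h => h.const_mul_unitI a⟩

namespace FinMeas

lemma disc_floor {μ : Measure ℝ} (hμ : μ unitIᶜ = 0) {g : ℝ → ℝ} (hg : ContinuousOn g unitI) :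
    Disc μ fun x => ⌊g x⌋ := by
  refine ⟨fun b => ?_, ?_⟩
  · have : (fun x => ⌊g x⌋) ⁻¹' {b} = g ⁻¹' Ico (b : ℝ) (b + 1) := by
      ext x; simp [Int.floor_eq_iff]
    rw [this]
    exact (aemeasurable_of_continuousOn hμ hg).nullMeasurable measurableSet_Ico
  · obtain ⟨B, hB⟩ := isCompact_unitI.exists_bound_of_continuousOn hg
    refine ⟨Finset.Icc ⌊-B⌋ ⌊B⌋, ?_⟩
    filter_upwards [mem_ae_iff.2 hμ] with x hx
    have := abs_le.1 (hB x hx)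
    exact Finset.mem_Icc.2 ⟨Int.floor_le_floor this.1, Int.floor_le_floor this.2⟩

lemma law_floor_map {μ : Measure ℝ} (hμ : μ unitIᶜ = 0) {g h : ℝ → ℝ}
    (hg : ContinuousOn g unitI) (hh : ContinuousOn h unitI) (hm : MapsTo h unitI unitI) :
    law (μ.map h) (fun x => ⌊g x⌋) = law μ fun x => ⌊g (h x)⌋ :=
  law_map (aemeasurable_of_continuousOn hμ hh) (disc_floor (map_compl_eq_zero hμ hh hm) hg)
    (disc_floor hμ (hg.comp hh hm))

lemma law_floor_mix {μ : Measure ℝ} [IsFiniteMeasure μ] (hμ : μ unitIᶜ = 0) {n : ℕ}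
    {p : Fin n → ℝ} {h : Fin n → ℝ → ℝ} (hp : ∀ u, 0 ≤ p u)
    (hh : ∀ u, ContinuousOn (h u) unitI) (hm : ∀ u, MapsTo (h u) unitI unitI)
    (he : μ = ∑ u, ENNReal.ofReal (p u) • μ.map (h u)) {g : ℝ → ℝ} (hg : ContinuousOn g unitI) :
    law μ (fun x => ⌊g x⌋) = ∑ u, p u • law μ fun x => ⌊g (h u x)⌋ := by
  rw [law_mix (fun u _ => hp u) he (disc_floor hμ hg)
    fun u _ => disc_floor (map_compl_eq_zero hμ (hh u) (hm u)) hg]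
  exact Finset.sum_congr rfl fun u _ => by rw [law_floor_map hμ hg (hh u) (hm u)]

lemma abs_floor_sub_floor_le {a b : ℝ} {N : ℕ} (h : |a - b| ≤ N) : |⌊a⌋ - ⌊b⌋| ≤ (N + 1 : ℕ) := by
  have h1 := abs_le.1 h
  have : (|⌊a⌋ - ⌊b⌋| : ℝ) < N + 2 := by
    rw [abs_lt]
    constructor <;>
      linarith [Int.floor_le a, Int.floor_le b, Int.lt_floor_add_one a, Int.lt_floor_add_one b]
  have h3 : |⌊a⌋ - ⌊b⌋| < (N : ℤ) + 2 := by exact_mod_cast this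
  push_cast
  omega

lemma floor_two_pow_mul_ediv {a M : ℕ} (h : a ≤ M) (y : ℝ) :
    ⌊(2 : ℝ) ^ M * y⌋ / 2 ^ a = ⌊(2 : ℝ) ^ (M - a) * y⌋ := by
  have := Int.floor_div_natCast ((2 : ℝ) ^ M * y) (2 ^ a)
  push_cast at this
  rw [← this]
  congr 1
  obtain ⟨b, rfl⟩ := Nat.exists_eq_add_of_le h
  rw [Nat.add_sub_cancel_left, pow_add]
  field_simp

variable {μ : Measure ℝ} [IsProbabilityMeasure μ]

lemma ent_law_floor_le (hμ : μ unitIᶜ = 0) {L : ℕ} {g : ℝ → ℝ} (hg : BiLip L g) (m : ℕ) :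
    ent (law μ fun x => ⌊(2 : ℝ) ^ m * x⌋) ≤
      ent (law μ fun x => ⌊(2 : ℝ) ^ m * g x⌋) + Real.log (L + 2) := by
  have := ent_law_le_of_determines (P := μ) (N := L + 1)
    (disc_floor hμ (hg.continuousOn.const_mul_unitI (2 ^ m)))
    (disc_floor hμ (continuousOn_id.const_mul_unitI (2 ^ m))) (mem_ae_iff.2 hμ) ?_
  · refine this.trans (le_of_eq ?_)
    push_cast
    ring_nf
  · intro x hx y hy hxy
    refine abs_floor_sub_floor_le ?_
    simp only [id] at hxy ⊢
    have h1 : |(2 : ℝ) ^ m * g x - 2 ^ m * g y| < 1 := by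
      rw [abs_lt]
      have e : (⌊(2 : ℝ) ^ m * g x⌋ : ℝ) = ⌊(2 : ℝ) ^ m * g y⌋ := by exact_mod_cast hxy
      constructor <;> linarith [Int.floor_le ((2 : ℝ) ^ m * g x), Int.floor_le ((2 : ℝ) ^ m * g y),
        Int.lt_floor_add_one ((2 : ℝ) ^ m * g x), Int.lt_floor_add_one ((2 : ℝ) ^ m * g y)]
    rw [← mul_sub, abs_mul, abs_of_pos (by positivity)] at h1 ⊢
    calc (2 : ℝ) ^ m * |x - y| ≤ 2 ^ m * (L * |g x - g y|) := by
          gcongr; exact (hg x hx y hy).1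
      _ = L * (2 ^ m * |g x - g y|) := by ring
      _ ≤ L * 1 := by gcongr
      _ = L := mul_one _

lemma hasPieces_law_floor (hμ : μ unitIᶜ = 0) {L C : ℕ} (hC : MultiScale μ C) {g : ℝ → ℝ}
    (hg : BiLip L g) {M a m : ℕ} (h : a + m ≤ M) {e : ℝ}
    (he : e + Real.log ((L * C : ℕ) + 2) ≤ ent (law μ fun x => ⌊(2 : ℝ) ^ m * x⌋)) :
    HasPieces (law μ fun x => ⌊(2 : ℝ) ^ M * g x⌋) (2 * (L * C + 1)) a (a + m) e := by
  obtain ⟨i, rfl⟩ := Nat.exists_eq_add_of_le h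
  obtain ⟨n, p, h, hp, hp1, hm, hb, hmu⟩ := hC i
  have hh : ∀ u, ContinuousOn (h u) unitI := fun u =>
    (continuousOn_const_mul_iff (by positivity)).1 (hb u).continuousOn
  have hgc : ContinuousOn (fun x => (2 : ℝ) ^ (a + m + i) * g x) unitI :=
    hg.continuousOn.const_mul_unitI _
  have hgu : ∀ u, BiLip (L * C : ℕ) fun x => 2 ^ i * g (h u x) := fun u => by
    have hg1 : BiLip L fun x => 1 * g x := by simpa using hg
    simpa using hg1.comp (hb u) (hm u)
  have hd : ∀ u, Disc μ fun x => ⌊(2 : ℝ) ^ (a + m + i) * g (h u x)⌋ := fun u =>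
    disc_floor hμ (hgc.comp (hh u) (hm u))
  refine ⟨n, p, fun u => law μ fun x => ⌊(2 : ℝ) ^ (a + m + i) * g (h u x)⌋,
    fun u => ⌊(2 : ℝ) ^ (a + m + i) * g (h u 0)⌋ - (L * C + 1 : ℕ) * 2 ^ (a + m), hp, hp1,
    fun u => isProb_law (hd u), law_floor_mix hμ hp hh hm hmu hgc, fun u x hx => ?_, fun u => ?_⟩
  · obtain ⟨y, hy, rfl⟩ := (hd u).exists_of_mem_support (mem_ae_iff.2 hμ) hx
    have h1 : |⌊(2 : ℝ) ^ (a + m + i) * g (h u y)⌋ - ⌊(2 : ℝ) ^ (a + m + i) * g (h u 0)⌋| ≤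
        (L * C * 2 ^ (a + m) + 1 : ℕ) := by
      refine abs_floor_sub_floor_le ?_
      rw [← mul_sub, abs_mul, abs_of_pos (by positivity)]
      have := (hgu u y hy 0 zero_mem_unitI).2
      rw [← mul_sub, abs_mul, abs_of_pos (by positivity)] at this
      have h2 := abs_sub_le_one_of_mem_unitI hy zero_mem_unitI
      calc (2 : ℝ) ^ (a + m + i) * |g (h u y) - g (h u 0)|
          = 2 ^ (a + m) * (2 ^ i * |g (h u y) - g (h u 0)|) := by ring
        _ ≤ 2 ^ (a + m) * ((L * C : ℕ) * 1) :=
            mul_le_mul_of_nonneg_left (this.trans (by gcongr)) (by positivity)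
        _ = _ := by push_cast; ring
    have h3 : (L * C * 2 ^ (a + m) + 1 : ℕ) ≤ (L * C + 1) * 2 ^ (a + m) := by
      nlinarith [Nat.one_le_two_pow (n := a + m)]
    have h4 := abs_le.1 (h1.trans (Nat.cast_le.2 h3))
    push_cast at h4 ⊢
    constructor <;> linarith [h4.1, h4.2]
  · have := ent_law_floor_le hμ (hgu u) m
    rw [push_law (hd u)]
    have e1 : (fun z : ℤ => z / 2 ^ a) ∘ (fun x => ⌊(2 : ℝ) ^ (a + m + i) * g (h u x)⌋) =
        fun x => ⌊(2 : ℝ) ^ m * (2 ^ i * g (h u x))⌋ := by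
      funext x
      simp only [Function.comp_def]
      rw [floor_two_pow_mul_ediv (by omega), ← mul_assoc, ← pow_add]
      congr 3
      omega
    rw [e1]
    linarith

/-- The entropy of the image of `μ` under a bi-Lipschitz map. -/
lemma le_ent_law_floor (hμ : μ unitIᶜ = 0) {d : ℝ}
    (hD : ∀ τ > 0, ∃ M₀ : ℕ, ∀ M, M₀ ≤ M →
      (d - τ) * M * Real.log 2 ≤ ent (law μ fun x => ⌊(2 : ℝ) ^ M * x⌋)) (L : ℕ) {τ : ℝ}
    (hτ : 0 < τ) : ∃ M₀ : ℕ, ∀ M, M₀ ≤ M → ∀ g, BiLip L g →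
      (d * Real.log 2 - τ) * M ≤ ent (law μ fun x => ⌊(2 : ℝ) ^ M * g x⌋) := by
  have hl : 0 < Real.log 2 := Real.log_pos one_lt_two
  obtain ⟨M₁, h1⟩ := hD (τ / 2 / Real.log 2) (by positivity)
  refine ⟨max M₁ ⌈Real.log (L + 2) / (τ / 2)⌉₊, fun M hM g hg => ?_⟩
  have h2 := h1 M (le_of_max_le_left hM)
  have h3 := ent_law_floor_le hμ hg M
  have h4 : Real.log (L + 2) ≤ M * (τ / 2) := by
    rw [← div_le_iff₀ (by positivity)]
    exact (Nat.le_ceil _).trans (Nat.cast_le.2 (le_of_max_le_right hM))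
  have : (d - τ / 2 / Real.log 2) * M * Real.log 2 = (d * Real.log 2 - τ / 2) * M := by
    field_simp
  rw [this] at h2
  linarith

/-- Entropy growth under convolution for bi-Lipschitz images of `μ`. -/
theorem ent_law_mul_growth (hμ : μ unitIᶜ = 0) {C : ℕ} (hC : MultiScale μ C) {d : ℝ} (hd1 : d < 1)
    (hD : ∀ τ > 0, ∃ M₀ : ℕ, ∀ M, M₀ ≤ M →
      (d - τ) * M * Real.log 2 ≤ ent (law μ fun x => ⌊(2 : ℝ) ^ M * x⌋)) (L : ℕ) {ε : ℝ}
    (hε : 0 < ε) :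
    ∃ δ > 0, ∃ M₀ : ℕ, ∀ M, M₀ ≤ M → ∀ g, BiLip L g → ∀ β : FinMeas ℤ, IsProb β →
      (∃ b : ℤ, ∀ x ∈ β.coeff.support, b ≤ x ∧ x ≤ b + L * 2 ^ M) → ε * M * Real.log 2 ≤ ent β →
      (d * Real.log 2 + δ) * M ≤ ent (law μ (fun x => ⌊(2 : ℝ) ^ M * g x⌋) * β) := by
  have hl : 0 < Real.log 2 := Real.log_pos one_lt_two
  obtain ⟨τ, hτ, δ, hδ, r, hr, H⟩ := ent_mul_pow_growth hd1 hε
  obtain ⟨t₀, H⟩ := H (L + 2 * (L * C + 1))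
  obtain ⟨M₁, h1⟩ := hD (τ / 2 / Real.log 2) (by positivity)
  set t := max t₀ (max M₁ ⌈Real.log ((L * C : ℕ) + 2) / (τ / 2)⌉₊) with ht
  obtain ⟨M₂, H⟩ := H t (le_max_left _ _)
  have htr : t ≤ t * r := Nat.le_mul_of_pos_right _ hr
  have hpiece : (d * Real.log 2 - τ) * (t * r : ℕ) + Real.log ((L * C : ℕ) + 2) ≤
      ent (law μ fun x => ⌊(2 : ℝ) ^ (t * r) * x⌋) := by
    have h2 := h1 (t * r) (by omega)
    have h4 : Real.log ((L * C : ℕ) + 2) ≤ (t * r : ℕ) * (τ / 2) := by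
      rw [← div_le_iff₀ (by positivity)]
      exact (Nat.le_ceil _).trans (Nat.cast_le.2 (by omega))
    have : (d - τ / 2 / Real.log 2) * (t * r : ℕ) * Real.log 2 =
        (d * Real.log 2 - τ / 2) * (t * r : ℕ) := by field_simp
    rw [this] at h2
    linarith
  set k : ℕ := 4 ^ ((t - 1) * r) with hk
  have hk1 : (1 : ℝ) ≤ k := by exact_mod_cast Nat.one_le_pow _ _ (by norm_num)
  obtain ⟨M₃, h3⟩ := le_ent_law_floor hμ hD L (τ := δ / (2 * k)) (by positivity)
  refine ⟨δ / (2 * k), by positivity, max M₂ M₃, fun M hM g hg β hβ ⟨b, hb⟩ hent => ?_⟩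
  have hα : IsProb (law μ fun x => ⌊(2 : ℝ) ^ M * g x⌋) :=
    isProb_law (disc_floor hμ (hg.continuousOn.const_mul_unitI _))
  have h5 := H M (le_of_max_le_left hM) _ β hα hβ ?_ hent ?_
  · have h6 := ent_mul_pow_le hα hβ k
    have h7 := h3 M (le_of_max_le_right hM) g hg
    set E := ent (law μ fun x => ⌊(2 : ℝ) ^ M * g x⌋)
    set E' := ent ((law μ fun x => ⌊(2 : ℝ) ^ M * g x⌋) * β)
    have h8 : (d * Real.log 2 + δ) * M + (k - 1) * E ≤ k * E' := by linarith
    have h9 : (k - 1) * ((d * Real.log 2 - δ / (2 * k)) * M) ≤ (k - 1) * E :=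
      mul_le_mul_of_nonneg_left h7 (by linarith)
    have h10 : k * ((d * Real.log 2 + δ / (2 * k)) * M) ≤ k * E' := by
      have e1 : k * ((d * Real.log 2 + δ / (2 * k)) * M) =
          k * (d * Real.log 2 * M) + δ / 2 * M := by
        field_simp
      have e2 : (k - 1) * ((d * Real.log 2 - δ / (2 * k)) * M) =
          (k - 1) * (d * Real.log 2 * M) - δ / 2 * M + δ / (2 * k) * M := by
        field_simp
        ring
      have : 0 ≤ δ / (2 * k) * M := by positivity
      nlinarith
    exact le_of_mul_le_mul_left h10 (by linarith)
  · refine ⟨b, fun x hx => ⟨(hb x hx).1, (hb x hx).2.trans ?_⟩⟩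
    push_cast
    have : (0 : ℤ) ≤ 2 * (L * C + 1) := by positivity
    have : (0 : ℤ) ≤ 2 * (L * C + 1) * 2 ^ M := by positivity
    linarith
  · intro a ha
    obtain ⟨n, p, ζ, c, h1, h2, h3, h4, h5, h6⟩ := hasPieces_law_floor hμ hC hg ha hpiece
    refine ⟨n, p, ζ, c, h1, h2, h3, h4, fun u x hx => ⟨(h5 u x hx).1, (h5 u x hx).2.trans ?_⟩, h6⟩
    gcongr
    omega

end FinMeas

section deriv

lemma exists_sub_eq_deriv_mul {h : ℝ → ℝ} (hd : ∀ x ∈ unitI, DifferentiableAt ℝ h x) {x y : ℝ}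
    (hx : x ∈ unitI) (hy : y ∈ unitI) : ∃ c ∈ unitI, h x - h y = deriv h c * (x - y) := by
  wlog hxy : x < y generalizing x y
  · rcases eq_or_lt_of_le (not_lt.1 hxy) with rfl | hlt
    · exact ⟨y, hy, by simp⟩
    · obtain ⟨c, hc, h1⟩ := this hy hx hlt
      exact ⟨c, hc, by linarith⟩
  have hsub : Icc x y ⊆ unitI := fun z hz => ⟨hx.1.trans hz.1, hz.2.trans hy.2⟩
  obtain ⟨c, hc, h1⟩ := exists_deriv_eq_slope h hxy
    (fun z hz => (hd z (hsub hz)).continuousAt.continuousWithinAt)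
    fun z hz => (hd z (hsub (Ioo_subset_Icc_self hz))).differentiableWithinAt
  refine ⟨c, hsub (Ioo_subset_Icc_self hc), ?_⟩
  rw [h1]
  field_simp [(sub_pos.2 hxy).ne']
  ring

lemma bilip_of_deriv {h : ℝ → ℝ} (hd : ∀ x ∈ unitI, DifferentiableAt ℝ h x) {L : ℝ} (hL : 0 < L)
    (h1 : ∀ x ∈ unitI, L⁻¹ ≤ |deriv h x|) (h2 : ∀ x ∈ unitI, |deriv h x| ≤ L) : BiLip L h := by
  intro x hx y hy
  obtain ⟨c, hc, e⟩ := exists_sub_eq_deriv_mul hd hx hy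
  rw [e, abs_mul]
  refine ⟨?_, mul_le_mul_of_nonneg_right (h2 c hc) (abs_nonneg _)⟩
  calc |x - y| = L * (L⁻¹ * |x - y|) := by field_simp
    _ ≤ L * (|deriv h c| * |x - y|) := by gcongr; exact h1 c hc

end deriv

/-- Differentiable self-maps of the unit interval whose derivative has a `K`-Lipschitz logarithm. -/
structure Distort (K : ℝ) (h : ℝ → ℝ) : Prop where
  mapsTo : MapsTo h unitI unitI
  differentiableAt : ∀ x ∈ unitI, DifferentiableAt ℝ h x
  deriv_ne_zero : ∀ x ∈ unitI, deriv h x ≠ 0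
  log_deriv : ∀ x ∈ unitI, ∀ y ∈ unitI,
    |Real.log (deriv h x) - Real.log (deriv h y)| ≤ K * |x - y|

lemma distort_id {K : ℝ} (hK : 0 ≤ K) : Distort K id where
  mapsTo := fun _ h => h
  differentiableAt := fun _ _ => differentiableAt_id
  deriv_ne_zero := fun x _ => by simp
  log_deriv := fun x _ y _ => by simpa using by positivity

lemma Distort.continuousOn {K : ℝ} {h : ℝ → ℝ} (hh : Distort K h) : ContinuousOn h unitI :=
  fun x hx => (hh.differentiableAt x hx).continuousAt.continuousWithinAt

lemma Distort.deriv_comp {K K' : ℝ} {h g : ℝ → ℝ} (hh : Distort K h) (hg : Distort K' g) {x : ℝ}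
    (hx : x ∈ unitI) : deriv (h ∘ g) x = deriv h (g x) * deriv g x :=
  _root_.deriv_comp x (hh.differentiableAt _ (hg.mapsTo hx)) (hg.differentiableAt x hx)

lemma Distort.comp {K K' r : ℝ} {h g : ℝ → ℝ} (hh : Distort K h) (hg : Distort K' g) (hK : 0 ≤ K)
    (hr : ∀ x ∈ unitI, |deriv g x| ≤ r) (hKr : K * r + K' ≤ K) : Distort K (h ∘ g) where
  mapsTo := hh.mapsTo.comp hg.mapsTo
  differentiableAt := fun x hx =>
    (hh.differentiableAt _ (hg.mapsTo hx)).comp x (hg.differentiableAt x hx)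
  deriv_ne_zero := fun x hx => by
    rw [hh.deriv_comp hg hx]
    exact mul_ne_zero (hh.deriv_ne_zero _ (hg.mapsTo hx)) (hg.deriv_ne_zero x hx)
  log_deriv := fun x hx y hy => by
    rw [hh.deriv_comp hg hx, hh.deriv_comp hg hy,
      Real.log_mul (hh.deriv_ne_zero _ (hg.mapsTo hx)) (hg.deriv_ne_zero x hx),
      Real.log_mul (hh.deriv_ne_zero _ (hg.mapsTo hy)) (hg.deriv_ne_zero y hy)]
    have h1 := hh.log_deriv _ (hg.mapsTo hx) _ (hg.mapsTo hy)
    have h2 := hg.log_deriv x hx y hy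
    obtain ⟨c, hc, e⟩ := exists_sub_eq_deriv_mul hg.differentiableAt hx hy
    rw [e, abs_mul] at h1
    have h3 : K * (|deriv g c| * |x - y|) ≤ K * (r * |x - y|) := by gcongr; exact hr c hc
    have h4 : (K * r + K') * |x - y| ≤ K * |x - y| := by gcongr
    rw [add_sub_add_comm]
    refine (abs_add_le _ _).trans ?_
    linarith

lemma Distort.exp_mul_le {K : ℝ} {h : ℝ → ℝ} (hh : Distort K h) (hK : 0 ≤ K) {x y : ℝ}
    (hx : x ∈ unitI) (hy : y ∈ unitI) : Real.exp (-K) * |deriv h x| ≤ |deriv h y| := by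
  have h1 := (abs_le.1 (hh.log_deriv x hx y hy)).2
  have h2 : K * |x - y| ≤ K * 1 := by gcongr; exact abs_sub_le_one_of_mem_unitI hx hy
  rw [← Real.exp_log (abs_pos.2 (hh.deriv_ne_zero x hx)),
    ← Real.exp_log (abs_pos.2 (hh.deriv_ne_zero y hy)), ← Real.exp_add, Real.exp_le_exp,
    Real.log_abs, Real.log_abs]
  linarith

/-- `θ` is a finite mixture of images of `μ` under maps in `S`. -/
def IsMix (μ : Measure ℝ) (S : Set (ℝ → ℝ)) (θ : Measure ℝ) : Prop :=
  ∃ (κ : Type) (_ : Fintype κ) (p : κ → ℝ) (h : κ → ℝ → ℝ), (∀ u, 0 ≤ p u) ∧ ∑ u, p u = 1 ∧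
    (∀ u, h u ∈ S) ∧ θ = ∑ u, ENNReal.ofReal (p u) • μ.map (h u)

lemma isMix_map {μ : Measure ℝ} {S : Set (ℝ → ℝ)} {h : ℝ → ℝ} (hh : h ∈ S) :
    IsMix μ S (μ.map h) :=
  ⟨Unit, inferInstance, fun _ => 1, fun _ => h, by simp, by simp, fun _ => hh, by simp⟩

lemma IsMix.sum {μ : Measure ℝ} {S : Set (ℝ → ℝ)} {Λ : Type} [Fintype Λ] {p : Λ → ℝ}
    (hp : ∀ i, 0 ≤ p i) (hp1 : ∑ i, p i = 1) {θ : Λ → Measure ℝ} (hθ : ∀ i, IsMix μ S (θ i)) :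
    IsMix μ S (∑ i, ENNReal.ofReal (p i) • θ i) := by
  choose κ hκ q h h1 h2 h3 h4 using hθ
  refine ⟨Σ i, κ i, inferInstance, fun z => p z.1 * q z.1 z.2, fun z => h z.1 z.2,
    fun z => mul_nonneg (hp _) (h1 _ _), ?_, fun z => h3 _ _, ?_⟩
  · rw [Fintype.sum_sigma]
    simp only [← Finset.mul_sum, h2, mul_one, hp1]
  · rw [Fintype.sum_sigma]
    refine Finset.sum_congr rfl fun i _ => ?_
    conv_lhs => rw [h4 i]
    rw [Finset.smul_sum]
    refine Finset.sum_congr rfl fun u _ => ?_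
    rw [ENNReal.ofReal_mul (hp i), smul_smul]

lemma map_eq_sum_map_comp {μ : Measure ℝ} (hμI : μ unitIᶜ = 0) {Λ : Type} [Fintype Λ]
    {φ : Λ → ℝ → ℝ} {p : Λ → ℝ} (hc : ∀ i, ContinuousOn (φ i) unitI)
    (hmaps : ∀ i, MapsTo (φ i) unitI unitI)
    (hμ : μ = ∑ i : Λ, ENNReal.ofReal (p i) • μ.map (φ i)) {h : ℝ → ℝ}
    (hh : ContinuousOn h unitI) :
    μ.map h = ∑ i, ENNReal.ofReal (p i) • μ.map (h ∘ φ i) := by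
  ext s hs
  rw [Measure.map_apply_of_aemeasurable (aemeasurable_of_continuousOn hμI hh) hs]
  conv_lhs => rw [hμ]
  simp only [Measure.finsetSum_apply, Measure.smul_apply]
  refine Finset.sum_congr rfl fun i _ => ?_
  have h1 : AEMeasurable h (μ.map (φ i)) :=
    aemeasurable_of_continuousOn (map_compl_eq_zero hμI (hc i) (hmaps i)) hh
  rw [← Measure.map_apply_of_aemeasurable h1 hs,
    h1.map_map_of_aemeasurable (aemeasurable_of_continuousOn hμI (hc i))]

section IFS

variable {Λ : Type} [Fintype Λ] [Nonempty Λ] {φ : Λ → ℝ → ℝ}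

lemma exists_deriv_bounds (hanal : ∀ i, AnalyticOnNhd ℝ (φ i) unitI)
    (hderiv : ∀ i, ∀ x ∈ unitI, 0 < |deriv (φ i) x| ∧ |deriv (φ i) x| < 1) :
    ∃ s > 0, ∃ r < 1, ∀ i, ∀ x ∈ unitI, s ≤ |deriv (φ i) x| ∧ |deriv (φ i) x| ≤ r := by
  have hc : ∀ i, ContinuousOn (fun x => |deriv (φ i) x|) unitI := fun i =>
    (hanal i).deriv.continuousOn.abs
  have hne : unitI.Nonempty := ⟨0, zero_mem_unitI⟩
  choose a ha ha' using fun i => isCompact_unitI.exists_isMinOn hne (hc i)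
  choose b hb hb' using fun i => isCompact_unitI.exists_isMaxOn hne (hc i)
  obtain ⟨i, hi⟩ := Finite.exists_min fun i => |deriv (φ i) (a i)|
  obtain ⟨j, hj⟩ := Finite.exists_max fun i => |deriv (φ i) (b i)|
  exact ⟨_, (hderiv i _ (ha i)).1, _, (hderiv j _ (hb j)).2, fun l x hx =>
    ⟨(hi l).trans (ha' l hx), (hb' l hx).trans (hj l)⟩⟩

lemma exists_distort (hanal : ∀ i, AnalyticOnNhd ℝ (φ i) unitI)
    (hmaps : ∀ i, MapsTo (φ i) unitI unitI) (hderiv : ∀ i, ∀ x ∈ unitI, deriv (φ i) x ≠ 0) :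
    ∃ K, 0 ≤ K ∧ ∀ i, Distort K (φ i) := by
  have hl : ∀ i, AnalyticOnNhd ℝ (deriv (φ i)) unitI := fun i => (hanal i).deriv
  have hd : ∀ i, ∀ x ∈ unitI, HasDerivAt (fun x => Real.log (deriv (φ i) x))
      (deriv (deriv (φ i)) x / deriv (φ i) x) x := fun i x hx =>
    (hl i x hx).differentiableAt.hasDerivAt.log (hderiv i x hx)
  have hc : ∀ i, ContinuousOn (fun x => deriv (deriv (φ i)) x / deriv (φ i) x) unitI := fun i =>
    (hl i).deriv.continuousOn.div (hl i).continuousOn (hderiv i)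
  choose B hB using fun i => isCompact_unitI.exists_bound_of_continuousOn (hc i)
  obtain ⟨j, hj⟩ := Finite.exists_max B
  have hB' : ∀ i, ∀ x ∈ unitI, |deriv (deriv (φ i)) x / deriv (φ i) x| ≤ B j := fun i x hx =>
    (hB i x hx).trans (hj i)
  refine ⟨B j, (abs_nonneg _).trans (hB' j 0 zero_mem_unitI), fun i =>
    ⟨hmaps i, fun x hx => (hanal i x hx).differentiableAt, hderiv i, fun x hx y hy => ?_⟩⟩
  obtain ⟨c, hc, e⟩ := exists_sub_eq_deriv_mul (fun x hx => (hd i x hx).differentiableAt) hx hy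
  rw [e, abs_mul, (hd i c hc).deriv]
  exact mul_le_mul_of_nonneg_right (hB' i c hc) (abs_nonneg _)

lemma isMix_map_of_le {K s r t : ℝ} (hφ : ∀ i, Distort K (φ i))
    (hs : 0 < s)
    (hsr : ∀ i, ∀ x ∈ unitI, s ≤ |deriv (φ i) x| ∧ |deriv (φ i) x| ≤ r) {K' : ℝ} (hK' : 0 ≤ K')
    (hKr : K' * r + K ≤ K')
    {p : Λ → ℝ} (hp : ∀ i, 0 ≤ p i) (hp1 : ∑ i, p i = 1) {μ : Measure ℝ} (hμI : μ unitIᶜ = 0)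
    (hμ : μ = ∑ i : Λ, ENNReal.ofReal (p i) • μ.map (φ i)) (N : ℕ) {h : ℝ → ℝ}
    (hh : Distort K' h) (h1 : ∀ x ∈ unitI, r ^ N * |deriv h x| ≤ t)
    (h2 : ∀ x ∈ unitI, Real.exp (-K') * s * t ≤ |deriv h x|) :
    IsMix μ {g | Distort K' g ∧
      ∀ x ∈ unitI, Real.exp (-K') * s * t ≤ |deriv g x| ∧ |deriv g x| ≤ t} (μ.map h) := by
  induction N generalizing h with
  | zero => exact isMix_map ⟨hh, fun x hx => ⟨h2 x hx, by simpa using h1 x hx⟩⟩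
  | succ N ih =>
    by_cases hle : ∀ x ∈ unitI, |deriv h x| ≤ t
    · exact isMix_map ⟨hh, fun x hx => ⟨h2 x hx, hle x hx⟩⟩
    push Not at hle
    obtain ⟨z, hz, hzt⟩ := hle
    rw [map_eq_sum_map_comp hμI (fun i => (hφ i).continuousOn) (fun i => (hφ i).mapsTo) hμ
      hh.continuousOn]
    have hr : 0 ≤ r := by
      obtain ⟨i⟩ := ‹Nonempty Λ›
      exact (abs_nonneg _).trans (hsr i 0 zero_mem_unitI).2
    refine IsMix.sum hp hp1 fun i => ih ?_ ?_ ?_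
    · exact hh.comp (hφ i) hK' (fun x hx => (hsr i x hx).2) hKr
    · intro x hx
      rw [hh.deriv_comp (hφ i) hx, abs_mul]
      calc r ^ N * (|deriv h (φ i x)| * |deriv (φ i) x|) ≤ r ^ N * (|deriv h (φ i x)| * r) := by
            gcongr; exact (hsr i x hx).2
        _ = r ^ (N + 1) * |deriv h (φ i x)| := by ring
        _ ≤ t := h1 _ ((hφ i).mapsTo hx)
    · intro x hx
      rw [hh.deriv_comp (hφ i) hx, abs_mul]
      calc Real.exp (-K') * s * t = (Real.exp (-K') * t) * s := by ring
        _ ≤ (Real.exp (-K') * |deriv h z|) * |deriv (φ i) x| := by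
          gcongr; exact (hsr i x hx).1
        _ ≤ |deriv h (φ i x)| * |deriv (φ i) x| := by
          gcongr; exact hh.exp_mul_le hK' hz ((hφ i).mapsTo hx)

theorem exists_multiScale (hanal : ∀ i, AnalyticOnNhd ℝ (φ i) unitI)
    (hmaps : ∀ i, MapsTo (φ i) unitI unitI)
    (hderiv : ∀ i, ∀ x ∈ unitI, 0 < |deriv (φ i) x| ∧ |deriv (φ i) x| < 1)
    {p : Λ → ℝ} (hp : ∀ i, 0 ≤ p i) (hp1 : ∑ i, p i = 1) {μ : Measure ℝ} (hμI : μ unitIᶜ = 0)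
    (hμ : μ = ∑ i : Λ, ENNReal.ofReal (p i) • μ.map (φ i)) : ∃ C : ℕ, MultiScale μ C := by
  obtain ⟨s, hs, r, hr1, hsr⟩ := exists_deriv_bounds hanal hderiv
  obtain ⟨K, hK, hφ⟩ := exists_distort hanal hmaps fun i x hx => abs_pos.1 (hderiv i x hx).1
  obtain ⟨i₀⟩ := ‹Nonempty Λ›
  have hs1 : s ≤ 1 := (hsr i₀ 0 zero_mem_unitI).1.trans (hderiv i₀ 0 zero_mem_unitI).2.le
  have hr0 : 0 ≤ r := (abs_nonneg _).trans (hsr i₀ 0 zero_mem_unitI).2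
  set K' := K / (1 - r) with hK'
  have hr' : 0 < 1 - r := by linarith
  have hK0 : 0 ≤ K' := by positivity
  have hKr : K' * r + K ≤ K' := by
    have : K' * (1 - r) = K := by rw [hK']; field_simp
    linarith
  set c := Real.exp (-K') * s with hc
  have hc0 : 0 < c := by positivity
  have hc1 : c ≤ 1 := mul_le_one₀ (Real.exp_le_one_iff.2 (by linarith)) hs.le hs1
  refine ⟨⌈c⁻¹⌉₊, fun i => ?_⟩
  have ht : (0 : ℝ) < (2 ^ i)⁻¹ := by positivity
  have ht1 : ((2 : ℝ) ^ i)⁻¹ ≤ 1 := inv_le_one_of_one_le₀ (one_le_pow₀ one_le_two)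
  obtain ⟨N, hN⟩ := exists_pow_lt_of_lt_one ht hr1
  have : Nonempty Λ := ⟨i₀⟩
  obtain ⟨κ, _, q, h, hq, hq1, hh, he⟩ := isMix_map_of_le hφ hs hsr hK0 hKr hp hp1 hμI hμ N
    (distort_id hK0) (fun x _ => by simpa using hN.le) fun x _ => by
      simpa using mul_le_one₀ hc1 ht.le ht1
  rw [Measure.map_id] at he
  let e := Fintype.equivFin κ
  refine ⟨Fintype.card κ, q ∘ e.symm, h ∘ e.symm, fun u => hq _, ?_, fun u => (hh _).1.mapsTo,
    fun u => ?_, ?_⟩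
  · rw [← hq1]
    exact e.symm.sum_comp q
  · have hCc : c⁻¹ ≤ (⌈c⁻¹⌉₊ : ℝ) := Nat.le_ceil _
    have hC1 : 1 ≤ c⁻¹ := (one_le_inv₀ hc0).2 hc1
    have hdu := (hh (e.symm u)).1.differentiableAt
    have hde : ∀ x ∈ unitI, |deriv (fun x => 2 ^ i * h (e.symm u) x) x| =
        2 ^ i * |deriv (h (e.symm u)) x| := fun x hx => by
      rw [deriv_const_mul _ (hdu x hx), abs_mul, abs_of_pos (by positivity)]
    refine BiLip.mono (bilip_of_deriv (fun x hx => (hdu x hx).const_mul _) (inv_pos.2 hc0) ?_ ?_)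
      hCc
    · intro x hx
      rw [hde x hx, inv_inv]
      have := ((hh (e.symm u)).2 x hx).1
      rwa [← div_eq_mul_inv, div_le_iff₀' (by positivity)] at this
    · intro x hx
      rw [hde x hx]
      have := ((hh (e.symm u)).2 x hx).2
      rw [← one_div, le_div_iff₀' (by positivity)] at this
      exact this.trans hC1
  · conv_lhs => rw [he]
    exact (e.symm.sum_comp fun u => ENNReal.ofReal (q u) • μ.map (h u)).symm

/-- The support of a self-conformal measure is infinite. -/
theorem infinite_setOf_measure_ball_pos (hanal : ∀ i, AnalyticOnNhd ℝ (φ i) unitI)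
    (hmaps : ∀ i, MapsTo (φ i) unitI unitI)
    (hderiv : ∀ i, ∀ x ∈ unitI, 0 < |deriv (φ i) x| ∧ |deriv (φ i) x| < 1)
    (hnofix : ¬ ∃ x ∈ unitI, ∀ i, φ i x = x)
    {p : Λ → ℝ} (hp : ∀ i, 0 < p i) {μ : Measure ℝ} [IsProbabilityMeasure μ]
    (hμI : μ unitIᶜ = 0)
    (hμ : μ = ∑ i : Λ, ENNReal.ofReal (p i) • μ.map (φ i)) :
    {x | x ∈ unitI ∧ ∀ r > 0, μ (closedBall x r) ≠ 0}.Infinite := by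
  set S := {x | x ∈ unitI ∧ ∀ r > 0, μ (closedBall x r) ≠ 0} with hS
  have hd : ∀ i, ∀ x ∈ unitI, DifferentiableAt ℝ (φ i) x := fun i x hx =>
    (hanal i x hx).differentiableAt
  have hcont : ∀ i, ContinuousOn (φ i) unitI := fun i => (hanal i).continuousOn
  have hlip : ∀ i, ∀ x ∈ unitI, ∀ y ∈ unitI, x ≠ y →
      0 < |φ i x - φ i y| ∧ |φ i x - φ i y| < |x - y| := by
    intro i x hx y hy hxy
    obtain ⟨c, hc, e⟩ := exists_sub_eq_deriv_mul (hd i) hx hy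
    have h0 : 0 < |x - y| := abs_pos.2 (sub_ne_zero.2 hxy)
    have h1 := hderiv i c hc
    rw [e, abs_mul]
    exact ⟨mul_pos h1.1 h0, mul_lt_of_lt_one_left h0 h1.2⟩
  have hne : S.Nonempty := by
    by_contra hemp
    rw [not_nonempty_iff_eq_empty] at hemp
    have h1 : ∀ x ∈ unitI, ∃ r > 0, μ (closedBall x r) = 0 := by
      intro x hx
      by_contra! h
      exact (hemp ▸ (⟨hx, h⟩ : x ∈ S) : x ∈ (∅ : Set ℝ))
    have h2 : μ unitI = 0 := by
      refine isCompact_unitI.measure_zero_of_nhdsWithin fun x hx => ?_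
      obtain ⟨r, hr, h⟩ := h1 x hx
      exact ⟨_, mem_nhdsWithin_of_mem_nhds (closedBall_mem_nhds x hr), h⟩
    have h3 : μ univ = 0 := by
      rw [← union_compl_self unitI]
      exact measure_union_null h2 hμI
    simp at h3
  have hmS : ∀ i, MapsTo (φ i) S S := by
    intro i x hx
    refine ⟨hmaps i hx.1, fun r hr h0 => hx.2 r hr ?_⟩
    have h1 : μ.map (φ i) (closedBall (φ i x) r) = 0 := by
      have h2 := congrArg (fun θ : Measure ℝ => θ (closedBall (φ i x) r)) hμ
      simp only [h0, Measure.finsetSum_apply, Measure.smul_apply, smul_eq_mul] at h2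
      have h3 := (Finset.sum_eq_zero_iff.1 h2.symm) i (Finset.mem_univ i)
      rcases mul_eq_zero.1 h3 with h4 | h4
      · exact absurd (ENNReal.ofReal_eq_zero.1 h4) (not_le.2 (hp i))
      · exact h4
    rw [Measure.map_apply_of_aemeasurable (aemeasurable_of_continuousOn hμI (hcont i))
      measurableSet_closedBall] at h1
    refine measure_mono_null ?_ (measure_union_null h1 hμI)
    intro y hy
    by_cases hyI : y ∈ unitI
    · left
      rcases eq_or_ne y x with rfl | hyx
      · simp [hr.le]
      · have := (hlip i y hyI x hx.1 hyx).2
        rw [mem_closedBall, Real.dist_eq] at hy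
        rw [mem_preimage, mem_closedBall, Real.dist_eq]
        linarith
    · exact Or.inr hyI
  intro hfin
  have hinj : ∀ i, InjOn (φ i) S := by
    intro i x hx y hy hxy
    by_contra hne
    have := (hlip i x hx.1 y hy.1 hne).1
    rw [hxy, sub_self, abs_zero] at this
    exact lt_irrefl _ this
  have hsurj : ∀ i, SurjOn (φ i) S S := fun i =>
    ((hfin.injOn_iff_bijOn_of_mapsTo (hmS i)).1 (hinj i)).surjOn
  obtain ⟨z, hz, hmax⟩ := exists_max_image (S ×ˢ S) (fun z : ℝ × ℝ => |z.1 - z.2|)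
    (hfin.prod hfin) (hne.prod hne)
  obtain ⟨i₀⟩ := ‹Nonempty Λ›
  obtain ⟨x, hx, hx1⟩ := hsurj i₀ hz.1
  obtain ⟨y, hy, hy1⟩ := hsurj i₀ hz.2
  have hz0 : |z.1 - z.2| = 0 := by
    by_contra h0
    have hxy : x ≠ y := by
      rintro rfl
      rw [← hx1, ← hy1, sub_self, abs_zero] at h0
      exact h0 rfl
    have h1 := (hlip i₀ x hx.1 y hy.1 hxy).2
    rw [hx1, hy1] at h1
    exact absurd (hmax (x, y) ⟨hx, hy⟩) (not_le.2 h1)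
  refine hnofix ⟨z.1, hz.1.1, fun i => ?_⟩
  have h1 := hmax (φ i z.1, z.1) ⟨hmS i hz.1, hz.1⟩
  rw [hz0] at h1
  exact sub_eq_zero.1 (abs_eq_zero.1 (le_antisymm h1 (abs_nonneg _)))

end IFS

/-- An infinite support contains any number of separated points. -/
lemma exists_separated {μ : Measure ℝ} [IsFiniteMeasure μ]
    (h : {x | x ∈ unitI ∧ ∀ r > 0, μ (closedBall x r) ≠ 0}.Infinite) (k : ℕ) :
    ∃ a : Fin k → ℝ, ∃ κ > 0, ∃ c > 0, (∀ l, a l ∈ unitI) ∧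
      (∀ l l', l ≠ l' → 5 * κ ≤ |a l - a l'|) ∧ ∀ l, c ≤ μ.real (closedBall (a l) κ) := by
  obtain ⟨t, ht, hcard⟩ := h.exists_subset_card_eq k
  let e := t.equivFinOfCardEq hcard
  have hinj : ∀ l l', l ≠ l' → 0 < |(e.symm l : ℝ) - e.symm l'| := fun l l' hl =>
    abs_pos.2 (sub_ne_zero.2 fun h => hl (e.symm.injective (Subtype.ext h)))
  have h1 : ∀ᶠ κ in 𝓝[>] (0 : ℝ), ∀ l l', l ≠ l' → 5 * κ ≤ |(e.symm l : ℝ) - e.symm l'| := by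
    refine eventually_all.2 fun l => eventually_all.2 fun l' => ?_
    by_cases hl : l = l'
    · simp [hl]
    · filter_upwards [mem_nhdsWithin_of_mem_nhds
        (Iio_mem_nhds (div_pos (hinj l l' hl) (by norm_num : (0 : ℝ) < 5)))] with κ hκ _
      have := (lt_div_iff₀' (by norm_num : (0 : ℝ) < 5)).1 hκ
      exact this.le
  obtain ⟨κ, hκ, hκ0⟩ := (h1.and self_mem_nhdsWithin).exists
  have h2 : ∀ᶠ c in 𝓝[>] (0 : ℝ), ∀ l, c ≤ μ.real (closedBall (e.symm l : ℝ) κ) := by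
    refine eventually_all.2 fun l => mem_nhdsWithin_of_mem_nhds (Iic_mem_nhds ?_)
    exact ENNReal.toReal_pos ((ht (e.symm l).2).2 κ hκ0) (measure_ne_top _ _)
  obtain ⟨c, hc, hc0⟩ := (h2.and self_mem_nhdsWithin).exists
  exact ⟨fun l => e.symm l, κ, hκ0, c, hc0, fun l => (ht (e.symm l).2).1, hκ, hc⟩

namespace FinMeas

open Classical in
/-- The entropy of dyadic partitions in terms of the local dimension. -/
theorem le_ent_law_of_exactDimWith {μ : Measure ℝ} [IsProbabilityMeasure μ] (hμI : μ unitIᶜ = 0)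
    {d : ℝ} (hd1 : d < 1) (hdim : ExactDimWith μ d) {τ : ℝ} (hτ : 0 < τ) :
    ∃ M₀ : ℕ, ∀ M, M₀ ≤ M →
      (d - τ) * M * Real.log 2 ≤ ent (law μ fun x => ⌊(2 : ℝ) ^ M * x⌋) := by
  have hl : 0 < Real.log 2 := Real.log_pos one_lt_two
  have hdisc : ∀ M : ℕ, Disc μ fun x => ⌊(2 : ℝ) ^ M * x⌋ := fun M =>
    disc_floor hμI (continuousOn_id.const_mul_unitI (2 ^ M))
  set G : ℕ → Set ℝ := fun M₁ => {x | ∀ M : ℕ, M₁ ≤ M →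
    Real.log (μ (closedBall x ((2 : ℝ) ^ M)⁻¹)).toReal ≤ -((d - τ / 2) * M * Real.log 2)} with hG
  have hGmono : Monotone G := fun a b hab x hx M hM => hx M (hab.trans hM)
  have hGfull : ∀ᵐ x ∂μ, x ∈ ⋃ M₁, G M₁ := by
    filter_upwards [hdim] with x hx
    have h1 : Tendsto (fun M : ℕ => ((2 : ℝ) ^ M)⁻¹) atTop (𝓝[>] 0) := by
      refine tendsto_nhdsWithin_iff.2 ⟨?_, Eventually.of_forall fun M => ?_⟩
      · exact (tendsto_pow_atTop_atTop_of_one_lt one_lt_two).inv_tendsto_atTop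
      · exact mem_Ioi.2 (inv_pos.2 (pow_pos two_pos M))
    have h2 := (hx.comp h1).eventually (Ioi_mem_nhds (show d - τ / 2 < d by linarith))
    obtain ⟨M₁, h3⟩ := eventually_atTop.1 (h2.and (eventually_gt_atTop 0))
    refine mem_iUnion.2 ⟨M₁, fun M hM => ?_⟩
    obtain ⟨h4, h5⟩ := h3 M hM
    have h5' : (0 : ℝ) < M := by exact_mod_cast h5
    simp only [Function.comp_apply, Real.log_inv, Real.log_pow] at h4
    rw [div_neg, lt_neg, div_lt_iff₀ (by positivity)] at h4
    linarith
  have hlim : Tendsto (fun M₁ => μ.real (G M₁)) atTop (𝓝 1) := by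
    have h1 := tendsto_measure_iUnion_atTop (μ := μ) hGmono
    have h2 : μ (⋃ n, G n) = 1 := by
      rw [← measure_univ (μ := μ)]
      exact measure_congr (eventuallyEq_univ.2 hGfull)
    rw [h2] at h1
    exact (ENNReal.tendsto_toReal ENNReal.one_ne_top).comp h1
  obtain ⟨M₀, hM₀⟩ := (hlim.eventually (Ioi_mem_nhds
    (show 1 - min (τ / 2) 1 < (1 : ℝ) by linarith [lt_min (half_pos hτ) one_pos]))).exists
  refine ⟨M₀, fun M hM => ?_⟩
  have hP := isProb_law (hdisc M)
  rcases le_or_gt (d - τ / 2) 0 with hneg | hpos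
  · refine le_trans ?_ hP.ent_nonneg
    have : (d - τ) * (M * Real.log 2) ≤ 0 :=
      mul_nonpos_of_nonpos_of_nonneg (by linarith) (by positivity)
    linarith
  set ζ := law μ fun x => ⌊(2 : ℝ) ^ M * x⌋ with hζ
  obtain ⟨s, hs⟩ := (hdisc M).2
  set p : ℤ → Prop := fun b => ∃ x ∈ G M₀, ⌊(2 : ℝ) ^ M * x⌋ = b with hp
  have h1 : μ.real (G M₀) ≤ ∑ b ∈ s with p b, ζ.coeff b := by
    have := measureReal_comp (hdisc M) hs p
    simp only [hζ, coeff_law (hdisc M)]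
    rw [← this]
    exact measureReal_mono fun x hx => ⟨x, hx, rfl⟩
  have h2 : ∀ b, p b → ζ.coeff b * ((d - τ / 2) * M * Real.log 2) ≤
      Real.negMulLog (ζ.coeff b) := by
    rintro b ⟨x, hx, hxb⟩
    have h0 := hP.1 b
    rcases eq_or_lt_of_le h0 with h0 | h0
    · rw [← h0]; simp
    rw [Real.negMulLog, neg_mul, ← mul_neg]
    refine mul_le_mul_of_nonneg_left ?_ h0.le
    have h3 : ζ.coeff b ≤ (μ (closedBall x ((2 : ℝ) ^ M)⁻¹)).toReal := by
      rw [hζ, coeff_law (hdisc M)]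
      refine measureReal_mono fun y hy => ?_
      have hy' : ⌊(2 : ℝ) ^ M * y⌋ = b := hy
      have h4 := Int.abs_sub_lt_one_of_floor_eq_floor (hy'.trans hxb.symm)
      rw [← mul_sub, abs_mul, abs_of_pos (by positivity)] at h4
      rw [mem_closedBall, Real.dist_eq, ← one_div, le_div_iff₀' (by positivity)]
      exact h4.le
    have h5 := (Real.log_le_log h0 h3).trans (hx M hM)
    linarith
  have h3 : ∑ b ∈ s with p b, ζ.coeff b * ((d - τ / 2) * M * Real.log 2) ≤ ent ζ := by
    rw [ent_eq_sum ζ ((hdisc M).support_subset hs)]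
    calc _ ≤ ∑ b ∈ s with p b, Real.negMulLog (ζ.coeff b) :=
          Finset.sum_le_sum fun b hb => h2 b (Finset.mem_filter.1 hb).2
      _ ≤ _ := Finset.sum_le_sum_of_subset_of_nonneg (Finset.filter_subset _ _) fun b _ _ => by
          refine Real.negMulLog_nonneg (hP.1 b) ?_
          rw [hζ, coeff_law (hdisc M)]
          exact measureReal_le_one
  rw [← Finset.sum_mul] at h3
  refine le_trans ?_ h3
  have h4 : 1 - min (τ / 2) 1 ≤ ∑ b ∈ s with p b, ζ.coeff b := le_trans (le_of_lt hM₀) h1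
  have h5 := min_le_left (τ / 2) 1
  have h6 : d - τ ≤ (∑ b ∈ s with p b, ζ.coeff b) * (d - τ / 2) := by
    have h7 : (1 - min (τ / 2) 1) * (d - τ / 2) ≤ (∑ b ∈ s with p b, ζ.coeff b) * (d - τ / 2) := by
      gcongr
    have h8 : min (τ / 2) 1 * (d - τ / 2) ≤ τ / 2 * 1 :=
      mul_le_mul h5 (by linarith) hpos.le (by linarith)
    linarith
  calc (d - τ) * M * Real.log 2 = (d - τ) * (M * Real.log 2) := by ring
    _ ≤ ((∑ b ∈ s with p b, ζ.coeff b) * (d - τ / 2)) * (M * Real.log 2) := by gcongr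
    _ = _ := by ring

end FinMeas

namespace FinMeas

section bind

variable {A B C : Type*}

/-- The mixture of the measures `F x`, weighted by a finitely supported measure. -/
def bind (F : A → FinMeas B) : FinMeas A →ₗ[ℝ] FinMeas B where
  toFun ζ := Finsupp.linearCombination ℝ F ζ.coeff
  map_add' ζ ξ := by simp
  map_smul' c ζ := by simp

lemma bind_eq_sum (F : A → FinMeas B) (ζ : FinMeas A) :
    bind F ζ = ∑ x ∈ ζ.coeff.support, ζ.coeff x • F x :=
  Finsupp.linearCombination_apply ℝ ζ.coeff

lemma IsProb.bind {F : A → FinMeas B} {ζ : FinMeas A} (h : IsProb ζ)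
    (hF : ∀ x ∈ ζ.coeff.support, IsProb (F x)) : IsProb (bind F ζ) := by
  rw [bind_eq_sum]
  exact IsProb.mix (fun x _ => h.1 x) h.sum_coeff hF

lemma push_bind (f : B → C) (F : A → FinMeas B) (ζ : FinMeas A) :
    push f (bind F ζ) = bind (fun x => push f (F x)) ζ := by
  simp [bind_eq_sum]

lemma bind_congr {F G : A → FinMeas B} {ζ : FinMeas A} (h : ∀ x ∈ ζ.coeff.support, F x = G x) :
    bind F ζ = bind G ζ := by
  rw [bind_eq_sum, bind_eq_sum]
  exact Finset.sum_congr rfl fun x hx => by rw [h x hx]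

lemma bind_sum_smul {ι : Type*} (s : Finset ι) (c : ι → ℝ) (F : ι → A → FinMeas B)
    (ζ : FinMeas A) : bind (fun x => ∑ i ∈ s, c i • F i x) ζ = ∑ i ∈ s, c i • bind (F i) ζ := by
  simp only [bind_eq_sum, Finset.smul_sum]
  rw [Finset.sum_comm]
  exact Finset.sum_congr rfl fun i _ => Finset.sum_congr rfl fun x _ => smul_comm _ _ _

lemma bind_dirac_comp (f : A → B) (ζ : FinMeas A) : bind (fun x => dirac (f x)) ζ = push f ζ := by
  conv_rhs => rw [eq_sum_dirac ζ subset_rfl]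
  simp [bind_eq_sum]

lemma bind_push (G : B → FinMeas C) (f : A → B) (ζ : FinMeas A) :
    bind G (push f ζ) = bind (G ∘ f) ζ := by
  rw [← bind_dirac_comp, bind_eq_sum (fun x => dirac (f x)), bind_eq_sum (G ∘ f), map_sum]
  simp [bind, dirac]

lemma exists_of_mem_support_bind {F : A → FinMeas B} {ζ : FinMeas A} {b : B}
    (hb : b ∈ (bind F ζ).coeff.support) :
    ∃ x ∈ ζ.coeff.support, b ∈ (F x).coeff.support := by
  by_contra! hcon
  refine Finsupp.mem_support_iff.1 hb ?_
  rw [bind_eq_sum, AddMonoidAlgebra.coeff_sum, Finsupp.coe_finsetSum, Finset.sum_apply]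
  refine Finset.sum_eq_zero fun x hx => ?_
  simp [Finsupp.notMem_support_iff.1 (hcon x hx)]

lemma exists_of_mem_support_push {f : A → B} {ζ : FinMeas A} {b : B}
    (hb : b ∈ (push f ζ).coeff.support) : ∃ x ∈ ζ.coeff.support, f x = b := by
  rw [← bind_dirac_comp] at hb
  obtain ⟨x, hx, hxb⟩ := exists_of_mem_support_bind hb
  have : b = f x := by simpa [dirac] using hxb
  exact ⟨x, hx, this.symm⟩

/-- Disintegration of a finitely supported probability measure along the fibers of a map. -/
lemma IsProb.exists_fiber {ζ : FinMeas A} (h : IsProb ζ) (f : A → B) :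
    ∃ w : B → FinMeas A, ζ = FinMeas.bind w (FinMeas.push f ζ) ∧
      ∀ b ∈ (FinMeas.push f ζ).coeff.support, IsProb (w b) ∧
        ∀ x ∈ (w b).coeff.support, x ∈ ζ.coeff.support ∧ f x = b := by
  classical
  have hcoeff : ∀ b, (FinMeas.push f ζ).coeff b = ∑ x ∈ ζ.coeff.support with f x = b, ζ.coeff x :=
    coeff_push f ζ subset_rfl
  set v : B → FinMeas A := fun b => ∑ x ∈ ζ.coeff.support with f x = b, ζ.coeff x • dirac x with hv
  have hvn : ∀ b, Nonneg (v b) := fun b =>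
    Nonneg.sum fun x _ => (nonneg_dirac x).smul (h.1 x)
  have hvm : ∀ b, mass (v b) = (FinMeas.push f ζ).coeff b := by
    intro b
    rw [hcoeff, hv, mass_sum]
    exact Finset.sum_congr rfl fun x _ => by rw [mass_smul, (isProb_dirac x).2, mul_one]
  have hvs : ∀ b, ∀ x ∈ (v b).coeff.support, x ∈ ζ.coeff.support ∧ f x = b := by
    intro b x hx
    by_contra hcon
    rw [Finsupp.mem_support_iff] at hx
    refine hx ?_
    simp only [hv, AddMonoidAlgebra.coeff_sum, Finsupp.coe_finsetSum, Finset.sum_apply]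
    refine Finset.sum_eq_zero fun y hy => ?_
    rw [Finset.mem_filter] at hy
    have hne : y ≠ x := fun hyx => hcon (hyx ▸ hy)
    simp [dirac, hne]
  refine ⟨fun b => ((FinMeas.push f ζ).coeff b)⁻¹ • v b, ?_, ?_⟩
  · rw [bind_eq_sum]
    have : ∀ b ∈ (FinMeas.push f ζ).coeff.support,
        (FinMeas.push f ζ).coeff b • ((FinMeas.push f ζ).coeff b)⁻¹ • v b = v b := fun b hb => by
      rw [smul_smul, mul_inv_cancel₀ (Finsupp.mem_support_iff.1 hb), one_smul]
    rw [Finset.sum_congr rfl this]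
    conv_lhs => rw [eq_sum_dirac ζ subset_rfl]
    refine (Finset.sum_fiberwise_of_maps_to (fun x hx => ?_) _).symm
    rw [Finsupp.mem_support_iff]
    have := h.1.coeff_le_push f x
    have h0 := (h.1 x).lt_of_ne' (Finsupp.mem_support_iff.1 hx)
    linarith
  · intro b hb
    have hb' := Finsupp.mem_support_iff.1 hb
    refine ⟨⟨(hvn b).smul (inv_nonneg.2 (h.1.push f b)), ?_⟩, fun x hx => hvs b x ?_⟩
    · rw [mass_smul, hvm, inv_mul_cancel₀ hb']
    · rw [Finsupp.mem_support_iff] at hx ⊢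
      intro h0
      exact hx (by simp [h0])

lemma negMulLog_sum_le {ι : Type*} (s : Finset ι) {a : ι → ℝ} (ha : ∀ i ∈ s, 0 ≤ a i) :
    Real.negMulLog (∑ i ∈ s, a i) ≤ ∑ i ∈ s, Real.negMulLog (a i) := by
  rw [Real.negMulLog, neg_mul, Finset.sum_mul, ← Finset.sum_neg_distrib]
  refine Finset.sum_le_sum fun i hi => ?_
  rw [Real.negMulLog, neg_mul]
  rcases (ha i hi).eq_or_lt with h0 | h0
  · simp [← h0]
  · have := Real.log_le_log h0 (Finset.single_le_sum ha hi)
    nlinarith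

/-- A mixture has at most the average entropy plus the entropy of the weights. -/
lemma ent_bind_le {F : A → FinMeas B} {ζ : FinMeas A} (h : IsProb ζ)
    (hF : ∀ x ∈ ζ.coeff.support, IsProb (F x)) :
    ent (bind F ζ) ≤ ent ζ + ∑ x ∈ ζ.coeff.support, ζ.coeff x * ent (F x) := by
  classical
  set S := ζ.coeff.support with hS
  set s := (bind F ζ).coeff.support ∪ S.biUnion fun x => (F x).coeff.support with hs
  have hsub : ∀ x ∈ S, (F x).coeff.support ⊆ s := fun x hx =>
    (Finset.subset_biUnion_of_mem (fun x => (F x).coeff.support) hx).trans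
      Finset.subset_union_right
  rw [ent_eq_sum _ (Finset.subset_union_left : _ ⊆ s), ent_eq_sum ζ subset_rfl]
  have hc : ∀ y, (bind F ζ).coeff y = ∑ x ∈ S, ζ.coeff x * (F x).coeff y := fun y => by
    simp [bind_eq_sum, hS]
  calc ∑ y ∈ s, Real.negMulLog ((bind F ζ).coeff y)
      ≤ ∑ y ∈ s, ∑ x ∈ S, Real.negMulLog (ζ.coeff x * (F x).coeff y) := by
        refine Finset.sum_le_sum fun y _ => ?_
        rw [hc]
        exact negMulLog_sum_le _ fun x hx => mul_nonneg (h.1 x) ((hF x hx).1 y)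
    _ = ∑ x ∈ S, ∑ y ∈ s, ((F x).coeff y * Real.negMulLog (ζ.coeff x) +
          ζ.coeff x * Real.negMulLog ((F x).coeff y)) := by
        rw [Finset.sum_comm]
        exact Finset.sum_congr rfl fun x _ => Finset.sum_congr rfl fun y _ =>
          Real.negMulLog_mul _ _
    _ = _ := by
        rw [← Finset.sum_add_distrib]
        refine Finset.sum_congr rfl fun x hx => ?_
        rw [Finset.sum_add_distrib, ← Finset.sum_mul, ← Finset.mul_sum,
          ← mass_eq_sum _ (hsub x hx), (hF x hx).2, one_mul, ← ent_eq_sum _ (hsub x hx)]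

lemma le_condEnt_bind (f : B → C) {F : A → FinMeas B} {ζ : FinMeas A} (h : IsProb ζ)
    (hF : ∀ x ∈ ζ.coeff.support, IsProb (F x)) :
    ∑ x ∈ ζ.coeff.support, ζ.coeff x * condEnt f (F x) ≤ condEnt f (bind F ζ) := by
  rw [bind_eq_sum]
  exact sum_condEnt_le f _ (fun x _ => h.1 x) fun x hx => (hF x hx).1

lemma bind_bind (G : B → FinMeas C) (F : A → FinMeas B) (ζ : FinMeas A) :
    bind G (bind F ζ) = bind (fun x => bind G (F x)) ζ := by
  rw [bind_eq_sum F, bind_eq_sum (fun x => bind G (F x)), map_sum]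
  simp

end bind

section cells

variable {k : ℕ}

/-- The index of the level-`m` dyadic cell of a coefficient vector. -/
def cell (m : ℕ) (q : EuclideanSpace ℝ (Fin (k + 1))) : Fin (k + 1) → ℤ :=
  fun j => ⌊(2 : ℝ) ^ m * q j⌋

lemma card_le_of_forall_abs_sub_le {s : Finset (Fin (k + 1) → ℤ)} {R : ℕ}
    (h : ∀ a ∈ s, ∀ b ∈ s, ∀ j, |a j - b j| ≤ R) : s.card ≤ (2 * R + 1) ^ (k + 1) := by
  rcases s.eq_empty_or_nonempty with rfl | ⟨a, ha⟩
  · simp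
  · have hsub : s ⊆ Fintype.piFinset fun j => Finset.Icc (a j - R) (a j + R) := by
      intro b hb
      rw [Fintype.mem_piFinset]
      intro j
      have := abs_le.1 (h a ha b hb j)
      rw [Finset.mem_Icc]
      omega
    refine (Finset.card_le_card hsub).trans ?_
    rw [Fintype.card_piFinset]
    have : ∀ j, (Finset.Icc (a j - R) (a j + R)).card = 2 * R + 1 := fun j => by
      rw [Int.card_Icc]
      omega
    simp [this]

lemma IsProb.ent_push_cell_le {D : Type*} {w : FinMeas (EuclideanSpace ℝ (Fin (k + 1)))}
    (h : IsProb w)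
    (f : EuclideanSpace ℝ (Fin (k + 1)) → D) {m R : ℕ}
    (hf : ∀ q ∈ w.coeff.support, ∀ q' ∈ w.coeff.support, f q = f q' →
      ∀ j, (2 : ℝ) ^ m * |q j - q' j| ≤ R) :
    ent (FinMeas.push (cell m) w) ≤
      ent (FinMeas.push f w) + (k + 1) * Real.log (2 * (R + 1 : ℕ) + 1) := by
  have hlog : ((k : ℝ) + 1) * Real.log (2 * (R + 1 : ℕ) + 1) =
      Real.log (((2 * (R + 1) + 1) ^ (k + 1) : ℕ) : ℝ) := by
    push_cast
    rw [Real.log_pow]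
    push_cast
    rfl
  rw [hlog]
  refine h.ent_push_le_add_log f (cell m) (by positivity) fun b s hs => ?_
  refine Nat.cast_le.2 (card_le_of_forall_abs_sub_le fun c hc c' hc' j => ?_)
  obtain ⟨q, hq, rfl, rfl⟩ := hs c hc
  obtain ⟨q', hq', hqq, rfl⟩ := hs c' hc'
  refine abs_floor_sub_floor_le ?_
  rw [← mul_sub, abs_mul, abs_of_pos (by positivity : (0 : ℝ) < 2 ^ m)]
  exact hf q hq q' hq' hqq.symm j

end cells

end FinMeas

section polyEval

variable {k : ℕ}

lemma polyEval_sub (q q' : EuclideanSpace ℝ (Fin (k + 1))) (x : ℝ) :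
    polyEval k (q - q') x = polyEval k q x - polyEval k q' x := by
  simp [polyEval, sub_mul, Finset.sum_sub_distrib]

lemma polyEval_smul (c : ℝ) (q : EuclideanSpace ℝ (Fin (k + 1))) (x : ℝ) :
    polyEval k (c • q) x = c * polyEval k q x := by
  simp [polyEval, Finset.mul_sum, mul_assoc]

lemma continuous_uncurry_polyEval :
    Continuous fun z : EuclideanSpace ℝ (Fin (k + 1)) × ℝ => polyEval k z.1 z.2 := by
  unfold polyEval
  fun_prop

lemma differentiable_polyEval (q : EuclideanSpace ℝ (Fin (k + 1))) :
    Differentiable ℝ (polyEval k q) := by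
  unfold polyEval
  fun_prop

lemma abs_polyEval_le {q : EuclideanSpace ℝ (Fin (k + 1))} {R : ℝ} (h : ∀ j, |q j| ≤ R) {x : ℝ}
    (hx : x ∈ unitI) : |polyEval k q x| ≤ (k + 1) * R := by
  calc |polyEval k q x| ≤ ∑ j : Fin (k + 1), |q j * x ^ (j : ℕ)| := Finset.abs_sum_le_sum_abs _ _
    _ ≤ ∑ _j : Fin (k + 1), R := by
        refine Finset.sum_le_sum fun j _ => ?_
        rw [abs_mul, abs_of_nonneg (pow_nonneg hx.1 _)]
        exact (mul_le_of_le_one_right (abs_nonneg _) (pow_le_one₀ hx.1 hx.2)).trans (h j)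
    _ = _ := by simp

lemma abs_pow_sub_pow_le_of_mem_unitI {x y : ℝ} (hx : x ∈ unitI) (hy : y ∈ unitI) (j : ℕ) :
    |x ^ j - y ^ j| ≤ j * |x - y| := by
  refine (abs_pow_sub_pow_le x y j).trans ?_
  have : max |x| |y| ^ (j - 1) ≤ 1 := by
    refine pow_le_one₀ (le_max_of_le_left (abs_nonneg _)) (max_le ?_ ?_)
    · rw [abs_of_nonneg hx.1]; exact hx.2
    · rw [abs_of_nonneg hy.1]; exact hy.2
  calc |x - y| * j * max |x| |y| ^ (j - 1) ≤ |x - y| * j * 1 := by gcongr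
    _ = _ := by ring

lemma abs_polyEval_sub_le {q : EuclideanSpace ℝ (Fin (k + 1))} {R : ℝ} (h : ∀ j, |q j| ≤ R)
    {x y : ℝ} (hx : x ∈ unitI) (hy : y ∈ unitI) :
    |polyEval k q x - polyEval k q y| ≤ (k + 1) * k * R * |x - y| := by
  have hR : 0 ≤ R := (abs_nonneg _).trans (h 0)
  unfold polyEval
  rw [← Finset.sum_sub_distrib]
  calc |∑ j : Fin (k + 1), (q j * x ^ (j : ℕ) - q j * y ^ (j : ℕ))|
      ≤ ∑ j : Fin (k + 1), |q j * x ^ (j : ℕ) - q j * y ^ (j : ℕ)| :=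
        Finset.abs_sum_le_sum_abs _ _
    _ ≤ ∑ _j : Fin (k + 1), R * (k * |x - y|) := by
        refine Finset.sum_le_sum fun j _ => ?_
        rw [← mul_sub, abs_mul]
        have h1 := abs_pow_sub_pow_le_of_mem_unitI hx hy j
        have h2 : ((j : ℕ) : ℝ) ≤ k := by exact_mod_cast Nat.lt_succ_iff.1 j.2
        refine mul_le_mul (h j) (h1.trans (by gcongr)) (abs_nonneg _) hR
    _ = _ := by simp; ring

lemma abs_apply_le_norm (q : EuclideanSpace ℝ (Fin (k + 1))) (j : Fin (k + 1)) : |q j| ≤ ‖q‖ := by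
  simpa using PiLp.norm_apply_le q j

lemma bilip_polyEval {ε : ℝ} (hε : 0 < ε) {q : EuclideanSpace ℝ (Fin (k + 1))}
    (hq : ‖q‖ ≤ ε⁻¹) (hd : ∀ x ∈ unitI, ε ≤ |deriv (polyEval k q) x|) {E : ℝ}
    (hE : (k + 1) * k * ε⁻¹ ≤ E) (hE' : ε⁻¹ ≤ E) : BiLip E (polyEval k q) := by
  intro x hx y hy
  constructor
  · obtain ⟨c, hc, h⟩ := exists_sub_eq_deriv_mul
      (fun x _ => differentiable_polyEval q x) hx hy
    rw [h, abs_mul, ← mul_assoc]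
    refine le_mul_of_one_le_left (abs_nonneg _) ?_
    calc (1 : ℝ) = ε⁻¹ * ε := by field_simp
      _ ≤ E * |deriv (polyEval k q) c| := by
        have := hd c hc
        gcongr
        exact (inv_nonneg.2 hε.le).trans hE'
  · refine (abs_polyEval_sub_le (fun j => (abs_apply_le_norm q j).trans hq) hx hy).trans ?_
    gcongr

/-- Polynomials of bounded degree are controlled by their values at separated points. -/
lemma exists_interpolation (k : ℕ) {κ : ℝ} (hκ : 0 < κ) :
    ∃ B : ℕ, ∀ y : Fin (k + 1) → ℝ, (∀ l, y l ∈ unitI) →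
      (∀ l l', l ≠ l' → κ ≤ |y l - y l'|) → ∀ q : EuclideanSpace ℝ (Fin (k + 1)),
        ‖q‖ ≤ B * ∑ l, |polyEval k q (y l)| := by
  set K : Set ((Fin (k + 1) → ℝ) × EuclideanSpace ℝ (Fin (k + 1))) :=
    (Set.pi univ (fun _ => unitI) ∩ {y | ∀ l l', l ≠ l' → κ ≤ |y l - y l'|}) ×ˢ
      Metric.sphere 0 1 with hK
  have hKc : IsCompact K := by
    refine IsCompact.prod (IsCompact.inter_right (isCompact_univ_pi fun _ => isCompact_unitI) ?_)
      (isCompact_sphere _ _)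
    simp only [ne_eq, ofPred_forall]
    refine isClosed_iInter fun l => isClosed_iInter fun l' => isClosed_iInter fun _ => ?_
    exact isClosed_le (by fun_prop) (by fun_prop)
  have hf : ContinuousOn (fun z : (Fin (k + 1) → ℝ) × EuclideanSpace ℝ (Fin (k + 1)) =>
      ∑ l, |polyEval k z.2 (z.1 l)|) K := by
    refine Continuous.continuousOn ?_
    unfold polyEval
    fun_prop
  have hpos : ∀ z ∈ K, 0 < ∑ l, |polyEval k z.2 (z.1 l)| := by
    rintro ⟨y, q⟩ ⟨⟨-, hy⟩, hq⟩
    refine (Finset.sum_nonneg fun l _ => abs_nonneg _).lt_of_ne' fun h0 => ?_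
    rw [Finset.sum_eq_zero_iff_of_nonneg fun l _ => abs_nonneg _] at h0
    have hinj : Function.Injective y := by
      intro l l' hll
      by_contra hne
      have : κ ≤ |y l - y l'| := hy l l' hne
      rw [hll, sub_self, abs_zero] at this
      linarith
    have := Matrix.eq_zero_of_forall_index_sum_mul_pow_eq_zero (v := fun j => q j) hinj fun l =>
      abs_eq_zero.1 (h0 l (Finset.mem_univ l))
    have hq0 : q = 0 := by
      ext j
      exact congrFun this j
    simp [hq0] at hq
  obtain ⟨m, hm, hmK⟩ := hKc.exists_forall_le' hf hpos
  obtain ⟨B, hB⟩ := exists_nat_gt m⁻¹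
  refine ⟨B, fun y hy hsep q => ?_⟩
  rcases eq_or_ne q 0 with rfl | hq
  · simp only [norm_zero]
    positivity
  · have hn : 0 < ‖q‖ := norm_pos_iff.2 hq
    have h1 := hmK (y, ‖q‖⁻¹ • q) ⟨⟨fun l _ => hy l, hsep⟩, by
      simp [norm_smul, hn.ne']⟩
    simp only [polyEval_smul, abs_mul, ← Finset.mul_sum, abs_inv, abs_norm] at h1
    rw [le_inv_mul_iff₀ hn] at h1
    have h2 : 0 ≤ ∑ l, |polyEval k q (y l)| := Finset.sum_nonneg fun l _ => abs_nonneg _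
    calc ‖q‖ = m⁻¹ * (‖q‖ * m) := by field_simp
      _ ≤ B * ∑ l, |polyEval k q (y l)| := by gcongr

end polyEval

namespace FinMeas

variable {k : ℕ}

lemma abs_sub_le_one_of_floor_eq {a b : ℝ} (h : ⌊a⌋ = ⌊b⌋) : |a - b| ≤ 1 :=
  (Int.abs_sub_lt_one_of_floor_eq_floor h).le

lemma two_pow_mul_abs_sub_le {m : ℕ} {a b : ℝ}
    (h : ⌊(2 : ℝ) ^ m * a⌋ = ⌊(2 : ℝ) ^ m * b⌋) : (2 : ℝ) ^ m * |a - b| ≤ 1 := by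
  have := abs_sub_le_one_of_floor_eq h
  rwa [← mul_sub, abs_mul, abs_of_pos (by positivity : (0 : ℝ) < 2 ^ m)] at this

/-- The entropy of the coefficients is bounded by the entropies of the values at separated
points. -/
lemma exists_ent_cell_le_sum (k : ℕ) {κ : ℝ} (hκ : 0 < κ) :
    ∃ C₁ : ℝ, ∀ y : Fin (k + 1) → ℝ, (∀ l, y l ∈ unitI) →
      (∀ l l', l ≠ l' → κ ≤ |y l - y l'|) →
      ∀ w : FinMeas (EuclideanSpace ℝ (Fin (k + 1))), IsProb w → ∀ m : ℕ,
        ent (push (cell m) w) ≤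
          ∑ l, ent (push (fun q => ⌊(2 : ℝ) ^ m * polyEval k q (y l)⌋) w) + C₁ := by
  obtain ⟨B, hB⟩ := exists_interpolation k hκ
  refine ⟨(k + 1) * Real.log (2 * (B * (k + 1) + 1 : ℕ) + 1), fun y hy hsep w hw m => ?_⟩
  set f : EuclideanSpace ℝ (Fin (k + 1)) → Fin (k + 1) → ℤ :=
    fun q l => ⌊(2 : ℝ) ^ m * polyEval k q (y l)⌋ with hf
  refine (hw.ent_push_cell_le f (m := m) (R := B * (k + 1)) fun q _ q' _ hqq j => ?_).trans ?_
  · have h1 := hB y hy hsep (q - q')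
    have h2 : ∑ l, (2 : ℝ) ^ m * |polyEval k (q - q') (y l)| ≤ ∑ _l : Fin (k + 1), 1 :=
      Finset.sum_le_sum fun l _ => by
        rw [polyEval_sub]
        exact two_pow_mul_abs_sub_le (congrFun hqq l)
    rw [← Finset.mul_sum] at h2
    calc (2 : ℝ) ^ m * |q j - q' j| ≤ 2 ^ m * (B * ∑ l, |polyEval k (q - q') (y l)|) := by
          have := (abs_apply_le_norm (q - q') j).trans h1
          simp only [PiLp.sub_apply] at this
          gcongr
      _ = B * (2 ^ m * ∑ l, |polyEval k (q - q') (y l)|) := by ring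
      _ ≤ B * ∑ _l : Fin (k + 1), 1 := by gcongr
      _ = _ := by simp
  · have := (hw.push f).ent_le_sum_push
    simp only [push_push] at this
    gcongr
    exact this

end FinMeas

namespace FinMeas

lemma mul_push_eq_bind {A : Type*} (α : FinMeas ℤ) (f : A → ℤ) (w : FinMeas A) :
    α * push f w = bind (fun q => push (· + f q) α) w := by
  rw [← bind_dirac_comp, bind_eq_sum, bind_eq_sum, Finset.mul_sum]
  exact Finset.sum_congr rfl fun q _ => by rw [mul_smul_comm, mul_dirac]

section block

variable {k : ℕ}

lemma le_condEnt_bind_law {μ : Measure ℝ} [IsProbabilityMeasure μ] (hμ : μ unitIᶜ = 0) {E C : ℕ}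
    {w : FinMeas (EuclideanSpace ℝ (Fin (k + 1)))} (hw : IsProb w) {i M : ℕ} (hMi : M ≤ i)
    (hcell : ∀ q ∈ w.coeff.support, ∀ q' ∈ w.coeff.support, cell i q = cell i q')
    (hP : ∀ q ∈ w.coeff.support, BiLip E (polyEval k q))
    {ψ : ℝ → ℝ} (hψ : BiLip E ψ) (hψm : MapsTo ψ unitI unitI)
    {h : ℝ → ℝ} (hh : BiLip C fun x => 2 ^ i * h x) (hm : MapsTo h unitI unitI) :
    ∃ g, BiLip (E * E * C : ℕ) g ∧ ∃ β : FinMeas ℤ, IsProb β ∧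
      (∃ b : ℤ, ∀ x ∈ β.coeff.support, b ≤ x ∧ x ≤ b + (2 * (k + 2) : ℕ) * 2 ^ M) ∧
      ent β = ent (push (fun q => ⌊(2 : ℝ) ^ (i + M) * polyEval k q (ψ (h 0))⌋) w) ∧
      ent (law μ (fun x => ⌊(2 : ℝ) ^ M * g x⌋) * β) ≤
        condEnt (· / 2 ^ M)
          (bind (fun q => law μ fun x => ⌊(2 : ℝ) ^ (i + M) * polyEval k q (ψ (h x))⌋) w) +
        (Real.log (2 * ((k + 1) * k * (E * C) + 2 : ℕ) + 1) +
          Real.log ((2 * (k + 1 + E * E * C + 1) : ℕ) + 1 + 1)) := by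
  obtain ⟨q₀, hq₀⟩ : w.coeff.support.Nonempty := by
    rw [Finset.nonempty_iff_ne_empty]
    intro h0
    have := hw.sum_coeff
    simp [h0] at this
  have h2i : (0 : ℝ) < 2 ^ i := by positivity
  have h2M : (0 : ℝ) < 2 ^ M := by positivity
  have hcoef : ∀ q ∈ w.coeff.support, ∀ j, |(q - q₀) j| ≤ ((2 : ℝ) ^ i)⁻¹ := fun q hq j => by
    have := two_pow_mul_abs_sub_le (congrFun (hcell q hq q₀ hq₀) j)
    rw [PiLp.sub_apply, ← one_div, le_div_iff₀' h2i]
    exact this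
  have hc : ∀ q ∈ w.coeff.support, ContinuousOn (fun x => (2 : ℝ) ^ (i + M) *
      polyEval k q (ψ (h x))) unitI := fun q hq => by
    refine ContinuousOn.const_mul_unitI ?_ _
    exact ((hP q hq).continuousOn.comp hψ.continuousOn hψm).comp
      ((continuousOn_const_mul_iff h2i.ne').1 hh.continuousOn) hm
  have hd : ∀ q ∈ w.coeff.support,
      Disc μ fun x => ⌊(2 : ℝ) ^ (i + M) * polyEval k q (ψ (h x))⌋ :=
    fun q hq => disc_floor hμ (hc q hq)
  have hg : BiLip (E * E * C : ℕ) fun x => 2 ^ i * polyEval k q₀ (ψ (h x)) := by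
    have h1 : BiLip (E * E) fun x => 1 * 1 * polyEval k q₀ (ψ x) :=
      BiLip.comp (by simpa using hP q₀ hq₀) (by simpa using hψ) hψm
    have h2 := BiLip.comp (b := 1) (a := 2 ^ i) (by simpa using h1) hh hm
    push_cast
    simpa using h2
  set y := ψ (h 0) with hy
  have hyI : y ∈ unitI := hψm (hm zero_mem_unitI)
  set Y : EuclideanSpace ℝ (Fin (k + 1)) → ℤ := fun q => ⌊(2 : ℝ) ^ (i + M) * polyEval k q y⌋
    with hY
  have hpow : (2 : ℝ) ^ (i + M) = 2 ^ M * 2 ^ i := by rw [pow_add, mul_comm]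
  have hval : ∀ q ∈ w.coeff.support,
      |(2 : ℝ) ^ (i + M) * polyEval k q y - 2 ^ (i + M) * polyEval k q₀ y| ≤ (k + 1) * 2 ^ M := by
    intro q hq
    rw [← mul_sub, ← polyEval_sub, abs_mul, abs_of_pos (by positivity), hpow]
    calc 2 ^ M * 2 ^ i * |polyEval k (q - q₀) y|
        ≤ 2 ^ M * 2 ^ i * ((k + 1) * ((2 : ℝ) ^ i)⁻¹) := by
          have := abs_polyEval_le (hcoef q hq) hyI
          gcongr
      _ = _ := by field_simp
  have hdiff : ∀ x ∈ unitI, (2 : ℝ) ^ i * |ψ (h x) - y| ≤ E * C := by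
    intro x hx
    have h1 := (hψ _ (hm hx) _ (hm zero_mem_unitI)).2
    have h2 := (hh x hx 0 zero_mem_unitI).2
    rw [← mul_sub, abs_mul, abs_of_pos h2i] at h2
    have h3 := abs_sub_le_one_of_mem_unitI hx zero_mem_unitI
    calc (2 : ℝ) ^ i * |ψ (h x) - y| ≤ 2 ^ i * (E * |h x - h 0|) := by gcongr
      _ = E * (2 ^ i * |h x - h 0|) := by ring
      _ ≤ E * (C * 1) := by
        have := h2.trans (mul_le_mul_of_nonneg_left h3 C.cast_nonneg)
        gcongr
      _ = _ := by ring
  have hlip : ∀ q ∈ w.coeff.support, ∀ x ∈ unitI, (2 : ℝ) ^ (i + M) *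
      |polyEval k (q - q₀) (ψ (h x)) - polyEval k (q - q₀) y| ≤ (k + 1) * k * (E * C) := by
    intro q hq x hx
    have h1 := abs_polyEval_sub_le (hcoef q hq) (hψm (hm hx)) hyI
    have h2 : (2 : ℝ) ^ M * (2 ^ i)⁻¹ ≤ 1 := by
      rw [← div_eq_mul_inv, div_le_one h2i]
      exact pow_le_pow_right₀ one_le_two hMi
    calc (2 : ℝ) ^ (i + M) * |polyEval k (q - q₀) (ψ (h x)) - polyEval k (q - q₀) y|
        ≤ 2 ^ (i + M) * ((k + 1) * k * (2 ^ i)⁻¹ * |ψ (h x) - y|) := by gcongr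
      _ = (k + 1) * k * (2 ^ M * (2 ^ i)⁻¹) * (2 ^ i * |ψ (h x) - y|) := by rw [hpow]; ring
      _ ≤ (k + 1) * k * 1 * (E * C) := by
        have := hdiff x hx
        gcongr
      _ = _ := by ring
  have hval₀ : ∀ x ∈ unitI,
      |(2 : ℝ) ^ (i + M) * polyEval k q₀ (ψ (h x)) - 2 ^ (i + M) * polyEval k q₀ y| ≤
        E * E * C * 2 ^ M := by
    intro x hx
    have h1 := (hP q₀ hq₀ _ (hψm (hm hx)) _ hyI).2
    rw [← mul_sub, abs_mul, abs_of_pos (by positivity), hpow]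
    calc (2 : ℝ) ^ M * 2 ^ i * |polyEval k q₀ (ψ (h x)) - polyEval k q₀ y|
        ≤ 2 ^ M * 2 ^ i * (E * |ψ (h x) - y|) := by gcongr
      _ = 2 ^ M * E * (2 ^ i * |ψ (h x) - y|) := by ring
      _ ≤ 2 ^ M * E * (E * C) := by
        have := hdiff x hx
        gcongr
      _ = _ := by ring
  refine ⟨_, hg, push (fun q => Y q - Y q₀) w, hw.push _, ⟨-((k + 1) * 2 ^ M + 1), ?_⟩, ?_, ?_⟩
  · intro x hx
    obtain ⟨q, hq, hx'⟩ := exists_of_mem_support_push hx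
    have h1 : |Y q - Y q₀| ≤ ((k + 1) * 2 ^ M + 1 : ℕ) :=
      abs_floor_sub_floor_le (by push_cast; exact hval q hq)
    rw [hx', abs_le] at h1
    push_cast at h1 ⊢
    have : (1 : ℤ) ≤ 2 ^ M := one_le_pow₀ one_le_two
    constructor <;> nlinarith
  · have : (fun q => Y q - Y q₀) = (fun z => z - Y q₀) ∘ Y := rfl
    rw [this, ← push_push]
    exact ent_push_of_injective (hw.1.push _) (sub_left_injective)
  · have hα : Disc μ fun x => ⌊(2 : ℝ) ^ M * (2 ^ i * polyEval k q₀ (ψ (h x)))⌋ :=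
      disc_floor hμ (ContinuousOn.const_mul_unitI hg.continuousOn _)
    have hS : ∀ᵐ x ∂μ, x ∈ unitI := mem_ae_iff.2 hμ
    have hclose : ent (law μ (fun x => ⌊(2 : ℝ) ^ M * (2 ^ i * polyEval k q₀ (ψ (h x)))⌋) *
        push (fun q => Y q - Y q₀) w) ≤
        ent (bind (fun q => law μ fun x => ⌊(2 : ℝ) ^ (i + M) * polyEval k q (ψ (h x))⌋) w) +
          Real.log (2 * ((k + 1) * k * (E * C) + 2 : ℕ) + 1) := by
      rw [mul_push_eq_bind, bind_eq_sum, bind_eq_sum]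
      simp_rw [push_law hα]
      refine ent_mix_law_le_of_close (fun q _ => hw.1 q) hw.sum_coeff hd
        (fun q _ => hα.comp _) hS fun q hq x hx => ?_
      have h1 := hlip q hq x hx
      rw [polyEval_sub, polyEval_sub] at h1
      rw [← abs_of_pos (by positivity : (0 : ℝ) < 2 ^ (i + M)), ← abs_mul,
        abs_le] at h1
      simp only [Function.comp, ← mul_assoc, ← hpow]
      have f1 := Int.floor_le ((2 : ℝ) ^ (i + M) * polyEval k q (ψ (h x)))
      have f2 := Int.lt_floor_add_one ((2 : ℝ) ^ (i + M) * polyEval k q (ψ (h x)))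
      have f3 := Int.floor_le ((2 : ℝ) ^ (i + M) * polyEval k q₀ (ψ (h x)))
      have f4 := Int.lt_floor_add_one ((2 : ℝ) ^ (i + M) * polyEval k q₀ (ψ (h x)))
      have f5 := Int.floor_le ((2 : ℝ) ^ (i + M) * polyEval k q y)
      have f6 := Int.lt_floor_add_one ((2 : ℝ) ^ (i + M) * polyEval k q y)
      have f7 := Int.floor_le ((2 : ℝ) ^ (i + M) * polyEval k q₀ y)
      have f8 := Int.lt_floor_add_one ((2 : ℝ) ^ (i + M) * polyEval k q₀ y)
      simp only [hY]
      rw [abs_le]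
      constructor
      · rw [← Int.cast_le (R := ℝ)]
        push_cast
        linarith
      · rw [← Int.cast_le (R := ℝ)]
        push_cast
        linarith
    have hΞ : IsProb (bind (fun q => law μ fun x =>
        ⌊(2 : ℝ) ^ (i + M) * polyEval k q (ψ (h x))⌋) w) :=
      hw.bind fun q hq => isProb_law (hd q hq)
    have hwin := hΞ.ent_push_div_le_of_window (n := 2 ^ M)
      (u := Y q₀ - (k + 1 + E * E * C + 1) * 2 ^ M)
      (N := 2 * (k + 1 + E * E * C + 1)) (by positivity) fun z hz => by
        obtain ⟨q, hq, hz⟩ := exists_of_mem_support_bind hz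
        obtain ⟨x, hx, rfl⟩ := (hd q hq).exists_of_mem_support hS hz
        have h1 := hlip q hq x hx
        have h2 := hval₀ x hx
        have h3 : |(2 : ℝ) ^ (i + M) * polyEval k q (ψ (h x)) -
            2 ^ (i + M) * polyEval k q₀ (ψ (h x))| ≤ (k + 1) * 2 ^ M := by
          rw [← mul_sub, ← polyEval_sub, abs_mul, abs_of_pos (by positivity), hpow]
          calc 2 ^ M * 2 ^ i * |polyEval k (q - q₀) (ψ (h x))|
              ≤ 2 ^ M * 2 ^ i * ((k + 1) * ((2 : ℝ) ^ i)⁻¹) := by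
                have := abs_polyEval_le (hcoef q hq) (hψm (hm hx))
                gcongr
            _ = _ := by field_simp
        have h4 : |⌊(2 : ℝ) ^ (i + M) * polyEval k q (ψ (h x))⌋ - Y q₀| ≤
            ((k + 1 + E * E * C) * 2 ^ M + 1 : ℕ) := by
          refine abs_floor_sub_floor_le ((abs_sub_le _ _ _).trans (add_le_add h3 h2) |>.trans ?_)
          push_cast
          exact le_of_eq (by ring)
        rw [abs_le] at h4
        push_cast at h4 ⊢
        have : (1 : ℤ) ≤ 2 ^ M := one_le_pow₀ one_le_two
        constructor <;> nlinarith
    rw [condEnt]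
    linarith

end block

end FinMeas

lemma BiLip.abs_sub_le_of_scale {C : ℝ} {i : ℕ} {h : ℝ → ℝ} (hh : BiLip C fun x => 2 ^ i * h x)
    {κ : ℝ} (hκ : C ≤ κ * 2 ^ i) {x y : ℝ} (hx : x ∈ unitI) (hy : y ∈ unitI) :
    |h x - h y| ≤ κ := by
  have h2 := (hh x hx y hy).2
  have h3 := abs_sub_le_one_of_mem_unitI hx hy
  have h2i : (0 : ℝ) < 2 ^ i := by positivity
  rw [← mul_sub, abs_mul, abs_of_pos h2i] at h2
  have h4 : 2 ^ i * |h x - h y| ≤ 2 ^ i * κ :=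
    h2.trans ((mul_le_of_le_one_right hh.pos.le h3).trans (hκ.trans_eq (mul_comm _ _)))
  exact le_of_mul_le_mul_left h4 h2i

/-- If `F` is large on average over all separated tuples, then it is large on average over the
pieces of a decomposition of `μ` into small images of itself. -/
lemma le_sum_pieces_of_separated {μ : Measure ℝ} [IsProbabilityMeasure μ] (hμ : μ unitIᶜ = 0)
    {k : ℕ} {a : Fin (k + 1) → ℝ} {κ c : ℝ}
    (ha : ∀ l l', l ≠ l' → 5 * κ ≤ |a l - a l'|) (hc0 : 0 < c)
    (hc : ∀ l, c ≤ μ.real (closedBall (a l) κ))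
    {n : ℕ} {p : Fin n → ℝ} {h : Fin n → ℝ → ℝ} (hp : ∀ u, 0 ≤ p u)
    (hm : ∀ u, MapsTo (h u) unitI unitI) (hcont : ∀ u, ContinuousOn (h u) unitI)
    (hsmall : ∀ u, ∀ x ∈ unitI, |h u x - h u 0| ≤ κ)
    (he : μ = ∑ u, ENNReal.ofReal (p u) • μ.map (h u))
    {F : ℝ → ℝ} (hF : ∀ z ∈ unitI, 0 ≤ F z) {T : ℝ}
    (hT : ∀ z : Fin (k + 1) → ℝ, (∀ l, z l ∈ unitI) → (∀ l l', l ≠ l' → κ ≤ |z l - z l'|) →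
      T ≤ ∑ l, F (z l)) :
    c * T / (k + 1) ≤ ∑ u, p u * F (h u 0) := by
  classical
  have hz : ∀ u, h u 0 ∈ unitI := fun u => hm u zero_mem_unitI
  obtain ⟨l, hl⟩ : ∃ l, ∀ z ∈ unitI, |z - a l| ≤ 2 * κ → T / (k + 1) ≤ F z := by
    by_contra! hcon
    choose z hzI hza hzF using hcon
    have h1 := hT z hzI fun l l' hll => by
      have h2 := ha l l' hll
      have h3 : |a l - a l'| ≤ |a l - z l| + |z l - z l'| + |z l' - a l'| := by
        have : a l - a l' = (a l - z l) + (z l - z l') + (z l' - a l') := by ring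
        rw [this]
        exact abs_add_three _ _ _
      have h4 := hza l
      rw [abs_sub_comm] at h4
      linarith [hza l']
    have h2 : ∑ l, F (z l) < ∑ _l : Fin (k + 1), T / (k + 1) :=
      Finset.sum_lt_sum_of_nonempty Finset.univ_nonempty fun l _ => hzF l
    simp only [Finset.sum_const, Finset.card_univ, Fintype.card_fin, nsmul_eq_mul] at h2
    push_cast at h2
    rw [mul_div_cancel₀ _ (by positivity)] at h2
    linarith
  rcases le_or_gt T 0 with hT0 | hT0
  · calc c * T / (k + 1) ≤ 0 :=
        div_nonpos_of_nonpos_of_nonneg (mul_nonpos_of_nonneg_of_nonpos hc0.le hT0) (by positivity)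
      _ ≤ _ := Finset.sum_nonneg fun u _ => mul_nonneg (hp u) (hF _ (hz u))
  have hmass : c ≤ ∑ u with |h u 0 - a l| ≤ 2 * κ, p u := by
    have h1 : μ (closedBall (a l) κ) ≤
        ∑ u with |h u 0 - a l| ≤ 2 * κ, ENNReal.ofReal (p u) := by
      calc μ (closedBall (a l) κ)
          = ∑ u, ENNReal.ofReal (p u) * μ.map (h u) (closedBall (a l) κ) := by
            conv_lhs => rw [he]
            simp
        _ ≤ ∑ u, if |h u 0 - a l| ≤ 2 * κ then ENNReal.ofReal (p u) else 0 := by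
            refine Finset.sum_le_sum fun u _ => ?_
            have hae := aemeasurable_of_continuousOn hμ (hcont u)
            rw [Measure.map_apply_of_aemeasurable hae measurableSet_closedBall]
            split_ifs with hu
            · exact mul_le_of_le_one_right' prob_le_one
            · have : μ (h u ⁻¹' closedBall (a l) κ) = 0 := by
                refine measure_mono_null (t := unitIᶜ) (fun x hx hxI => hu ?_) hμ
                have h2 : |h u x - a l| ≤ κ := hx
                have h3 := hsmall u x hxI
                rw [abs_sub_comm] at h3
                linarith [abs_sub_le (h u 0) (h u x) (a l)]
              rw [this, mul_zero]
        _ = _ := (Finset.sum_filter _ _).symm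
    refine (hc l).trans ?_
    rw [← ENNReal.ofReal_sum_of_nonneg fun u _ => hp u] at h1
    exact ENNReal.toReal_le_of_le_ofReal (Finset.sum_nonneg fun u _ => hp u) h1
  calc c * T / (k + 1) = c * (T / (k + 1)) := by ring
    _ ≤ (∑ u with |h u 0 - a l| ≤ 2 * κ, p u) * (T / (k + 1)) := by gcongr
    _ ≤ ∑ u with |h u 0 - a l| ≤ 2 * κ, p u * F (h u 0) := by
      rw [Finset.sum_mul]
      refine Finset.sum_le_sum fun u hu => ?_
      exact mul_le_mul_of_nonneg_left (hl _ (hz u) (Finset.mem_filter.1 hu).2) (hp u)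
    _ ≤ _ := Finset.sum_le_sum_of_subset_of_nonneg (Finset.subset_univ _) fun u _ _ =>
      mul_nonneg (hp u) (hF _ (hz u))

namespace FinMeas

/-- The law of `2 ^ m * q (ψ x)`, rounded, for `q` and `x` independent. -/
def actLaw {k : ℕ} (μ : Measure ℝ) (ψ : ℝ → ℝ) (m : ℕ)
    (w : FinMeas (EuclideanSpace ℝ (Fin (k + 1)))) : FinMeas ℤ :=
  bind (fun q => law μ fun x => ⌊(2 : ℝ) ^ m * polyEval k q (ψ x)⌋) w

section growth

variable {μ : Measure ℝ} {C : ℕ} {d : ℝ} {k : ℕ}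

lemma disc_polyEval (hμ : μ unitIᶜ = 0) {ψ : ℝ → ℝ} (hψ : ContinuousOn ψ unitI) (m : ℕ)
    (q : EuclideanSpace ℝ (Fin (k + 1))) :
    Disc μ fun x => ⌊(2 : ℝ) ^ m * polyEval k q (ψ x)⌋ :=
  disc_floor hμ (ContinuousOn.const_mul_unitI
    ((differentiable_polyEval q).continuous.comp_continuousOn hψ) _)

variable [IsProbabilityMeasure μ]

lemma IsProb.actLaw (hμ : μ unitIᶜ = 0) {ψ : ℝ → ℝ} (hψ : ContinuousOn ψ unitI) (m : ℕ)
    {w : FinMeas (EuclideanSpace ℝ (Fin (k + 1)))} (hw : IsProb w) :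
    IsProb (FinMeas.actLaw μ ψ m w) :=
  hw.bind fun q _ => isProb_law (disc_polyEval hμ hψ m q)

lemma condEnt_actLaw (hμ : μ unitIᶜ = 0) {ψ : ℝ → ℝ} (hψ : ContinuousOn ψ unitI) (i M : ℕ)
    (w : FinMeas (EuclideanSpace ℝ (Fin (k + 1)))) :
    condEnt (· / 2 ^ M) (actLaw μ ψ (i + M) w) =
      ent (actLaw μ ψ (i + M) w) - ent (actLaw μ ψ i w) := by
  rw [condEnt]
  congr 2
  rw [actLaw, push_bind]
  refine bind_congr fun q _ => ?_
  rw [push_law (disc_polyEval hμ hψ _ q)]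
  congr 1
  ext x
  simp [floor_two_pow_mul_ediv (Nat.le_add_left M i)]

lemma exists_le_condEnt_of_cell (hμ : μ unitIᶜ = 0) (hC : MultiScale μ C) (hd1 : d < 1)
    (hD : ∀ τ > 0, ∃ M₀ : ℕ, ∀ M, M₀ ≤ M →
      (d - τ) * M * Real.log 2 ≤ ent (law μ fun x => ⌊(2 : ℝ) ^ M * x⌋)) (k E : ℕ) {ε : ℝ}
    (hε : 0 < ε) :
    ∃ δ > 0, ∃ K, ∀ τ > 0, ∃ M₀ : ℕ, ∀ M, M₀ ≤ M → ∀ i, M ≤ i →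
      ∀ w : FinMeas (EuclideanSpace ℝ (Fin (k + 1))), IsProb w →
      (∀ q ∈ w.coeff.support, ∀ q' ∈ w.coeff.support, cell i q = cell i q') →
      (∀ q ∈ w.coeff.support, BiLip E (polyEval k q)) →
      ∀ ψ, BiLip E ψ → MapsTo ψ unitI unitI →
      ∀ h, (BiLip C fun x => 2 ^ i * h x) → MapsTo h unitI unitI →
      (d * Real.log 2 - τ) * M + δ * (ent (push (fun q => ⌊(2 : ℝ) ^ (i + M) *
        polyEval k q (ψ (h 0))⌋) w) - ε * M * Real.log 2) - K ≤
      condEnt (· / 2 ^ M)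
        (bind (fun q => law μ fun x => ⌊(2 : ℝ) ^ (i + M) * polyEval k q (ψ (h x))⌋) w) := by
  have hl : 0 < Real.log 2 := Real.log_pos one_lt_two
  set L : ℕ := E * E * C + 2 * (k + 2) with hL
  obtain ⟨δ, hδ, M₁, h1⟩ := ent_law_mul_growth hμ hC hd1 hD L hε
  refine ⟨δ / (2 * Real.log 2), by positivity,
    Real.log (2 * ((k + 1) * k * (E * C) + 2 : ℕ) + 1) +
      Real.log ((2 * (k + 1 + E * E * C + 1) : ℕ) + 1 + 1), fun τ hτ => ?_⟩
  obtain ⟨M₂, h2⟩ := le_ent_law_floor hμ hD L hτ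
  refine ⟨max (max M₁ M₂) ⌈Real.log (L + 1) / Real.log 2⌉₊, fun M hM i hi w hw hcell hP ψ hψ hψm
    h hh hm => ?_⟩
  have hM1 : M₁ ≤ M := (le_max_left _ _).trans ((le_max_left _ _).trans hM)
  have hM2 : M₂ ≤ M := (le_max_right _ _).trans ((le_max_left _ _).trans hM)
  have hM3 : Real.log (L + 1) ≤ M * Real.log 2 := by
    rw [← div_le_iff₀ hl]
    exact (Nat.le_ceil _).trans (Nat.cast_le.2 ((le_max_right _ _).trans hM))
  obtain ⟨g, hg, β, hβ, ⟨b, hb⟩, he, hle⟩ := le_condEnt_bind_law hμ hw hi hcell hP hψ hψm hh hm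
  have hg' : BiLip L g := hg.mono (Nat.cast_le.2 (Nat.le_add_right _ _))
  have hb' : ∀ x ∈ β.coeff.support, b ≤ x ∧ x ≤ b + L * 2 ^ M := fun x hx => by
    refine ⟨(hb x hx).1, (hb x hx).2.trans ?_⟩
    gcongr
    exact Nat.le_add_left _ _
  rw [← he]
  have hα : IsProb (law μ fun x => ⌊(2 : ℝ) ^ M * g x⌋) :=
    isProb_law (disc_floor hμ (ContinuousOn.const_mul_unitI hg.continuousOn _))
  have hgrow : (d * Real.log 2 - τ) * M + δ / (2 * Real.log 2) * (ent β - ε * M * Real.log 2) ≤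
      ent (law μ (fun x => ⌊(2 : ℝ) ^ M * g x⌋) * β) := by
    rcases le_or_gt (ε * M * Real.log 2) (ent β) with hcase | hcase
    · refine le_trans ?_ (h1 M hM1 g hg' β hβ ⟨b, hb'⟩ hcase)
      have hsub : β.coeff.support ⊆ Finset.Icc b (b + L * 2 ^ M) := fun x hx =>
        Finset.mem_Icc.2 (hb' x hx)
      have hcard : (β.coeff.support.card : ℝ) ≤ (L + 1) * 2 ^ M := by
        have h3 := Finset.card_le_card hsub
        rw [Int.card_Icc] at h3
        have h4 : (b + L * 2 ^ M + 1 - b).toNat = L * 2 ^ M + 1 := by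
          have : b + (L : ℤ) * 2 ^ M + 1 - b = ((L * 2 ^ M + 1 : ℕ) : ℤ) := by push_cast; ring
          rw [this, Int.toNat_natCast]
        rw [h4] at h3
        have h5 : (1 : ℝ) ≤ 2 ^ M := one_le_pow₀ one_le_two
        calc (β.coeff.support.card : ℝ) ≤ (L * 2 ^ M + 1 : ℕ) := Nat.cast_le.2 h3
          _ ≤ _ := by push_cast; linarith
      have hent := hβ.ent_le_log_card (by positivity) hcard
      rw [Real.log_mul (by positivity) (by positivity), Real.log_pow] at hent
      have h6 : ent β - ε * M * Real.log 2 ≤ 2 * Real.log 2 * M := by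
        have : 0 ≤ ε * M * Real.log 2 := by positivity
        linarith
      have h7 : δ / (2 * Real.log 2) * (ent β - ε * M * Real.log 2) ≤ δ * M := by
        calc _ ≤ δ / (2 * Real.log 2) * (2 * Real.log 2 * M) := by gcongr
          _ = _ := by field_simp
      have h8 : 0 ≤ τ * M := by positivity
      linarith
    · refine le_trans ?_ ((h2 M hM2 g hg').trans (ent_le_ent_mul hα hβ))
      have : δ / (2 * Real.log 2) * (ent β - ε * M * Real.log 2) ≤ 0 :=
        mul_nonpos_of_nonneg_of_nonpos (by positivity) (by linarith)
      linarith
  linarith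

lemma actLaw_eq_sum (hμ : μ unitIᶜ = 0) {ψ : ℝ → ℝ} (hψ : ContinuousOn ψ unitI) (m : ℕ)
    {n : ℕ} {p : Fin n → ℝ} {h : Fin n → ℝ → ℝ} (hp : ∀ u, 0 ≤ p u)
    (hh : ∀ u, ContinuousOn (h u) unitI) (hm : ∀ u, MapsTo (h u) unitI unitI)
    (he : μ = ∑ u, ENNReal.ofReal (p u) • μ.map (h u))
    (w : FinMeas (EuclideanSpace ℝ (Fin (k + 1)))) :
    actLaw μ ψ m w = ∑ u, p u •
      bind (fun q => law μ fun x => ⌊(2 : ℝ) ^ m * polyEval k q (ψ (h u x))⌋) w := by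
  rw [actLaw, ← bind_sum_smul]
  exact bind_congr fun q _ => law_floor_mix hμ hp hh hm he
    (g := fun x => (2 : ℝ) ^ m * polyEval k q (ψ x)) (ContinuousOn.const_mul_unitI
      ((differentiable_polyEval q).continuous.comp_continuousOn hψ) _)

lemma exists_block_growth (hμ : μ unitIᶜ = 0) (hC : MultiScale μ C) (hd1 : d < 1)
    (hD : ∀ τ > 0, ∃ M₀ : ℕ, ∀ M, M₀ ≤ M →
      (d - τ) * M * Real.log 2 ≤ ent (law μ fun x => ⌊(2 : ℝ) ^ M * x⌋)) {k : ℕ}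
    {a : Fin (k + 1) → ℝ} {κ c : ℝ} (hκ : 0 < κ)
    (ha : ∀ l l', l ≠ l' → 5 * κ ≤ |a l - a l'|) (hc0 : 0 < c)
    (hc : ∀ l, c ≤ μ.real (closedBall (a l) κ)) {E : ℕ} (hE : 0 < E) {ε : ℝ} (hε : 0 < ε) :
    ∃ δ > 0, ∃ K, ∀ τ > 0, ∃ M₀ : ℕ, ∀ M, M₀ ≤ M → ∀ i, M ≤ i →
      ∀ w : FinMeas (EuclideanSpace ℝ (Fin (k + 1))), IsProb w →
      (∀ q ∈ w.coeff.support, BiLip E (polyEval k q)) →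
      ∀ ψ, BiLip E ψ → MapsTo ψ unitI unitI →
      (d * Real.log 2 - τ) * M + δ * (c / (k + 1) *
        (ent (push (cell (i + M)) w) - ent (push (cell i) w)) - ε * M * Real.log 2) - K ≤
      ent (actLaw μ ψ (i + M) w) - ent (actLaw μ ψ i w) := by
  obtain ⟨δ, hδ, K, H⟩ := exists_le_condEnt_of_cell hμ hC hd1 hD k E hε
  obtain ⟨C₁, hC₁⟩ := exists_ent_cell_le_sum k (κ := κ / E) (by positivity)
  refine ⟨δ, hδ, K + δ * (c / (k + 1) * C₁), fun τ hτ => ?_⟩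
  obtain ⟨M₀, H⟩ := H τ hτ
  obtain ⟨M₁, hM₁⟩ := pow_unbounded_of_one_lt (C / κ) (one_lt_two (α := ℝ))
  refine ⟨max M₀ M₁, fun M hM i hi w hw hP ψ hψ hψm => ?_⟩
  have hM0 : M₀ ≤ M := (le_max_left _ _).trans hM
  have hCκ : (C : ℝ) ≤ κ * 2 ^ i := by
    rw [div_lt_iff₀' hκ] at hM₁
    refine hM₁.le.trans ?_
    gcongr
    · exact one_le_two
    · exact (le_max_right _ _).trans (hM.trans hi)
  obtain ⟨n, p, h, hp, hp1, hm, hh, he⟩ := hC i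
  have hcont : ∀ u, ContinuousOn (h u) unitI := fun u =>
    (continuousOn_const_mul_iff (by positivity)).1 (hh u).continuousOn
  obtain ⟨W, hW, hWc⟩ := hw.exists_fiber (cell i)
  set ν := push (cell i) w with hν
  have hνp : IsProb ν := hw.push _
  set f : (Fin (k + 1) → ℤ) → ℝ → ℝ := fun b z =>
    ent (push (fun q => ⌊(2 : ℝ) ^ (i + M) * polyEval k q (ψ z)⌋) (W b)) with hf
  have hT : ∀ z : Fin (k + 1) → ℝ, (∀ l, z l ∈ unitI) → (∀ l l', l ≠ l' → κ ≤ |z l - z l'|) →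
      ent (push (cell (i + M)) w) - ent ν - C₁ ≤
        ∑ l, ∑ b ∈ ν.coeff.support, ν.coeff b * f b (z l) := by
    intro z hz hsep
    have h1 : ent (push (cell (i + M)) w) ≤ ent ν +
        ∑ b ∈ ν.coeff.support, ν.coeff b * ent (push (cell (i + M)) (W b)) := by
      conv_lhs => rw [hW, push_bind]
      exact ent_bind_le hνp fun b hb => (hWc b hb).1.push _
    have h2 : ∑ b ∈ ν.coeff.support, ν.coeff b * ent (push (cell (i + M)) (W b)) ≤
        ∑ b ∈ ν.coeff.support, ν.coeff b * (∑ l, f b (z l) + C₁) := by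
      refine Finset.sum_le_sum fun b hb => mul_le_mul_of_nonneg_left ?_ (hνp.1 b)
      refine hC₁ (fun l => ψ (z l)) (fun l => hψm (hz l)) (fun l l' hll => ?_) (W b)
        (hWc b hb).1 (i + M)
      rw [div_le_iff₀' (by positivity)]
      exact (hsep l l' hll).trans (hψ _ (hz l) _ (hz l')).1
    simp only [mul_add, Finset.sum_add_distrib, ← Finset.sum_mul, hνp.sum_coeff, one_mul] at h2
    rw [Finset.sum_comm]
    simp only [Finset.mul_sum] at h2
    linarith
  have hsum := le_sum_pieces_of_separated hμ ha hc0 hc hp hm hcont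
    (fun u x hx => (hh u).abs_sub_le_of_scale hCκ hx zero_mem_unitI) he
    (F := fun z => ∑ b ∈ ν.coeff.support, ν.coeff b * f b z)
    (fun z _ => Finset.sum_nonneg fun b hb =>
      mul_nonneg (hνp.1 b) ((hWc b hb).1.push _).ent_nonneg) hT
  rw [← condEnt_actLaw hμ hψ.continuousOn]
  set A := (d * Real.log 2 - τ) * M - δ * (ε * M * Real.log 2) - K with hA
  have hcond : A + δ * ∑ u, p u * ∑ b ∈ ν.coeff.support, ν.coeff b * f b (h u 0) ≤
      condEnt (· / 2 ^ M) (actLaw μ ψ (i + M) w) := by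
    have h1 : actLaw μ ψ (i + M) w = bind (fun b => actLaw μ ψ (i + M) (W b)) ν := by
      conv_lhs => rw [hW, actLaw, bind_bind]
      rfl
    rw [h1]
    refine le_trans ?_ (le_condEnt_bind _ hνp fun b hb =>
      (hWc b hb).1.actLaw hμ hψ.continuousOn _)
    have h2 : ∀ b ∈ ν.coeff.support, A + δ * ∑ u, p u * f b (h u 0) ≤
        condEnt (· / 2 ^ M) (actLaw μ ψ (i + M) (W b)) := by
      intro b hb
      obtain ⟨hWp, hWs⟩ := hWc b hb
      rw [actLaw_eq_sum hμ hψ.continuousOn (i + M) hp hcont hm he]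
      refine le_trans ?_ (sum_condEnt_le _ _ (fun u _ => hp u) fun u _ => (hWp.bind fun q _ =>
        isProb_law (disc_polyEval (ψ := fun x => ψ (h u x)) hμ
          (hψ.continuousOn.comp (hcont u) (hm u)) _ q)).1)
      have h3 : ∀ u, A + δ * f b (h u 0) ≤ condEnt (· / 2 ^ M) (bind (fun q =>
          law μ fun x => ⌊(2 : ℝ) ^ (i + M) * polyEval k q (ψ (h u x))⌋) (W b)) := fun u => by
        refine le_trans (le_of_eq ?_) (H M hM0 i hi (W b) hWp
          (fun q hq q' hq' => (hWs q hq).2.trans (hWs q' hq').2.symm)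
          (fun q hq => hP q (hWs q hq).1) ψ hψ hψm (h u) (hh u) (hm u))
        rw [hA]
        ring
      calc A + δ * ∑ u, p u * f b (h u 0) = ∑ u, p u * (A + δ * f b (h u 0)) := by
            simp only [mul_add, Finset.sum_add_distrib, ← Finset.sum_mul, hp1, one_mul,
              Finset.mul_sum]
            congr 1
            exact Finset.sum_congr rfl fun u _ => by ring
        _ ≤ _ := Finset.sum_le_sum fun u _ => mul_le_mul_of_nonneg_left (h3 u) (hp u)
    calc A + δ * ∑ u, p u * ∑ b ∈ ν.coeff.support, ν.coeff b * f b (h u 0)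
        = ∑ b ∈ ν.coeff.support, ν.coeff b * (A + δ * ∑ u, p u * f b (h u 0)) := by
          simp only [mul_add, Finset.sum_add_distrib, ← Finset.sum_mul, hνp.sum_coeff, one_mul,
            Finset.mul_sum]
          congr 1
          rw [Finset.sum_comm]
          exact Finset.sum_congr rfl fun b _ => Finset.sum_congr rfl fun u _ => by ring
      _ ≤ _ := Finset.sum_le_sum fun b hb => mul_le_mul_of_nonneg_left (h2 b hb) (hνp.1 b)
  refine le_trans ?_ hcond
  have h4 := mul_le_mul_of_nonneg_left hsum hδ.le
  have h5 : c * (ent (push (cell (i + M)) w) - ent ν - C₁) / (k + 1) =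
      c / (k + 1) * (ent (push (cell (i + M)) w) - ent ν) - c / (k + 1) * C₁ := by ring
  rw [h5] at h4
  rw [hA]
  linarith

end growth

end FinMeas

namespace FinMeas

section cells

variable {k : ℕ} {w : FinMeas (EuclideanSpace ℝ (Fin (k + 1)))}

lemma IsProb.ent_push_cell_le_of_norm_le (hw : IsProb w) {E : ℕ}
    (hE : ∀ q ∈ w.coeff.support, ‖q‖ ≤ E) (m : ℕ) :
    ent (FinMeas.push (cell m) w) ≤
      (k + 1) * Real.log (2 * (2 ^ m * (2 * E) + 1 : ℕ) + 1) := by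
  have h := hw.ent_push_cell_le (fun _ => ()) (m := m) (R := 2 ^ m * (2 * E))
    fun q hq q' hq' _ j => by
      push_cast
      gcongr
      have h1 := (abs_apply_le_norm q j).trans (hE q hq)
      have h2 := (abs_apply_le_norm q' j).trans (hE q' hq')
      linarith [abs_sub (q j) (q' j)]
  rwa [hw.push_unit, ent_dirac, zero_add] at h

lemma IsProb.ent_push_cell_le_of_le (hw : IsProb w) {m n M : ℕ} (hn : n ≤ m + M) :
    ent (FinMeas.push (cell n) w) ≤
      ent (FinMeas.push (cell m) w) + (k + 1) * Real.log (2 * (2 ^ M + 1 : ℕ) + 1) := by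
  refine hw.ent_push_cell_le (cell m) (m := n) (R := 2 ^ M) fun q _ q' _ hqq j => ?_
  have h1 := two_pow_mul_abs_sub_le (congrFun hqq j)
  calc (2 : ℝ) ^ n * |q j - q' j| ≤ 2 ^ (m + M) * |q j - q' j| := by
        gcongr
        exact one_le_two
    _ = 2 ^ M * (2 ^ m * |q j - q' j|) := by rw [pow_add]; ring
    _ ≤ 2 ^ M * 1 := by gcongr
    _ = _ := by simp

end cells

section growth

variable {μ : Measure ℝ} [IsProbabilityMeasure μ] {C : ℕ} {d : ℝ} {k : ℕ}

lemma ent_actLaw_le_of_le (hμ : μ unitIᶜ = 0) {ψ : ℝ → ℝ} (hψ : ContinuousOn ψ unitI) {m n : ℕ}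
    (hmn : m ≤ n) {w : FinMeas (EuclideanSpace ℝ (Fin (k + 1)))} (hw : IsProb w) :
    ent (actLaw μ ψ m w) ≤ ent (actLaw μ ψ n w) := by
  obtain ⟨M, rfl⟩ := Nat.exists_eq_add_of_le hmn
  have h1 := condEnt_actLaw hμ hψ m M w
  have h2 := condEnt_nonneg (f := (· / 2 ^ M)) (hw.actLaw hμ hψ (m + M)).1
  linarith

/-- Entropy growth for the action of a finitely supported measure on polynomials. -/
theorem exists_ent_actLaw_growth (hμ : μ unitIᶜ = 0) (hC : MultiScale μ C) (hd1 : d < 1)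
    (hD : ∀ τ > 0, ∃ M₀ : ℕ, ∀ M, M₀ ≤ M →
      (d - τ) * M * Real.log 2 ≤ ent (law μ fun x => ⌊(2 : ℝ) ^ M * x⌋)) {k : ℕ}
    {a : Fin (k + 1) → ℝ} {κ c : ℝ} (hκ : 0 < κ)
    (ha : ∀ l l', l ≠ l' → 5 * κ ≤ |a l - a l'|) (hc0 : 0 < c)
    (hc : ∀ l, c ≤ μ.real (closedBall (a l) κ)) {E : ℕ} (hE : 0 < E) {ε : ℝ} (hε : 0 < ε) :
    ∃ σ > 0, ∃ K, ∀ n : ℕ,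
      ∀ w : FinMeas (EuclideanSpace ℝ (Fin (k + 1))), IsProb w →
      (∀ q ∈ w.coeff.support, ‖q‖ ≤ E ∧ BiLip E (polyEval k q)) →
      ε * n * Real.log 2 ≤ ent (push (cell n) w) →
      ∀ ψ, BiLip E ψ → MapsTo ψ unitI unitI →
      (d * Real.log 2 + σ) * n - K ≤ ent (actLaw μ ψ n w) := by
  have hl : 0 < Real.log 2 := Real.log_pos one_lt_two
  set c' := c / (k + 1) with hc'
  have hc'0 : 0 < c' := by positivity
  obtain ⟨δ, hδ, K₀, H⟩ := exists_block_growth hμ hC hd1 hD hκ ha hc0 hc hE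
    (ε := c' * ε / 2) (by positivity)
  set σ := δ * c' * ε * Real.log 2 / 8 with hσ
  have hσ0 : 0 < σ := by positivity
  obtain ⟨M₀, H⟩ := H σ hσ0
  set M := max (max M₀ 1) ⌈K₀ / σ⌉₊ with hM
  have hM0 : M₀ ≤ M := (le_max_left _ _).trans (le_max_left _ _)
  have hM1 : 1 ≤ M := (le_max_right _ _).trans (le_max_left _ _)
  have hMK : K₀ ≤ σ * M := by
    rw [← div_le_iff₀' hσ0]
    exact (Nat.le_ceil _).trans (Nat.cast_le.2 (le_max_right _ _))
  set K₁ := (k + 1) * Real.log (2 * (2 ^ M + 1 : ℕ) + 1) +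
    (k + 1) * Real.log (2 * (2 ^ M * (2 * E) + 1 : ℕ) + 1) with hK₁
  have hK₁0 : 0 ≤ K₁ := by
    have h1 : 0 ≤ Real.log (2 * (2 ^ M + 1 : ℕ) + 1) :=
      Real.log_nonneg (le_add_of_nonneg_left (by positivity))
    have h2 : 0 ≤ Real.log (2 * (2 ^ M * (2 * E) + 1 : ℕ) + 1) :=
      Real.log_nonneg (le_add_of_nonneg_left (by positivity))
    positivity
  refine ⟨σ, hσ0, δ * c' * K₁ + 2 * M * |d * Real.log 2| + (|d * Real.log 2| + σ) * M,
    fun n w hw hq hent ψ hψ hψm => ?_⟩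
  have hnonneg : ∀ m, 0 ≤ ent (actLaw μ ψ m w) := fun m =>
    (hw.actLaw hμ hψ.continuousOn m).ent_nonneg
  rcases lt_or_ge n M with hnM | hnM
  · refine le_trans ?_ (hnonneg n)
    have h1 : (n : ℝ) ≤ M := Nat.cast_le.2 hnM.le
    have h2 : (d * Real.log 2 + σ) * n ≤ (|d * Real.log 2| + σ) * M := by
      refine mul_le_mul (by gcongr; exact le_abs_self _) h1 (by positivity) (by positivity)
    have h3 : 0 ≤ δ * c' * K₁ + 2 * M * |d * Real.log 2| := by positivity
    linarith
  obtain ⟨r, hr⟩ : ∃ r, n / M = r + 1 :=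
    Nat.exists_eq_succ_of_ne_zero (Nat.div_pos hnM hM1).ne'
  have hrn : (r + 1) * M ≤ n := by rw [← hr]; exact Nat.div_mul_le_self n M
  have hnr : n ≤ (r + 1) * M + M := by
    have := Nat.lt_div_mul_add (a := n) hM1
    rw [hr] at this
    exact this.le
  set A := (d * Real.log 2 - σ) * M - δ * (c' * ε / 2 * M * Real.log 2) - K₀ with hA
  have htel : ∀ s : ℕ, s * A + δ * c' * (ent (push (cell ((s + 1) * M)) w) - ent (push (cell M) w))
      ≤ ent (actLaw μ ψ ((s + 1) * M) w) - ent (actLaw μ ψ M w) := by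
    intro s
    induction s with
    | zero => simp
    | succ s ih =>
      have h1 := H M hM0 ((s + 1) * M) (Nat.le_mul_of_pos_left M s.succ_pos) w hw
        (fun q h => (hq q h).2) ψ hψ hψm
      have h2 : (s + 1) * M + M = (s + 1 + 1) * M := by ring
      rw [h2] at h1
      push_cast
      rw [hA] at ih ⊢
      nlinarith
  have h1 := htel r
  have h2 := ent_actLaw_le_of_le hμ hψ.continuousOn hrn hw
  have h3 := hw.ent_push_cell_le_of_le hnr
  have h4 := hw.ent_push_cell_le_of_norm_le (fun q h => (hq q h).1) M
  have h5 : δ * c' * (ε * n * Real.log 2 - K₁) ≤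
      δ * c' * (ent (push (cell ((r + 1) * M)) w) - ent (push (cell M) w)) := by
    exact mul_le_mul_of_nonneg_left (by linarith) (by positivity)
  have hrn' : (r : ℝ) * M ≤ n := by
    have : ((r + 1) * M : ℕ) ≤ (n : ℝ) := Nat.cast_le.2 hrn
    push_cast at this
    linarith [(Nat.cast_nonneg M : (0 : ℝ) ≤ M)]
  have hnr' : (n : ℝ) - r * M ≤ 2 * M := by
    have : (n : ℝ) ≤ ((r + 1) * M + M : ℕ) := Nat.cast_le.2 hnr
    push_cast at this
    linarith
  have h6 : d * Real.log 2 * n - 2 * M * |d * Real.log 2| ≤ d * Real.log 2 * (r * M) := by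
    have : d * Real.log 2 * (n - r * M) ≤ |d * Real.log 2| * (2 * M) :=
      mul_le_mul (le_abs_self _) hnr' (by linarith) (abs_nonneg _)
    linarith
  have h7 : r * K₀ ≤ σ * n := by
    calc r * K₀ ≤ r * (σ * M) := by gcongr
      _ = σ * (r * M) := by ring
      _ ≤ _ := by gcongr
  have h8 : σ * (r * M) ≤ σ * n := by gcongr
  have h9 : (r : ℝ) * A = d * Real.log 2 * (r * M) - σ * (r * M) - 4 * (σ * (r * M)) - r * K₀ := by
    rw [hA, hσ]; ring
  have h10 : δ * c' * (ε * n * Real.log 2) = 8 * (σ * n) := by rw [hσ]; ring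
  have h11 : 0 ≤ (|d * Real.log 2| + σ) * M := by positivity
  have h12 := hnonneg M
  have h13 : 0 ≤ σ * n := by positivity
  rw [mul_sub, h10] at h5
  linarith

end growth

end FinMeas

lemma bilip_of_derivWithin {ψ : ℝ → ℝ} (hψ : DifferentiableOn ℝ ψ unitI) {ε : ℝ} (hε : 0 < ε)
    (h : ∀ x ∈ unitI, ε ≤ |derivWithin ψ unitI x| ∧ |derivWithin ψ unitI x| ≤ ε⁻¹) :
    BiLip ε⁻¹ ψ := by
  have key : ∀ x ∈ unitI, ∀ y ∈ unitI, x < y →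
      |x - y| ≤ ε⁻¹ * |ψ x - ψ y| ∧ |ψ x - ψ y| ≤ ε⁻¹ * |x - y| := by
    intro x hx y hy hxy
    have hsub : Icc x y ⊆ unitI := Icc_subset_Icc hx.1 hy.2
    obtain ⟨c, hc, hs⟩ := exists_hasDerivAt_eq_slope ψ (derivWithin ψ unitI) hxy
      (hψ.continuousOn.mono hsub) fun z hz =>
        (hψ z (hsub (Ioo_subset_Icc_self hz))).hasDerivWithinAt.hasDerivAt
          (Icc_mem_nhds (hx.1.trans_lt hz.1) (hz.2.trans_le hy.2))
    have hcI := hsub (Ioo_subset_Icc_self hc)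
    have he : |ψ x - ψ y| = |derivWithin ψ unitI c| * |x - y| := by
      rw [hs, abs_div, abs_sub_comm x y, abs_sub_comm (ψ x) (ψ y),
        div_mul_cancel₀ _ (abs_pos.2 (sub_pos.2 hxy).ne').ne']
    rw [he, ← mul_assoc]
    constructor
    · refine le_mul_of_one_le_left (abs_nonneg _) ?_
      calc (1 : ℝ) = ε⁻¹ * ε := by field_simp
        _ ≤ _ := by
          have := (h c hcI).1
          gcongr
    · have := (h c hcI).2
      gcongr
  intro x hx y hy
  rcases lt_trichotomy x y with hxy | rfl | hxy
  · exact key x hx y hy hxy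
  · simp
  · rw [abs_sub_comm x y, abs_sub_comm (ψ x) (ψ y)]
    exact key y hy x hx hxy

lemma measure_msupp_compl {X : Type*} [TopologicalSpace X] [MeasurableSpace X]
    [SecondCountableTopology X] (θ : Measure X) : θ (msupp θ)ᶜ = 0 := by
  refine measure_null_of_locally_null _ fun x hx => ?_
  simp only [msupp, mem_compl_iff, mem_ofPred_eq, not_forall, not_not] at hx
  obtain ⟨U, hU, hxU, h0⟩ := hx
  exact ⟨U, mem_nhdsWithin_of_mem_nhds (hU.mem_nhds hxU), h0⟩

namespace FinMeas

section law

variable {Ω Ω' A B : Type*} [MeasurableSpace Ω] [MeasurableSpace Ω'] {P : Measure Ω}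

lemma neg_tsum_logb_eq {F : Ω → A} (hF : Disc P F) :
    -∑' b, (P (F ⁻¹' {b})).toReal * Real.logb 2 (P (F ⁻¹' {b})).toReal =
      ent (law P F) / Real.log 2 := by
  have hc : ∀ b, (P (F ⁻¹' {b})).toReal = (law P F).coeff b := fun b => (coeff_law hF b).symm
  simp only [hc]
  rw [tsum_eq_sum (s := (law P F).coeff.support) fun b hb => by
    rw [Finsupp.notMem_support_iff.1 hb, zero_mul], ent_eq_sum _ subset_rfl, Finset.sum_div,
    ← Finset.sum_neg_distrib]
  refine Finset.sum_congr rfl fun b _ => ?_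
  rw [Real.negMulLog, Real.logb]
  ring

lemma disc_of_abs_le {F : Ω → ℤ} (hF : ∀ b, MeasurableSet (F ⁻¹' {b})) {N : ℤ}
    (hN : ∀ᵐ ω ∂P, |F ω| ≤ N) : Disc P F :=
  ⟨fun b => (hF b).nullMeasurableSet, Finset.Icc (-N) N,
    hN.mono fun _ h => Finset.mem_Icc.2 (abs_le.1 h)⟩

/-- The law of a function of an independent pair, as a mixture over the first component. -/
lemma law_prod {Q : Measure Ω'} [IsFiniteMeasure P] [IsFiniteMeasure Q] {F : Ω → A}
    (hF : ∀ b, MeasurableSet (F ⁻¹' {b})) (hFd : Disc P F) {G : A → Ω' → B}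
    (hG : ∀ a b, MeasurableSet (G a ⁻¹' {b})) (hGd : ∀ a, Disc Q (G a))
    (hd : Disc (P.prod Q) fun z => G (F z.1) z.2) :
    law (P.prod Q) (fun z => G (F z.1) z.2) = bind (fun a => law Q (G a)) (law P F) := by
  ext b
  rw [coeff_law hd, bind_eq_sum]
  simp only [AddMonoidAlgebra.coeff_sum, Finsupp.coe_finsetSum, Finset.sum_apply,
    AddMonoidAlgebra.coeff_smul, Finsupp.coe_smul, Pi.smul_apply, smul_eq_mul, coeff_law hFd,
    coeff_law (hGd _)]
  have hae : ∀ᵐ z ∂P.prod Q, F z.1 ∈ (law P F).coeff.support := by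
    suffices h : ∀ᵐ ω ∂P, F ω ∈ (law P F).coeff.support from
      Measure.quasiMeasurePreserving_fst.ae h
    obtain ⟨s, hs⟩ := hFd.2
    have hnull : ∀ᵐ ω ∂P, ∀ a ∈ s, P (F ⁻¹' {a}) = 0 → F ω ≠ a := by
      rw [Finset.eventually_all]
      intro a _
      by_cases h0 : P (F ⁻¹' {a}) = 0
      · filter_upwards [compl_mem_ae_iff.2 h0] with ω hω _ hne
        exact hω hne
      · exact Eventually.of_forall fun _ h => absurd h h0
    filter_upwards [hs, hnull] with ω h1 h2
    rw [Finsupp.mem_support_iff, coeff_law hFd]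
    intro h0
    exact h2 _ h1 ((measureReal_eq_zero_iff).1 h0) rfl
  have hset : (fun z : Ω × Ω' => G (F z.1) z.2) ⁻¹' {b} =ᵐ[P.prod Q]
      ⋃ a ∈ (law P F).coeff.support, (F ⁻¹' {a}) ×ˢ (G a ⁻¹' {b}) := by
    filter_upwards [hae] with z hz
    refine propext ⟨fun h => ?_, fun h => ?_⟩
    · exact mem_iUnion₂.2 ⟨F z.1, hz, rfl, h⟩
    · obtain ⟨a, -, ha, hb⟩ := mem_iUnion₂.1 h
      have ha' : F z.1 = a := ha
      change G (F z.1) z.2 = b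
      rw [ha']
      exact hb
  rw [measureReal_congr hset, measureReal_biUnion_finset]
  · exact Finset.sum_congr rfl fun a _ => measureReal_prod_prod _ _
  · intro a _ a' _ hne
    refine disjoint_left.2 fun z h h' => hne ?_
    exact (show F z.1 = a from h.1).symm.trans h'.1
  · exact fun a _ => (hF a).prod (hG a b)

end law

section reduction

variable {k : ℕ}

lemma measurableSet_cell (n : ℕ) (b : Fin (k + 1) → ℤ) :
    MeasurableSet (cell (k := k) n ⁻¹' {b}) := by
  have : Measurable (cell (k := k) n) := by
    unfold cell
    fun_prop
  exact this (measurableSet_singleton b)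

lemma vcell_eq (n : ℕ) (m : Fin (k + 1) → ℤ) : vcell (k + 1) n m = cell n ⁻¹' {m} := by
  ext q
  simp only [vcell, mem_ofPred_eq, mem_Ico, mem_preimage, mem_singleton_iff, funext_iff, cell,
    Int.floor_eq_iff, mul_comm ((2 : ℝ) ^ n)]
  refine forall_congr' fun j => ?_
  rw [div_le_iff₀ (by positivity), lt_div_iff₀ (by positivity)]

lemma dyadIco_eq (n : ℕ) (m : ℤ) : dyadIco n m = (fun x : ℝ => ⌊(2 : ℝ) ^ n * x⌋) ⁻¹' {m} := by
  ext x
  simp only [dyadIco, mem_Ico, mem_preimage, mem_singleton_iff, Int.floor_eq_iff,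
    mul_comm ((2 : ℝ) ^ n)]
  rw [div_le_iff₀ (by positivity), lt_div_iff₀ (by positivity)]

lemma abs_floor_le {a : ℝ} {N : ℕ} (h : |a| ≤ N) : |⌊a⌋| ≤ (N + 1 : ℕ) := by
  simpa using abs_floor_sub_floor_le (a := a) (b := 0) (by simpa using h)

lemma abs_floor_two_pow_mul_le {a : ℝ} {n R : ℕ} (h : |a| ≤ R) :
    |⌊(2 : ℝ) ^ n * a⌋| ≤ (2 ^ n * R + 1 : ℕ) := by
  refine abs_floor_le ?_
  rw [abs_mul, abs_of_pos (by positivity)]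
  push_cast
  gcongr

lemma disc_cell {ν : Measure (EuclideanSpace ℝ (Fin (k + 1)))} {R : ℕ}
    (hR : ∀ᵐ q ∂ν, ‖q‖ ≤ R) (n : ℕ) : Disc ν (cell n) := by
  refine ⟨fun b => (measurableSet_cell n b).nullMeasurableSet,
    Fintype.piFinset fun _ => Finset.Icc (-((2 ^ n * R + 1 : ℕ) : ℤ)) (2 ^ n * R + 1 : ℕ), ?_⟩
  filter_upwards [hR] with q hq
  rw [Fintype.mem_piFinset]
  exact fun j => Finset.mem_Icc.2 (abs_le.1
    (abs_floor_two_pow_mul_le ((abs_apply_le_norm q j).trans hq)))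

/-- The entropy of `ν.(ψμ)` is comparable to that of the action of a finitely supported measure
with the same coefficient entropy as `ν`. -/
lemma exists_finMeas_ent_actLaw_le {μ : Measure ℝ} [IsProbabilityMeasure μ] (hμ : μ unitIᶜ = 0)
    {ψ : ℝ → ℝ} (hψ : ContinuousOn ψ unitI) (hψm : MapsTo ψ unitI unitI)
    {ν : Measure (EuclideanSpace ℝ (Fin (k + 1)))} [IsProbabilityMeasure ν] {R : ℕ}
    (hR : ∀ q ∈ msupp ν, ‖q‖ ≤ R) (n : ℕ) :
    ∃ w : FinMeas (EuclideanSpace ℝ (Fin (k + 1))), IsProb w ∧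
      (∀ q ∈ w.coeff.support, q ∈ msupp ν) ∧
      ent (push (cell n) w) = entV (k + 1) n ν * Real.log 2 ∧
      ent (actLaw μ ψ n w) ≤
        ent1 n (pact k ν (μ.map ψ)) * Real.log 2 + Real.log (2 * (k + 1 + 1 : ℕ) + 1) := by
  classical
  have hl : 0 < Real.log 2 := Real.log_pos one_lt_two
  have hae : ∀ᵐ q ∂ν, q ∈ msupp ν := mem_ae_iff.2 (measure_msupp_compl ν)
  have hcell : Disc ν (cell n) := disc_cell (hae.mono hR) n
  obtain ⟨q₀, hq₀⟩ := hae.exists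
  have hr : ∀ b : Fin (k + 1) → ℤ, ∃ q ∈ msupp ν,
      ∀ q' ∈ msupp ν, cell n q' = b → cell n q = b := fun b => by
    by_cases h : ∃ q ∈ msupp ν, cell n q = b
    · obtain ⟨q, hq, hqb⟩ := h
      exact ⟨q, hq, fun _ _ _ => hqb⟩
    · push Not at h
      exact ⟨q₀, hq₀, fun q' hq' hb => absurd hb (h q' hq')⟩
  choose r hrm hrc using hr
  set θ := law ν (cell n) with hθ
  have hθp : IsProb θ := isProb_law hcell
  refine ⟨push r θ, hθp.push r, fun q hq => ?_, ?_, ?_⟩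
  · obtain ⟨b, -, rfl⟩ := exists_of_mem_support_push hq
    exact hrm b
  · have h1 : push (cell n) (push r θ) = θ := by
      rw [push_push]
      conv_rhs => rw [← push_id θ]
      refine push_congr fun b hb => ?_
      obtain ⟨q, hq, hqb⟩ := hcell.exists_of_mem_support hae hb
      exact hrc b q hq hqb
    rw [h1, entV]
    simp only [vcell_eq]
    rw [neg_tsum_logb_eq hcell, div_mul_cancel₀ _ hl.ne']
  · have hψa : AEMeasurable ψ μ := aemeasurable_of_continuousOn hμ hψ
    have hQ : IsProbabilityMeasure (μ.map ψ) := Measure.isProbabilityMeasure_map hψa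
    have hQI : μ.map ψ unitIᶜ = 0 := map_compl_eq_zero hμ hψ hψm
    have hS : ∀ᵐ z ∂ν.prod (μ.map ψ), z ∈ {z : EuclideanSpace ℝ (Fin (k + 1)) × ℝ |
        z.1 ∈ msupp ν ∧ z.2 ∈ unitI} :=
      (Measure.quasiMeasurePreserving_fst.ae hae).and
        (Measure.quasiMeasurePreserving_snd.ae (mem_ae_iff.2 hQI))
    have hbd : ∀ q ∈ msupp ν, ∀ x ∈ unitI,
        |⌊(2 : ℝ) ^ n * polyEval k q x⌋| ≤ (2 ^ n * ((k + 1) * R) + 1 : ℕ) := fun q hq x hx => by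
      refine abs_floor_two_pow_mul_le ?_
      push_cast
      exact abs_polyEval_le (fun j => (abs_apply_le_norm q j).trans (hR q hq)) hx
    have hmeas : Measurable fun z : EuclideanSpace ℝ (Fin (k + 1)) × ℝ =>
        ⌊(2 : ℝ) ^ n * polyEval k z.1 z.2⌋ :=
      (continuous_uncurry_polyEval.measurable.const_mul _).floor
    have hG : ∀ b : Fin (k + 1) → ℤ, Measurable fun x =>
        ⌊(2 : ℝ) ^ n * polyEval k (r b) x⌋ := fun b => hmeas.comp measurable_prodMk_left
    have hT : Disc (ν.prod (μ.map ψ)) fun z => ⌊(2 : ℝ) ^ n * polyEval k z.1 z.2⌋ :=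
      disc_of_abs_le (fun b => hmeas (measurableSet_singleton b))
        (hS.mono fun z hz => hbd _ hz.1 _ hz.2)
    have hT' : Disc (ν.prod (μ.map ψ)) fun z =>
        ⌊(2 : ℝ) ^ n * polyEval k (r (cell n z.1)) z.2⌋ := by
      refine disc_of_abs_le (fun t => ?_) (hS.mono fun z hz => hbd _ (hrm _) _ hz.2)
      have : (fun z : EuclideanSpace ℝ (Fin (k + 1)) × ℝ =>
          ⌊(2 : ℝ) ^ n * polyEval k (r (cell n z.1)) z.2⌋) ⁻¹' {t} =
          ⋃ b, (cell n ⁻¹' {b}) ×ˢ ((fun x => ⌊(2 : ℝ) ^ n * polyEval k (r b) x⌋) ⁻¹' {t}) := by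
        ext z
        simp
      rw [this]
      exact MeasurableSet.iUnion fun b =>
        (measurableSet_cell n b).prod (hG b (measurableSet_singleton t))
    have hGd : ∀ b, Disc (μ.map ψ) fun x => ⌊(2 : ℝ) ^ n * polyEval k (r b) x⌋ := fun b =>
      disc_floor hQI (ContinuousOn.const_mul_unitI
        (differentiable_polyEval _).continuous.continuousOn _)
    have hlaw : actLaw μ ψ n (push r θ) = law (ν.prod (μ.map ψ)) fun z =>
        ⌊(2 : ℝ) ^ n * polyEval k (r (cell n z.1)) z.2⌋ := by
      rw [law_prod (G := fun b x => ⌊(2 : ℝ) ^ n * polyEval k (r b) x⌋) (measurableSet_cell n)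
        hcell (fun b t => hG b (measurableSet_singleton t)) hGd hT', actLaw, bind_push]
      refine bind_congr fun b _ => ?_
      exact (law_floor_map hμ (g := fun x => (2 : ℝ) ^ n * polyEval k (r b) x)
        (ContinuousOn.const_mul_unitI (differentiable_polyEval _).continuous.continuousOn _)
        hψ hψm).symm
    have hclose := ent_mix_law_le_of_close (s := {()}) (c := fun _ => 1)
      (by simp) (by simp) (fun _ _ => hT) (fun _ _ => hT') hS (N := k + 1 + 1)
      fun _ _ z hz => by
        refine abs_floor_sub_floor_le ?_
        have h1 : cell n (r (cell n z.1)) = cell n z.1 := hrc _ _ hz.1 rfl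
        have h2 : ∀ j, |(z.1 - r (cell n z.1)) j| ≤ ((2 : ℝ) ^ n)⁻¹ := fun j => by
          have := two_pow_mul_abs_sub_le (congrFun h1.symm j)
          rw [PiLp.sub_apply, ← one_div, le_div_iff₀' (by positivity)]
          exact this
        have h3 := abs_polyEval_le h2 hz.2
        rw [polyEval_sub] at h3
        rw [← mul_sub, abs_mul, abs_of_pos (by positivity)]
        calc (2 : ℝ) ^ n * |polyEval k z.1 z.2 - polyEval k (r (cell n z.1)) z.2|
            ≤ 2 ^ n * ((k + 1) * ((2 : ℝ) ^ n)⁻¹) := by gcongr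
          _ = (k + 1 : ℕ) := by push_cast; field_simp
    simp only [Finset.sum_singleton, one_smul] at hclose
    have hpm : Measurable fun q : EuclideanSpace ℝ (Fin (k + 1)) × ℝ => polyEval k q.1 q.2 :=
      continuous_uncurry_polyEval.measurable
    have hFm : Measurable fun x : ℝ => ⌊(2 : ℝ) ^ n * x⌋ := by fun_prop
    have hF : Disc (pact k ν (μ.map ψ)) fun x => ⌊(2 : ℝ) ^ n * x⌋ := by
      refine disc_of_abs_le (fun b => hFm (measurableSet_singleton b))
        (N := (2 ^ n * ((k + 1) * R) + 1 : ℕ)) ?_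
      refine (ae_map_iff hpm.aemeasurable ?_).2 (hS.mono fun z hz => hbd _ hz.1 _ hz.2)
      exact (hFm (MeasurableSet.of_discrete (s := {t | |t| ≤ _})))
    have hent1 : ent1 n (pact k ν (μ.map ψ)) * Real.log 2 =
        ent (law (ν.prod (μ.map ψ)) fun z => ⌊(2 : ℝ) ^ n * polyEval k z.1 z.2⌋) := by
      rw [ent1]
      simp only [dyadIco_eq]
      rw [neg_tsum_logb_eq hF, div_mul_cancel₀ _ hl.ne', pact, law_map hpm.aemeasurable hF hT]
      rfl
    rw [hlaw, hent1]
    exact hclose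

end reduction

end FinMeas

theorem entropy_increase_polynomials
    {Λ : Type} [Fintype Λ] [Nonempty Λ]
    (φ : Λ → ℝ → ℝ)
    (hanal : ∀ i, AnalyticOnNhd ℝ (φ i) unitI)
    (hmaps : ∀ i, Set.MapsTo (φ i) unitI unitI)
    (hderiv : ∀ i, ∀ x ∈ unitI, 0 < |deriv (φ i) x| ∧ |deriv (φ i) x| < 1)
    (hnofix : ¬ ∃ x ∈ unitI, ∀ i, φ i x = x)
    (p : Λ → ℝ) (hp : ∀ i, 0 < p i) (hp1 : ∑ i, p i = 1)
    (μ : Measure ℝ) (hprob : IsProbabilityMeasure μ) (hμI : μ unitIᶜ = 0)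
    (hμ : μ = ∑ i : Λ, ENNReal.ofReal (p i) • Measure.map (φ i) μ)
    (dμ : ℝ) (hdim : ExactDimWith μ dμ) (hdμ : dμ < 1) :
    ∀ k : ℕ, 1 ≤ k → ∀ ε : ℝ, 0 < ε → ε < 1 →
      ∃ ρ : ℝ, 0 < ρ ∧ ∃ N : ℕ, 1 ≤ N ∧ ∀ n : ℕ, N ≤ n →
        ∀ ν : Measure (EuclideanSpace ℝ (Fin (k + 1))), IsProbabilityMeasure ν →
          (∃ S : Set (EuclideanSpace ℝ (Fin (k + 1))), IsCompact S ∧ ν Sᶜ = 0) →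
          (∀ q ∈ msupp ν, ‖q‖ ≤ ε⁻¹ ∧ ∀ x ∈ unitI, ε ≤ |deriv (polyEval k q) x|) →
          ε ≤ (1 / (n : ℝ)) * entV (k + 1) n ν →
          ∀ ψ : ℝ → ℝ, ContDiffOn ℝ 1 ψ unitI → Set.MapsTo ψ unitI unitI →
            (∀ x ∈ unitI, ε ≤ |derivWithin ψ unitI x| ∧ |derivWithin ψ unitI x| ≤ ε⁻¹) →
            dμ + ρ ≤ (1 / (n : ℝ)) * ent1 n (pact k ν (μ.map ψ)) := by
  intro k _ ε hε _
  have hl : 0 < Real.log 2 := Real.log_pos one_lt_two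
  obtain ⟨C, hC⟩ := exists_multiScale hanal hmaps hderiv (fun i => (hp i).le) hp1 hμI hμ
  obtain ⟨a, κ, hκ, c, hc0, -, ha, hc⟩ := exists_separated
    (infinite_setOf_measure_ball_pos hanal hmaps hderiv hnofix hp hμI hμ) (k + 1)
  obtain ⟨E, hE⟩ := exists_nat_ge (max ((k + 1) * k * ε⁻¹) ε⁻¹)
  have hE1 : (k + 1) * k * ε⁻¹ ≤ (E : ℝ) := (le_max_left _ _).trans hE
  have hE2 : ε⁻¹ ≤ (E : ℝ) := (le_max_right _ _).trans hE
  have hE0 : 0 < E := Nat.cast_pos.1 ((inv_pos.2 hε).trans_le hE2)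
  obtain ⟨σ, hσ, K, H⟩ := FinMeas.exists_ent_actLaw_growth hμI hC hdμ
    (fun τ hτ => FinMeas.le_ent_law_of_exactDimWith hμI hdμ hdim hτ) hκ ha hc0 hc hE0 hε
  set L := Real.log (2 * (k + 1 + 1 : ℕ) + 1) with hL
  refine ⟨σ / (2 * Real.log 2), by positivity, max 1 ⌈(K + L) / (σ / 2)⌉₊, le_max_left _ _, ?_⟩
  intro n hn ν hν _ hq hent ψ hψ hψm hψd
  have hn0 : (0 : ℝ) < n := Nat.cast_pos.2 ((le_max_left _ _).trans hn)
  have hnK : K + L ≤ n * (σ / 2) :=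
    (div_le_iff₀ (by positivity)).1 (Nat.ceil_le.1 ((le_max_right _ _).trans hn))
  obtain ⟨w, hw, hws, hwe, hwa⟩ := FinMeas.exists_finMeas_ent_actLaw_le hμI hψ.continuousOn hψm
    (fun q hqν => (hq q hqν).1.trans hE2) n
  have hent' : ε * n ≤ entV (k + 1) n ν := by
    rwa [one_div, inv_mul_eq_div, le_div_iff₀ hn0] at hent
  have hgrow := H n w hw
    (fun q hqw => have h := hq q (hws q hqw)
      ⟨h.1.trans hE2, bilip_polyEval hε h.1 h.2 hE1 hE2⟩)
    (by rw [hwe]; gcongr) ψ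
    ((bilip_of_derivWithin (hψ.differentiableOn one_ne_zero) hε hψd).mono hE2) hψm
  rw [one_div, inv_mul_eq_div, le_div_iff₀ hn0]
  refine le_of_mul_le_mul_right ?_ hl
  calc (dμ + σ / (2 * Real.log 2)) * n * Real.log 2
      = (dμ * Real.log 2 + σ) * n - n * (σ / 2) := by field_simp; ring
    _ ≤ _ := by linarith
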